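/- arXiv:2005.10403 — 2 statements merged into one kernel-verified Lean document; each statement's English description precedes it below -/
import Mathlib

section
/- Let x > 0 and α > 0, and let M := [[α+1]] be the largest integer strictly smaller than α+1. Suppose f : ℝ → ℂ is continuous, integrable, vanishes identically outside [−x, x], and there is a constant C > 0 such that its Fourier transform f̂(ξ) = ∫_ℝ f(t) e^{−iξt} dt satisfies |f̂(ξ)| ≤ C/|ξ|^{α+2} for all ξ ≠ 0. Then f is M times differentiable on ℝ, and for each m = 0, 1, …, M there exists a function r_m : [−x, x] → ℂ, bounded on [−x, x] and continuous on (−x, x), such that f^{(m)}(t) = (x² − t²)^{α+1−m} · r_m(t) for all t ∈ [−x, x]. -/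
open MeasureTheory Set Filter

/-- The Fourier transform `f̂(ξ) = ∫ f(t) e^{-iξt} dt`. -/
noncomputable def fourierT (f : ℝ → ℂ) (ξ : ℝ) : ℂ :=
  ∫ t : ℝ, f t * Complex.exp (-Complex.I * ξ * t)

open scoped FourierTransform

/-- A measurable function which is bounded near the origin and `O(|ξ|⁻ˢ)` away from it, with
`s > 1`, is integrable. -/
lemma integrable_of_norm_le_rpow_neg {E : Type*} [NormedAddCommGroup E] {g : ℝ → E} {K s : ℝ}
    (hg : AEStronglyMeasurable g volume) (hs : 1 < s)
    (hnear : ∀ ξ : ℝ, |ξ| ≤ 1 → ‖g ξ‖ ≤ K)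
    (hfar : ∀ ξ : ℝ, 1 < |ξ| → ‖g ξ‖ ≤ K * |ξ| ^ (-s)) : Integrable g := by
  have hK : 0 ≤ K := (norm_nonneg _).trans (hnear 0 (by simp))
  have hJ : Integrable (fun ξ : ℝ => (1 + ‖ξ‖) ^ (-s)) := integrable_one_add_norm (by simpa using hs)
  refine (hJ.const_mul (K * (2 : ℝ)⁻¹ ^ (-s))).mono' hg (Eventually.of_forall fun ξ => ?_)
  have hscale : K * (2 : ℝ)⁻¹ ^ (-s) * (1 + ‖ξ‖) ^ (-s) = K * ((1 + |ξ|) / 2) ^ (-s) := by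
    rw [mul_assoc, ← Real.mul_rpow (by norm_num) (by positivity), Real.norm_eq_abs]
    congr 2
    ring
  rw [hscale]
  rcases le_or_gt |ξ| 1 with h | h
  · refine (hnear ξ h).trans (le_mul_of_one_le_right hK ?_)
    exact Real.one_le_rpow_of_pos_of_le_one_of_nonpos (by positivity) (by linarith) (by linarith)
  · refine (hfar ξ h).trans (mul_le_mul_of_nonneg_left ?_ hK)
    exact Real.rpow_le_rpow_of_nonpos (by positivity) (by linarith) (by linarith)

lemma norm_one_sub_fourierChar_le_two (y : ℝ) : ‖1 - (Real.fourierChar y : ℂ)‖ ≤ 2 := by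
  refine (norm_sub_le _ _).trans ?_
  rw [norm_one, Circle.norm_coe]
  norm_num

lemma norm_one_sub_fourierChar_le (y : ℝ) :
    ‖1 - (Real.fourierChar y : ℂ)‖ ≤ 2 * Real.pi * |y| := by
  have h := Real.norm_exp_I_mul_ofReal_sub_one_le (x := 2 * Real.pi * y)
  rw [norm_sub_rev, Real.fourierChar_apply, mul_comm _ Complex.I]
  refine h.trans_eq ?_
  rw [Real.norm_eq_abs, abs_mul, abs_of_pos Real.two_pi_pos]

lemma integrable_norm_one_sub_fourierChar_pow_mul_rpow {β : ℝ} (hβ : 0 < β) {n : ℕ}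
    (hn : 1 + β ≤ n) :
    Integrable fun ξ : ℝ => ‖1 - (Real.fourierChar (-ξ) : ℂ)‖ ^ n * |ξ| ^ (-(1 + β)) := by
  have hmeas : Measurable fun ξ : ℝ => ‖1 - (Real.fourierChar (-ξ) : ℂ)‖ ^ n := by
    have : Continuous fun ξ : ℝ => (Real.fourierChar (-ξ) : ℂ) :=
      continuous_subtype_val.comp (Real.continuous_fourierChar.comp continuous_neg)
    exact ((continuous_const.sub this).norm.pow n).measurable
  have hpi : 2 ≤ 2 * Real.pi := by linarith [Real.pi_gt_three]
  refine integrable_of_norm_le_rpow_neg (K := (2 * Real.pi) ^ n) (s := 1 + β)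
    (hmeas.mul (by fun_prop)).aestronglyMeasurable (by linarith) (fun ξ hξ => ?_) (fun ξ hξ => ?_)
  · rw [Real.norm_of_nonneg (by positivity)]
    rcases eq_or_ne ξ 0 with rfl | h0
    · rw [abs_zero, Real.zero_rpow (by linarith), mul_zero]
      positivity
    have hpos : 0 < |ξ| := abs_pos.mpr h0
    calc ‖1 - (Real.fourierChar (-ξ) : ℂ)‖ ^ n * |ξ| ^ (-(1 + β))
        ≤ (2 * Real.pi * |ξ|) ^ n * |ξ| ^ (-(1 + β)) := by
          gcongr
          simpa using norm_one_sub_fourierChar_le (-ξ)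
      _ = (2 * Real.pi) ^ n * |ξ| ^ ((n : ℝ) + -(1 + β)) := by
          rw [mul_pow, Real.rpow_add hpos, Real.rpow_natCast, mul_assoc]
      _ ≤ (2 * Real.pi) ^ n :=
          mul_le_of_le_one_right (by positivity)
            (Real.rpow_le_one hpos.le hξ (by linarith))
  · rw [Real.norm_of_nonneg (by positivity)]
    gcongr
    exact (norm_one_sub_fourierChar_le_two _).trans hpi

/-- The `n`-th finite difference of a Fourier transform, as an integral. -/
lemma sum_choose_mul_fourier_eq_integral {G : ℝ → ℂ} (hG : Integrable G) (n : ℕ) (t d : ℝ) :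
    ∑ k ∈ Finset.range (n + 1), (-1 : ℂ) ^ k * (n.choose k : ℂ) * 𝓕 G (t + k * d) =
      ∫ ξ : ℝ, (Real.fourierChar (-(ξ * t)) : ℂ) *
        (1 - (Real.fourierChar (-(d * ξ)) : ℂ)) ^ n * G ξ := by
  have hint : ∀ w : ℝ, Integrable fun ξ : ℝ => Real.fourierChar (-(ξ * w)) • G ξ := fun w => by
    have := (Real.fourierIntegral_convergent_iff (μ := volume) (f := G) w).2 hG
    simpa [mul_comm] using this
  simp_rw [Real.fourier_real_eq, ← integral_const_mul]
  rw [← integral_finsetSum _ fun k _ => (hint _).const_mul _]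
  refine integral_congr_ae (Eventually.of_forall fun ξ => ?_)
  have hchar : ∀ k : ℕ, (Real.fourierChar (-(ξ * (t + k * d))) : ℂ) =
      (Real.fourierChar (-(ξ * t)) : ℂ) * (Real.fourierChar (-(d * ξ)) : ℂ) ^ k := fun k => by
    simp only [Real.fourierChar_apply, ← Complex.exp_nat_mul, ← Complex.exp_add]
    congr 1
    push_cast
    ring
  simp only [Circle.smul_def, smul_eq_mul, hchar]
  rw [sub_eq_neg_add, add_pow, Finset.mul_sum, Finset.sum_mul]
  refine Finset.sum_congr rfl fun k _ => ?_
  rw [neg_pow (Real.fourierChar (-(d * ξ)) : ℂ), one_pow]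
  ring

/-- If `G = O(|ξ|^{-(1+β)})`, then `𝓕 G` has size `O(|d|^β)` at every point `t` for which `𝓕 G`
vanishes along `t + d, t + 2d, …`. -/
lemma exists_norm_fourier_le_mul_rpow {G : ℝ → ℂ} {β K : ℝ} (hG : Integrable G) (hβ : 0 < β)
    (hK : ∀ ξ : ℝ, ξ ≠ 0 → ‖G ξ‖ ≤ K * |ξ| ^ (-(1 + β))) :
    ∃ B : ℝ, 0 ≤ B ∧ ∀ t d : ℝ, d ≠ 0 → (∀ k : ℕ, 1 ≤ k → 𝓕 G (t + k * d) = 0) →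
      ‖𝓕 G t‖ ≤ B * |d| ^ β := by
  have hK0 : 0 ≤ K := by simpa using (norm_nonneg _).trans (hK 1 one_ne_zero)
  obtain ⟨n, hn⟩ := exists_nat_ge (1 + β)
  set φ : ℝ → ℝ := fun ξ => ‖1 - (Real.fourierChar (-ξ) : ℂ)‖ ^ n * |ξ| ^ (-(1 + β)) with hφ
  have hφi : Integrable φ := integrable_norm_one_sub_fourierChar_pow_mul_rpow hβ hn
  refine ⟨K * ∫ ξ, φ ξ, mul_nonneg hK0 (integral_nonneg fun ξ => by positivity), ?_⟩
  intro t d hd hvanish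
  have hdpos : 0 < |d| := abs_pos.mpr hd
  have hsum := sum_choose_mul_fourier_eq_integral hG n t d
  rw [Finset.sum_range_succ', Finset.sum_eq_zero fun k _ => by
    rw [hvanish (k + 1) (by omega), mul_zero]] at hsum
  simp only [pow_zero, Nat.choose_zero_right, Nat.cast_one, mul_one, one_mul, Nat.cast_zero,
    zero_mul, add_zero, zero_add] at hsum
  rw [hsum]
  have hbound : ∀ᵐ ξ : ℝ, ‖(Real.fourierChar (-(ξ * t)) : ℂ) *
      (1 - (Real.fourierChar (-(d * ξ)) : ℂ)) ^ n * G ξ‖ ≤ K * |d| ^ (1 + β) * φ (d * ξ) := by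
    filter_upwards [Measure.ae_ne volume (0 : ℝ)] with ξ hξ
    rw [norm_mul, norm_mul, Circle.norm_coe, one_mul, norm_pow]
    calc ‖1 - (Real.fourierChar (-(d * ξ)) : ℂ)‖ ^ n * ‖G ξ‖
        ≤ ‖1 - (Real.fourierChar (-(d * ξ)) : ℂ)‖ ^ n * (K * |ξ| ^ (-(1 + β))) := by
          gcongr
          exact hK ξ hξ
      _ = ‖1 - (Real.fourierChar (-(d * ξ)) : ℂ)‖ ^ n * (K * |ξ| ^ (-(1 + β))) *
          (|d| ^ (1 + β) * |d| ^ (-(1 + β))) := by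
          rw [← Real.rpow_add hdpos, add_neg_cancel, Real.rpow_zero, mul_one]
      _ = K * |d| ^ (1 + β) * φ (d * ξ) := by
          simp only [hφ]
          rw [abs_mul, Real.mul_rpow hdpos.le (abs_nonneg ξ)]
          ring
  refine (norm_integral_le_of_norm_le ((hφi.comp_mul_left' hd).const_mul _) hbound).trans_eq ?_
  rw [integral_const_mul, Measure.integral_comp_mul_left, smul_eq_mul, abs_inv,
    Real.rpow_add hdpos, Real.rpow_one]
  field_simp

lemma tsupport_iteratedDeriv_subset {𝕜 E : Type*} [NontriviallyNormedField 𝕜]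
    [NormedAddCommGroup E] [NormedSpace 𝕜 E] (f : 𝕜 → E) (m : ℕ) :
    tsupport (iteratedDeriv m f) ⊆ tsupport f := by
  induction m with
  | zero => rw [iteratedDeriv_zero]
  | succ m ih =>
    rw [iteratedDeriv_succ]
    exact tsupport_deriv_subset.trans ih

lemma iteratedDeriv_eq_zero_of_notMem_Ioo {E : Type*} [NormedAddCommGroup E] [NormedSpace ℝ E]
    {f : ℝ → E} {a b : ℝ} (hf : ∀ t ∉ Set.Icc a b, f t = 0) {m : ℕ}
    (hm : Continuous (iteratedDeriv m f)) {t : ℝ} (ht : t ∉ Set.Ioo a b) :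
    iteratedDeriv m f t = 0 := by
  by_contra h
  have hsub : Function.support (iteratedDeriv m f) ⊆ Set.Icc a b :=
    ((subset_tsupport _).trans (tsupport_iteratedDeriv_subset f m)).trans
      (closure_minimal (fun s hs => by_contra fun hs' => hs (hf s hs')) isClosed_Icc)
  have hmem := interior_maximal hsub hm.isOpen_support h
  rw [interior_Icc] at hmem
  exact ht hmem

lemma fourierT_two_pi_mul (f : ℝ → ℂ) (ξ : ℝ) : fourierT f (2 * Real.pi * ξ) = 𝓕 f ξ := by
  rw [fourierT, Real.fourier_real_eq_integral_exp_smul]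
  refine integral_congr_ae (Eventually.of_forall fun t => ?_)
  simp only [smul_eq_mul]
  rw [mul_comm]
  congr 2
  push_cast
  ring

/-- A continuous compactly supported function vanishing to order `β` at both ends of `[-x, x]` is
`(x² - t²)^β` times a bounded function. -/
lemma exists_factorization_of_norm_le {g : ℝ → ℂ} {x β B : ℝ} (hx : 0 < x) (hβ : 0 < β)
    (hB : 0 ≤ B) (hg : Continuous g) (hzero : ∀ t ∉ Set.Ioo (-x) x, g t = 0)
    (hright : ∀ t ∈ Set.Ioo (-x) x, ‖g t‖ ≤ B * (x - t) ^ β)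
    (hleft : ∀ t ∈ Set.Ioo (-x) x, ‖g t‖ ≤ B * (x + t) ^ β) :
    ∃ r : ℝ → ℂ, (∃ B' : ℝ, ∀ t ∈ Set.Icc (-x) x, ‖r t‖ ≤ B') ∧
      ContinuousOn r (Set.Ioo (-x) x) ∧
      ∀ t ∈ Set.Icc (-x) x, g t = (((x ^ 2 - t ^ 2) ^ β : ℝ) : ℂ) * r t := by
  have hpos : ∀ t ∈ Set.Ioo (-x) x, 0 < x ^ 2 - t ^ 2 := fun t ht => by
    nlinarith [ht.1, ht.2]
  have hle : ∀ t ∈ Set.Ioo (-x) x, ‖g t‖ ≤ B / x ^ β * (x ^ 2 - t ^ 2) ^ β := fun t ht => by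
    have hscale : ∀ d : ℝ, 0 ≤ d → x * d ≤ x ^ 2 - t ^ 2 →
        B * d ^ β ≤ B / x ^ β * (x ^ 2 - t ^ 2) ^ β := fun d hd hdx => by
      have hxβ : 0 < x ^ β := Real.rpow_pos_of_pos hx β
      calc B * d ^ β = B / x ^ β * (x * d) ^ β := by
            rw [Real.mul_rpow hx.le hd]
            field_simp
        _ ≤ _ := by gcongr
    obtain ⟨h1, h2⟩ := ht
    rcases le_total 0 t with h | h
    · exact (hright t ⟨h1, h2⟩).trans (hscale _ (by linarith) (by nlinarith))
    · exact (hleft t ⟨h1, h2⟩).trans (hscale _ (by linarith) (by nlinarith))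
  refine ⟨fun t => g t / (((x ^ 2 - t ^ 2) ^ β : ℝ) : ℂ), ⟨B / x ^ β, fun t _ => ?_⟩, ?_,
    fun t ht => ?_⟩
  · by_cases h : t ∈ Set.Ioo (-x) x
    · have hp := Real.rpow_pos_of_pos (hpos t h) β
      rw [norm_div, Complex.norm_real, Real.norm_of_nonneg hp.le, div_le_iff₀ hp]
      exact hle t h
    · simp only [hzero t h, zero_div, norm_zero]
      positivity
  · refine hg.continuousOn.div ?_ fun t ht => ?_
    · exact Complex.continuous_ofReal.comp_continuousOn
        (ContinuousOn.rpow_const (by fun_prop) fun t _ => Or.inr hβ.le)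
    · exact Complex.ofReal_ne_zero.2 (Real.rpow_pos_of_pos (hpos t ht) β).ne'
  · by_cases h : t ∈ Set.Ioo (-x) x
    · exact (mul_div_cancel₀ _
        (Complex.ofReal_ne_zero.2 (Real.rpow_pos_of_pos (hpos t h) β).ne')).symm
    · simp only [hzero t h, zero_div, mul_zero]

/-- A continuous integrable function with `|f̂(ξ)| ≤ C |ξ|^{-(α+2)}` is the Fourier transform of an
integrable function whose powers `ξ ^ m h(ξ)`, `m < α + 1`, are integrable and decay accordingly. -/
lemma exists_eq_fourier_of_decay {f : ℝ → ℂ} {α C : ℝ} (hα : 0 < α) (hfc : Continuous f)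
    (hfi : Integrable f)
    (hFT : ∀ ξ : ℝ, ξ ≠ 0 → ‖fourierT f ξ‖ ≤ C / |ξ| ^ (α + 2)) :
    ∃ (h : ℝ → ℂ) (K : ℝ), f = 𝓕 h ∧
      (∀ ξ : ℝ, ξ ≠ 0 → ‖h ξ‖ ≤ K * |ξ| ^ (-(α + 2))) ∧
      ∀ m : ℕ, (m : ℝ) < α + 1 → Integrable fun ξ : ℝ => ξ ^ m • h ξ := by
  set h : ℝ → ℂ := fun ξ => 𝓕 f (-ξ) with hh
  set K : ℝ := C / (2 * Real.pi) ^ (α + 2) with hKdef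
  have hdecay : ∀ ξ : ℝ, ξ ≠ 0 → ‖h ξ‖ ≤ K * |ξ| ^ (-(α + 2)) := fun ξ hξ => by
    have := hFT (2 * Real.pi * -ξ) (mul_ne_zero Real.two_pi_pos.ne' (neg_ne_zero.2 hξ))
    rw [fourierT_two_pi_mul, abs_mul, abs_neg, abs_of_pos Real.two_pi_pos,
      Real.mul_rpow Real.two_pi_pos.le (abs_nonneg ξ)] at this
    refine this.trans_eq ?_
    rw [Real.rpow_neg (abs_nonneg ξ), hKdef, div_mul_eq_div_div, div_eq_mul_inv _ (|ξ| ^ (α + 2))]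
  have hcont : Continuous h := by
    have : Continuous (𝓕 f) :=
      VectorFourier.fourierIntegral_continuous Real.continuous_fourierChar
        (innerSL ℝ).continuous₂ hfi
    exact this.comp continuous_neg
  have hbdd : ∀ ξ, ‖h ξ‖ ≤ ∫ t, ‖f t‖ := fun ξ =>
    VectorFourier.norm_fourierIntegral_le_integral_norm _ _ _ _ _
  have hint : ∀ m : ℕ, (m : ℝ) < α + 1 → Integrable fun ξ : ℝ => ξ ^ m • h ξ := fun m hm => by
    refine integrable_of_norm_le_rpow_neg (K := max (∫ t, ‖f t‖) K) (s := α + 2 - m)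
      (by fun_prop) (by linarith) (fun ξ hξ => ?_) (fun ξ hξ => ?_)
    · rw [norm_smul, norm_pow, Real.norm_eq_abs]
      exact (mul_le_of_le_one_left (norm_nonneg _) (pow_le_one₀ (abs_nonneg _) hξ)).trans
        ((hbdd ξ).trans (le_max_left _ _))
    · have hpos : 0 < |ξ| := one_pos.trans hξ
      rw [norm_smul, norm_pow, Real.norm_eq_abs]
      calc |ξ| ^ m * ‖h ξ‖ ≤ |ξ| ^ m * (K * |ξ| ^ (-(α + 2))) := by
            gcongr
            exact hdecay ξ (abs_pos.1 hpos)
        _ = K * |ξ| ^ (-(α + 2 - m)) := by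
            rw [show -(α + 2 - (m : ℝ)) = (m : ℝ) + -(α + 2) by ring, Real.rpow_add hpos,
              Real.rpow_natCast]
            ring
        _ ≤ _ := by
            gcongr
            exact le_max_right _ _
  refine ⟨h, K, ?_, hdecay, hint⟩
  have hFi : Integrable (𝓕 f) := by
    have := (hint 0 (by push_cast; linarith)).comp_neg
    simpa [hh] using this
  rw [hh, ← Real.fourierInv_eq_fourier_comp_neg]
  exact (hfc.fourierInv_fourier_eq hfi hFi).symm

/-- Let `x > 0`, `α > 0` and `M := [[α+1]]` (the largest integer strictly
smaller than `α+1`, i.e. `⌈α+1⌉ - 1`). If `f : ℝ → ℂ` is continuous, integrable,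
vanishes outside `[-x,x]`, and `|f̂(ξ)| ≤ C/|ξ|^{α+2}` for `ξ ≠ 0`, then `f` is `M` times
differentiable on `ℝ`, and for each `m ≤ M` there is `r_m`, bounded on `[-x,x]` and
continuous on `(-x,x)`, with `f^{(m)}(t) = (x²-t²)^{α+1-m} r_m(t)` on `[-x,x]`. -/
theorem fourier_decay_kernel_factorization
    (x α : ℝ) (hx : 0 < x) (hα : 0 < α)
    (f : ℝ → ℂ) (hfc : Continuous f) (hfi : Integrable f)
    (hsupp : ∀ t : ℝ, t ∉ Set.Icc (-x) x → f t = 0)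
    (C : ℝ) (hC : 0 < C)
    (hFT : ∀ ξ : ℝ, ξ ≠ 0 → ‖fourierT f ξ‖ ≤ C / |ξ| ^ (α + 2)) :
    (∀ m : ℕ, m < (⌈α + 1⌉ - 1).toNat → Differentiable ℝ (iteratedDeriv m f)) ∧
    (∀ m : ℕ, m ≤ (⌈α + 1⌉ - 1).toNat → ∃ r : ℝ → ℂ,
      (∃ B : ℝ, ∀ t ∈ Set.Icc (-x) x, ‖r t‖ ≤ B) ∧
      ContinuousOn r (Set.Ioo (-x) x) ∧
      ∀ t ∈ Set.Icc (-x) x,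
        iteratedDeriv m f t = (((x ^ 2 - t ^ 2) ^ (α + 1 - (m : ℝ)) : ℝ) : ℂ) * r t) := by
  have hlt : ∀ m : ℕ, m ≤ (⌈α + 1⌉ - 1).toNat → (m : ℝ) < α + 1 := fun m hm => by
    have h1 : 0 < ⌈α + 1⌉ := Int.ceil_pos.2 (by linarith)
    have h2 : (m : ℤ) < ⌈α + 1⌉ := by omega
    exact_mod_cast Int.lt_ceil.1 h2
  obtain ⟨h, K, hfh, hdecay, hint⟩ := exists_eq_fourier_of_decay hα hfc hfi hFT
  set M : ℕ := (⌈α + 1⌉ - 1).toNat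
  have hintM : ∀ n : ℕ, (n : ℕ∞) ≤ (M : ℕ∞) → Integrable fun ξ : ℝ => ξ ^ n • h ξ :=
    fun n hn => hint n (hlt n (by exact_mod_cast hn))
  have hsmooth : ContDiff ℝ M f := by
    rw [hfh]
    exact Real.contDiff_fourier (N := (M : ℕ∞)) fun n hn => by
      simpa [norm_smul] using (hintM n hn).norm
  refine ⟨fun m hm => hsmooth.differentiable_iteratedDeriv m (by exact_mod_cast hm),
    fun m hm => ?_⟩
  have hβ : 0 < α + 1 - (m : ℝ) := sub_pos.2 (hlt m hm)
  set G : ℝ → ℂ := fun ξ => (-2 * Real.pi * Complex.I * ξ) ^ m • h ξ with hGdef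
  have hG : iteratedDeriv m f = 𝓕 G := by
    rw [hfh]
    exact Real.iteratedDeriv_fourier hintM (by exact_mod_cast hm)
  have hGi : Integrable G := by
    refine ((hint m (hlt m hm)).const_mul ((-2 * Real.pi * Complex.I) ^ m)).congr
      (Eventually.of_forall fun ξ => ?_)
    simp only [hGdef, mul_pow, smul_eq_mul, Complex.real_smul, Complex.ofReal_pow]
    ring
  have hGdecay : ∀ ξ : ℝ, ξ ≠ 0 →
      ‖G ξ‖ ≤ (2 * Real.pi) ^ m * K * |ξ| ^ (-(1 + (α + 1 - (m : ℝ)))) := fun ξ hξ => by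
    have hnorm : ‖G ξ‖ = (2 * Real.pi) ^ m * |ξ| ^ m * ‖h ξ‖ := by
      simp [hGdef, mul_pow, abs_of_pos Real.pi_pos]
    rw [hnorm, show -(1 + (α + 1 - (m : ℝ))) = (m : ℝ) + -(α + 2) by ring,
      Real.rpow_add (abs_pos.2 hξ), Real.rpow_natCast]
    calc (2 * Real.pi) ^ m * |ξ| ^ m * ‖h ξ‖
        ≤ (2 * Real.pi) ^ m * |ξ| ^ m * (K * |ξ| ^ (-(α + 2))) := by
          gcongr
          exact hdecay ξ hξ
      _ = _ := by ring
  have hcont : Continuous (iteratedDeriv m f) :=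
    hsmooth.continuous_iteratedDeriv m (by exact_mod_cast hm)
  have hzero : ∀ t ∉ Set.Ioo (-x) x, iteratedDeriv m f t = 0 := fun t ht =>
    iteratedDeriv_eq_zero_of_notMem_Ioo hsupp hcont ht
  obtain ⟨B, hB, hbound⟩ := exists_norm_fourier_le_mul_rpow hGi hβ hGdecay
  rw [← hG] at hbound
  refine exists_factorization_of_norm_le hx hβ hB hcont hzero (fun t ht => ?_) (fun t ht => ?_)
  · have hd : 0 < x - t := sub_pos.2 ht.2
    refine (hbound t (x - t) hd.ne' fun k hk => hzero _ fun hmem => ?_).trans_eq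
      (by rw [abs_of_pos hd])
    have hk' : (1 : ℝ) ≤ k := by exact_mod_cast hk
    nlinarith [hmem.2]
  · have hd : 0 < x + t := by linarith [ht.1]
    refine (hbound t (-(x + t)) (neg_ne_zero.2 hd.ne') fun k hk => hzero _ fun hmem => ?_).trans_eq
      (by rw [abs_neg, abs_of_pos hd])
    have hk' : (1 : ℝ) ≤ k := by exact_mod_cast hk
    nlinarith [hmem.1]
end

section
/- Let ℓ ≥ −1/2, 0 ≤ μ < 1/2 and x > 0. Suppose f : ℝ → ℂ is continuous, integrable, even, vanishes identically outside [−x, x], and there is a constant C₀ > 0 such that its Fourier transform f̂(ξ) = ∫_ℝ f(t) e^{−iξt} dt satisfies |f̂(ξ)| ≤ C₀/|ξ|^{ℓ−μ+2} for all ξ ≠ 0. Define h(z) := f(xz)/(1−z²)^{ℓ+1} for z ∈ (−1,1) and the Fourier–Jacobi coefficients c_k := ∫_{−1}^{1} h(z) · P̃_k^{(ℓ+1,ℓ+1)}(z) · (1−z²)^{ℓ+1} dz for k ∈ ℕ₀. Then there exists a constant C > 0 (depending on f, x, ℓ, μ) such that for every natural N with 2N > ℓ+1 one has ‖ f(t)·(1−t²/x²)^{−(ℓ+1)/2}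 − (1−t²/x²)^{(ℓ+1)/2} · ∑_{k=0}^{N} c_{2k} P̃_{2k}^{(ℓ+1,ℓ+1)}(t/x) ‖_{L²(−x,x)} ≤ C/(2N−ℓ−1)^{ℓ−μ+1}. -/
open MeasureTheory Set Filter

/-- The Jacobi polynomial `P_n^{(a,b)}` for real parameters `a, b`. -/
noncomputable def jacobiP (a b : ℝ) (n : ℕ) (z : ℝ) : ℝ :=
  (Real.Gamma (a + n + 1) / (n.factorial * Real.Gamma (a + b + n + 1))) *
    ∑ k ∈ Finset.range (n + 1),
      (n.choose k : ℝ) * (Real.Gamma (a + b + n + k + 1) / Real.Gamma (a + k + 1)) *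
        ((z - 1) / 2) ^ k

/-- `h_k = ∫_{-1}^1 (P_k^{(ℓ+1,ℓ+1)})² (1-z²)^{ℓ+1} dz`, the squared weighted norm. -/
noncomputable def jacobiNormSq (l : ℝ) (k : ℕ) : ℝ :=
  (2 ^ (2 * l + 3) / (2 * (k : ℝ) + 2 * l + 3)) * (Real.Gamma ((k : ℝ) + l + 2)) ^ 2 /
    (k.factorial * Real.Gamma ((k : ℝ) + 2 * l + 3))

/-- The normalized Jacobi polynomial `P̃_k^{(ℓ+1,ℓ+1)}`. -/
noncomputable def jacobiPNorm (l : ℝ) (k : ℕ) (z : ℝ) : ℝ :=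
  jacobiP (l + 1) (l + 1) k z / Real.sqrt (jacobiNormSq l k)

/-- The Fourier–Jacobi coefficient `c_k = ∫_{-1}^1 h(z) P̃_k^{(ℓ+1,ℓ+1)}(z) (1-z²)^{ℓ+1} dz`
of `h(z) = f(xz)/(1-z²)^{ℓ+1}`. -/
noncomputable def cJ (l x : ℝ) (f : ℝ → ℂ) (k : ℕ) : ℂ :=
  ∫ z in Set.Ioo (-1 : ℝ) 1,
    (f (x * z) / (((1 - z ^ 2) ^ (l + 1) : ℝ) : ℂ)) *
      (((jacobiPNorm l k z * (1 - z ^ 2) ^ (l + 1)) : ℝ) : ℂ)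

open Topology

/-- The coefficient of `((z - 1) / 2) ^ k` in the Gegenbauer-type polynomial `P_n^{(α,α)}`. -/
noncomputable def jacobiCoeff (α : ℝ) (n k : ℕ) : ℝ :=
  Real.Gamma (α + n + 1) / (n.factorial * Real.Gamma (α + α + n + 1)) *
    ((n.choose k : ℝ) * (Real.Gamma (α + α + n + k + 1) / Real.Gamma (α + k + 1)))

/-- `P_n^{(α,α)}` as a polynomial in the variable `(z - 1) / 2`. -/
noncomputable def jacobiShifted (α : ℝ) (n : ℕ) : Polynomial ℝ :=
  ∑ k ∈ Finset.range (n + 1), Polynomial.C (jacobiCoeff α n k) * Polynomial.X ^ k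

/-- `P_n^{(α,α)}` as a polynomial. -/
noncomputable def jacobiPoly (α : ℝ) (n : ℕ) : Polynomial ℝ :=
  (jacobiShifted α n).comp (Polynomial.C (1 / 2) * Polynomial.X + Polynomial.C (-1 / 2))

lemma eval_jacobiPoly (α : ℝ) (n : ℕ) (z : ℝ) :
    (jacobiPoly α n).eval z = jacobiP α α n z := by
  simp only [jacobiPoly, jacobiShifted, jacobiP, jacobiCoeff, Polynomial.eval_comp,
    Polynomial.eval_finsetSum, Finset.mul_sum, Polynomial.eval_mul, Polynomial.eval_pow,
    Polynomial.eval_add, Polynomial.eval_C, Polynomial.eval_X]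
  refine Finset.sum_congr rfl fun k _ => ?_
  rw [show 1 / 2 * z + -1 / 2 = (z - 1) / 2 by ring]
  ring

lemma coeff_jacobiShifted (α : ℝ) (n k : ℕ) :
    (jacobiShifted α n).coeff k = jacobiCoeff α n k := by
  simp only [jacobiShifted, Polynomial.finsetSum_coeff, Polynomial.coeff_C_mul_X_pow]
  rw [Finset.sum_ite_eq]
  split_ifs with h
  · rfl
  · have : n < k := by simpa using h
    simp [jacobiCoeff, Nat.choose_eq_zero_of_lt this]

lemma jacobiCoeff_recurrence_zero {α : ℝ} (hα : 0 < α) (j : ℕ) :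
    (α + 1) * jacobiCoeff (α + 1) j 0 = (j + 1) * jacobiCoeff α (j + 1) 0 := by
  unfold jacobiCoeff
  have h1 : Real.Gamma (α + 1 + ((0 : ℕ) : ℝ) + 1) = (α + 1) * Real.Gamma (α + 1) := by
    rw [Nat.cast_zero, add_zero, Real.Gamma_add_one (by positivity)]
  have e1 : α + 1 + j + 1 = α + (j + 1 : ℕ) + 1 := by push_cast; ring
  have e2 : α + 1 + (α + 1) + j + ((0 : ℕ) : ℝ) + 1 = α + 1 + (α + 1) + j + 1 := by simp
  have e3 : α + α + (j + 1 : ℕ) + ((0 : ℕ) : ℝ) + 1 = α + α + (j + 1 : ℕ) + 1 := by simp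
  have e4 : α + ((0 : ℕ) : ℝ) + 1 = α + 1 := by simp
  rw [h1, e1, e2, e3, e4, Nat.factorial_succ]
  have p1 : Real.Gamma (α + 1 + (α + 1) + j + 1) ≠ 0 := (Real.Gamma_pos_of_pos (by positivity)).ne'
  have p2 : Real.Gamma (α + α + (j + 1 : ℕ) + 1) ≠ 0 := (Real.Gamma_pos_of_pos (by positivity)).ne'
  have p3 : Real.Gamma (α + 1) ≠ 0 := (Real.Gamma_pos_of_pos (by positivity)).ne'
  have p4 : (j.factorial : ℝ) ≠ 0 := by positivity
  push_cast at *
  field_simp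
  simp

lemma jacobiCoeff_recurrence_succ {α : ℝ} (hα : 0 < α) (j i : ℕ) :
    (i + 1 + (α + 1)) * jacobiCoeff (α + 1) j (i + 1) +
      (i + 2 * (α + 1)) * jacobiCoeff (α + 1) j i = (j + 1) * jacobiCoeff α (j + 1) (i + 1) := by
  unfold jacobiCoeff
  have e1 : α + 1 + j + 1 = α + (j + 1 : ℕ) + 1 := by push_cast; ring
  have e2 : Real.Gamma (α + 1 + (α + 1) + j + 1) =
      (α + α + j + 2) * Real.Gamma (α + α + (j + 1 : ℕ) + 1) := by
    rw [show α + 1 + (α + 1) + j + 1 = (α + α + j + 2) + 1 by ring,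
      Real.Gamma_add_one (by positivity)]
    congr 2; push_cast; ring
  have e3 : Real.Gamma (α + 1 + (α + 1) + j + (i + 1 : ℕ) + 1) =
      (α + α + j + i + 3) * Real.Gamma (α + α + (j + 1 : ℕ) + (i + 1 : ℕ) + 1) := by
    rw [show α + 1 + (α + 1) + j + (i + 1 : ℕ) + 1 = (α + α + j + i + 3) + 1 by push_cast; ring,
      Real.Gamma_add_one (by positivity)]
    congr 2; push_cast; ring
  have e4 : Real.Gamma (α + 1 + (i + 1 : ℕ) + 1) =
      (α + i + 2) * Real.Gamma (α + (i + 1 : ℕ) + 1) := by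
    rw [show α + 1 + (i + 1 : ℕ) + 1 = (α + i + 2) + 1 by push_cast; ring,
      Real.Gamma_add_one (by positivity)]
    congr 2; push_cast; ring
  have e5 : α + 1 + (α + 1) + j + i + 1 = α + α + (j + 1 : ℕ) + (i + 1 : ℕ) + 1 := by
    push_cast; ring
  have e6 : α + 1 + i + 1 = α + (i + 1 : ℕ) + 1 := by push_cast; ring
  rw [e1, e2, e3, e4, e5, e6, Nat.factorial_succ]
  have p1 : Real.Gamma (α + α + (j + 1 : ℕ) + (i + 1 : ℕ) + 1) ≠ 0 :=
    (Real.Gamma_pos_of_pos (by positivity)).ne'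
  have p2 : Real.Gamma (α + α + (j + 1 : ℕ) + 1) ≠ 0 := (Real.Gamma_pos_of_pos (by positivity)).ne'
  have p3 : Real.Gamma (α + (i + 1 : ℕ) + 1) ≠ 0 := (Real.Gamma_pos_of_pos (by positivity)).ne'
  have p4 : (j.factorial : ℝ) ≠ 0 := by positivity
  have p5 : α + i + 2 ≠ 0 := by positivity
  have p6 : α + α + j + 2 ≠ 0 := by positivity
  have hch : ((j + 1).choose (i + 1) : ℝ) = j.choose i + j.choose (i + 1) := by
    rw [Nat.choose_succ_succ]; push_cast; ring
  have hch2 : (j.choose (i + 1) : ℝ) * (i + 1) = j.choose i * (j - i) := by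
    rcases le_or_gt i j with h | h
    · have := Nat.choose_succ_right_eq j i
      have h2 : ((j - i : ℕ) : ℝ) = j - i := by push_cast [h]; ring
      rw [← h2]; exact_mod_cast this
    · simp [Nat.choose_eq_zero_of_lt h, Nat.choose_eq_zero_of_lt (Nat.lt_succ_of_lt h)]
  rw [hch]
  generalize Real.Gamma (α + α + (j + 1 : ℕ) + (i + 1 : ℕ) + 1) = g1 at *
  generalize Real.Gamma (α + α + (j + 1 : ℕ) + 1) = g2 at *
  generalize Real.Gamma (α + (i + 1 : ℕ) + 1) = g3 at *
  generalize Real.Gamma (α + (j + 1 : ℕ) + 1) = g4 at *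
  generalize (j.choose (i + 1) : ℝ) = c1 at *
  generalize (j.choose i : ℝ) = c2 at *
  push_cast
  field_simp
  linear_combination (g4 * (α + i + 2)) * hch2

lemma jacobiShifted_recurrence {α : ℝ} (hα : 0 < α) (j : ℕ) :
    (Polynomial.X + Polynomial.X ^ 2) * (jacobiShifted (α + 1) j).derivative +
      Polynomial.C (α + 1) * (1 + Polynomial.C 2 * Polynomial.X) * jacobiShifted (α + 1) j =
      Polynomial.C ((j : ℝ) + 1) * jacobiShifted α (j + 1) := by
  have key : (Polynomial.X + Polynomial.X ^ 2) * (jacobiShifted (α + 1) j).derivative +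
      Polynomial.C (α + 1) * (1 + Polynomial.C 2 * Polynomial.X) * jacobiShifted (α + 1) j =
      Polynomial.X * (jacobiShifted (α + 1) j).derivative +
      Polynomial.X * (Polynomial.X * (jacobiShifted (α + 1) j).derivative) +
      Polynomial.C (α + 1) * jacobiShifted (α + 1) j +
      Polynomial.C (2 * (α + 1)) * (Polynomial.X * jacobiShifted (α + 1) j) := by
    simp only [map_mul, map_add]
    ring
  rw [key]
  ext i
  simp only [Polynomial.coeff_add, Polynomial.coeff_C_mul]
  rcases i with _ | i
  · simp only [Polynomial.coeff_X_mul_zero, coeff_jacobiShifted]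
    rw [← jacobiCoeff_recurrence_zero hα]
    ring
  · simp only [Polynomial.coeff_X_mul, coeff_jacobiShifted, Polynomial.coeff_derivative]
    rw [← jacobiCoeff_recurrence_succ hα]
    rcases i with _ | i
    · simp only [Polynomial.coeff_X_mul_zero]; push_cast; ring
    · simp only [Polynomial.coeff_X_mul, coeff_jacobiShifted, Polynomial.coeff_derivative]
      push_cast; ring

lemma jacobiPoly_recurrence {α : ℝ} (hα : 0 < α) (j : ℕ) :
    (1 - Polynomial.X ^ 2) * (jacobiPoly (α + 1) j).derivative -
      Polynomial.C (2 * (α + 1)) * Polynomial.X * jacobiPoly (α + 1) j =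
      Polynomial.C (-2 * ((j : ℝ) + 1)) * jacobiPoly α (j + 1) := by
  have h := congrArg (fun p : Polynomial ℝ => p.comp
    (Polynomial.C (1 / 2) * Polynomial.X + Polynomial.C (-1 / 2))) (jacobiShifted_recurrence hα j)
  apply Polynomial.funext
  intro z
  have h2 := congrArg (Polynomial.eval z) h
  simp only [jacobiPoly, Polynomial.derivative_comp, Polynomial.eval_mul, Polynomial.eval_sub,
    Polynomial.eval_add, Polynomial.eval_pow, Polynomial.eval_comp, Polynomial.eval_C,
    Polynomial.eval_X, Polynomial.eval_one, Polynomial.derivative_add, Polynomial.derivative_C,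
    Polynomial.derivative_mul, Polynomial.derivative_X, Polynomial.eval_zero] at h2 ⊢
  linear_combination (-2) * h2

lemma jacobiPoly_zero {α : ℝ} (hα : 0 < α) : jacobiPoly α 0 = 1 := by
  have p1 : Real.Gamma (α + α + 1) ≠ 0 := (Real.Gamma_pos_of_pos (by positivity)).ne'
  have p3 : Real.Gamma (α + 1) ≠ 0 := (Real.Gamma_pos_of_pos (by positivity)).ne'
  have : jacobiCoeff α 0 0 = 1 := by
    simp [jacobiCoeff]; field_simp
  simp [jacobiPoly, jacobiShifted, this]

lemma natDegree_jacobiPoly_le (α : ℝ) (n : ℕ) : (jacobiPoly α n).natDegree ≤ n := by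
  unfold jacobiPoly
  have h1 : (jacobiShifted α n).natDegree ≤ n := by
    unfold jacobiShifted
    refine Polynomial.natDegree_sum_le_of_forall_le _ _ fun k hk => ?_
    exact (Polynomial.natDegree_C_mul_X_pow_le _ _).trans (by simpa [Nat.lt_succ_iff] using hk)
  refine Polynomial.natDegree_comp_le.trans ?_
  calc _ ≤ n * 1 := Nat.mul_le_mul h1 (Polynomial.natDegree_linear_le)
    _ = n := mul_one n

/-- The leading coefficient of `P_n^{(α,α)}`. -/
noncomputable def jacobiLead (α : ℝ) (n : ℕ) : ℝ :=
  Real.Gamma (2 * α + 2 * n + 1) / (n.factorial * Real.Gamma (2 * α + n + 1) * 2 ^ n)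

lemma jacobiLead_pos {α : ℝ} (hα : 0 < α) (n : ℕ) : 0 < jacobiLead α n := by
  have := Real.Gamma_pos_of_pos (show 0 < 2 * α + 2 * n + 1 by positivity)
  have := Real.Gamma_pos_of_pos (show 0 < 2 * α + n + 1 by positivity)
  unfold jacobiLead; positivity

lemma coeff_jacobiPoly_self {α : ℝ} (hα : 0 < α) (n : ℕ) :
    (jacobiPoly α n).coeff n = jacobiLead α n := by
  have hc : jacobiCoeff α n n = jacobiLead α n * 2 ^ n := by
    have p3 : Real.Gamma (α + n + 1) ≠ 0 := (Real.Gamma_pos_of_pos (by positivity)).ne'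
    simp only [jacobiCoeff, jacobiLead, Nat.choose_self]
    rw [show α + α + n + n + 1 = 2 * α + 2 * n + 1 by ring,
      show α + α + n + 1 = 2 * α + n + 1 by ring]
    field_simp
    simp
  have hpos := jacobiLead_pos hα n
  have h1 : (jacobiShifted α n).natDegree = n := by
    refine Polynomial.natDegree_eq_of_le_of_coeff_ne_zero ?_ ?_
    · unfold jacobiShifted
      refine Polynomial.natDegree_sum_le_of_forall_le _ _ fun k hk => ?_
      exact (Polynomial.natDegree_C_mul_X_pow_le _ _).trans
        (by simpa [Nat.lt_succ_iff] using hk)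
    · rw [coeff_jacobiShifted, hc]
      positivity
  have h3 : (Polynomial.C (1 / 2 : ℝ) * Polynomial.X + Polynomial.C (-1 / 2)).natDegree = 1 :=
    Polynomial.natDegree_linear (by norm_num)
  have h4 : (Polynomial.C (1 / 2 : ℝ) * Polynomial.X + Polynomial.C (-1 / 2)).leadingCoeff =
      1 / 2 := Polynomial.leadingCoeff_linear (by norm_num)
  have h2 := Polynomial.coeff_comp_degree_mul_degree (p := jacobiShifted α n)
    (q := Polynomial.C (1 / 2 : ℝ) * Polynomial.X + Polynomial.C (-1 / 2)) (by simp)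
  rw [Polynomial.leadingCoeff, h1, h3, h4, mul_one, coeff_jacobiShifted, hc] at h2
  rw [jacobiPoly, h2, mul_assoc, ← mul_pow]
  norm_num

lemma jacobiPoly_comp_neg {α : ℝ} (hα : 0 < α) (n : ℕ) (z : ℝ) :
    (jacobiPoly α n).eval (-z) = (-1) ^ n * (jacobiPoly α n).eval z := by
  induction n generalizing α z with
  | zero => simp [jacobiPoly_zero hα]
  | succ j ih =>
    have hj : (-2 * ((j : ℝ) + 1)) ≠ 0 := by
      have : (0 : ℝ) < j + 1 := by positivity
      simp; positivity
    have hp : (jacobiPoly (α + 1) j).comp (-Polynomial.X) =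
        Polynomial.C ((-1) ^ j) * jacobiPoly (α + 1) j := by
      apply Polynomial.funext
      intro y
      simpa using ih (by positivity : 0 < α + 1) y
    have hd := congrArg (fun p : Polynomial ℝ => p.derivative.eval z) hp
    simp only [Polynomial.derivative_comp, Polynomial.derivative_mul, Polynomial.derivative_C,
      Polynomial.eval_mul, Polynomial.eval_comp, Polynomial.derivative_neg, Polynomial.eval_neg,
      Polynomial.derivative_X, Polynomial.eval_one, Polynomial.eval_X, Polynomial.eval_C,
      zero_mul, zero_add] at hd
    have r1 := congrArg (Polynomial.eval z) (jacobiPoly_recurrence hα j)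
    have r2 := congrArg (Polynomial.eval (-z)) (jacobiPoly_recurrence hα j)
    simp only [Polynomial.eval_mul, Polynomial.eval_sub, Polynomial.eval_pow, Polynomial.eval_C,
      Polynomial.eval_X, Polynomial.eval_one] at r1 r2
    rw [ih (by positivity : 0 < α + 1)] at r2
    apply mul_left_cancel₀ hj
    rw [← r2]
    rw [pow_succ]
    linear_combination (-(-1) ^ j) * r1 - (1 - z ^ 2) * hd

lemma continuous_weight {a : ℝ} (ha : 0 ≤ a) : Continuous fun z : ℝ => (1 - z ^ 2) ^ a :=
  (by fun_prop : Continuous fun z : ℝ => 1 - z ^ 2).rpow_const fun _ => Or.inr ha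

lemma hasDerivAt_weight_mul_jacobiPoly {α : ℝ} (hα : 0 < α) (j : ℕ) {z : ℝ}
    (hz : z ∈ Ioo (-1 : ℝ) 1) :
    HasDerivAt (fun z : ℝ => (1 - z ^ 2) ^ (α + 1) * (jacobiPoly (α + 1) j).eval z)
      (-2 * (j + 1) * ((1 - z ^ 2) ^ α * (jacobiPoly α (j + 1)).eval z)) z := by
  have hpos : 0 < 1 - z ^ 2 := by nlinarith [hz.1, hz.2]
  have h1 : HasDerivAt (fun z : ℝ => 1 - z ^ 2) (-(2 * z)) z := by
    simpa using (hasDerivAt_pow 2 z).const_sub 1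
  have h2 := h1.rpow_const (p := α + 1) (Or.inl hpos.ne')
  have h3 := h2.mul ((jacobiPoly (α + 1) j).hasDerivAt z)
  refine h3.congr_deriv ?_
  have r := congrArg (Polynomial.eval z) (jacobiPoly_recurrence hα j)
  simp only [Polynomial.eval_mul, Polynomial.eval_sub, Polynomial.eval_pow, Polynomial.eval_C,
      Polynomial.eval_X, Polynomial.eval_one] at r
  rw [add_sub_cancel_right, Real.rpow_add_one hpos.ne']
  linear_combination (1 - z ^ 2) ^ α * r

lemma integral_jacobiPoly_succ {α : ℝ} (hα : 0 < α) (j : ℕ) {φ φ' : ℝ → ℝ}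
    (hφ : ∀ z, HasDerivAt φ (φ' z) z) (hφ' : Continuous φ') :
    ∫ z in (-1 : ℝ)..1, (1 - z ^ 2) ^ α * (jacobiPoly α (j + 1)).eval z * φ z =
      1 / (2 * ((j : ℝ) + 1)) *
        ∫ z in (-1 : ℝ)..1, (1 - z ^ 2) ^ (α + 1) * (jacobiPoly (α + 1) j).eval z * φ' z := by
  have hc : Continuous φ := continuous_iff_continuousAt.2 fun z => (hφ z).continuousAt
  have c1 := continuous_weight (by positivity : 0 ≤ α + 1)
  have c2 := continuous_weight hα.le
  have c3 : Continuous fun z : ℝ =>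
      -2 * ((j : ℝ) + 1) * ((1 - z ^ 2) ^ α * (jacobiPoly α (j + 1)).eval z) :=
    continuous_const.mul (c2.mul (Polynomial.continuous _))
  have h := intervalIntegral.integral_mul_deriv_eq_deriv_mul_of_hasDerivAt
    (a := (-1 : ℝ)) (b := 1)
    (u := fun z : ℝ => (1 - z ^ 2) ^ (α + 1) * (jacobiPoly (α + 1) j).eval z)
    (u' := fun z => -2 * (j + 1) * ((1 - z ^ 2) ^ α * (jacobiPoly α (j + 1)).eval z))
    (v := φ) (v' := φ') (c1.mul (Polynomial.continuous _)).continuousOn hc.continuousOn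
    (fun z hz => hasDerivAt_weight_mul_jacobiPoly hα j (by simpa using hz))
    (fun z _ => hφ z) (c3.intervalIntegrable _ _) (hφ'.intervalIntegrable _ _)
  rw [h]
  have hne : (α + 1) ≠ 0 := by positivity
  have hj : ((j : ℝ) + 1) ≠ 0 := by positivity
  simp only [one_pow, sub_self, Real.zero_rpow hne, even_two.neg_pow, zero_mul, zero_sub]
  rw [← intervalIntegral.integral_neg, ← intervalIntegral.integral_const_mul]
  refine intervalIntegral.integral_congr fun z _ => ?_
  field_simp

lemma integral_jacobiPoly_eq {α : ℝ} (hα : 0 < α) (k : ℕ) (φ : ℕ → ℝ → ℝ)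
    (hφ : ∀ j z, HasDerivAt (φ j) (φ (j + 1) z) z) :
    ∫ z in (-1 : ℝ)..1, (1 - z ^ 2) ^ α * (jacobiPoly α k).eval z * φ 0 z =
      (1 : ℝ) / (2 ^ k * k.factorial) * ∫ z in (-1 : ℝ)..1, (1 - z ^ 2) ^ (α + k) * φ k z := by
  induction k generalizing α φ with
  | zero => simp [jacobiPoly_zero hα]
  | succ j ih =>
    have hc : Continuous (φ 1) := continuous_iff_continuousAt.2 fun z => (hφ 1 z).continuousAt
    rw [integral_jacobiPoly_succ hα j (hφ 0) hc,
      ih (by positivity : 0 < α + 1) (fun j => φ (j + 1)) (fun j => hφ (j + 1)), ← mul_assoc,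
      Nat.factorial_succ]
    congr 1
    · push_cast; field_simp; ring
    · refine intervalIntegral.integral_congr fun z _ => ?_
      congr 2
      push_cast; ring

/-- The integral of `(1 - z ^ 2) ^ b` over `(-1, 1)`. -/
noncomputable def weightMass (b : ℝ) : ℝ := ∫ z in (-1 : ℝ)..1, (1 - z ^ 2) ^ b

lemma weightMass_eq {b : ℝ} (hb : 0 < b) :
    weightMass b = 2 ^ (2 * b + 1) * Real.Gamma (b + 1) ^ 2 / Real.Gamma (2 * b + 2) := by
  have h1 := ProbabilityTheory.beta_eq_betaIntegralReal (b + 1) (b + 1) (by positivity)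
    (by positivity)
  have h2 : Complex.betaIntegral ((b + 1 : ℝ) : ℂ) ((b + 1 : ℝ) : ℂ) =
      ((∫ x in (0 : ℝ)..1, x ^ b * (1 - x) ^ b : ℝ) : ℂ) := by
    rw [Complex.betaIntegral, ← intervalIntegral.integral_ofReal]
    refine intervalIntegral.integral_congr fun x hx => ?_
    rw [uIcc_of_le zero_le_one] at hx
    have h3 : 0 ≤ 1 - x := by linarith [hx.2]
    simp only [Complex.ofReal_mul, Complex.ofReal_cpow hx.1, Complex.ofReal_cpow h3]
    push_cast
    simp
  rw [h2, Complex.ofReal_re, ProbabilityTheory.beta] at h1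
  have h4 : weightMass b = 2 ^ (2 * b + 1) * ∫ x in (0 : ℝ)..1, x ^ b * (1 - x) ^ b := by
    have h5 := intervalIntegral.integral_comp_mul_add (a := (0 : ℝ)) (b := 1) (c := 2)
      (fun z : ℝ => (1 - z ^ 2) ^ b) two_ne_zero (-1)
    norm_num at h5
    rw [weightMass, ← mul_right_inj' (show (1 / 2 : ℝ) ≠ 0 by norm_num), ← h5,
      ← mul_assoc, ← intervalIntegral.integral_const_mul]
    refine intervalIntegral.integral_congr fun x hx => ?_
    rw [uIcc_of_le zero_le_one] at hx
    have h3 : 0 ≤ 1 - x := by linarith [hx.2]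
    rw [show 1 - (2 * x + -1) ^ 2 = 4 * (x * (1 - x)) by ring,
      Real.mul_rpow (by norm_num) (mul_nonneg hx.1 h3), Real.mul_rpow hx.1 h3,
      show (4 : ℝ) = 2 ^ (2 : ℝ) by norm_num, ← Real.rpow_mul (by norm_num),
      Real.rpow_add_one (by norm_num)]
    ring
  rw [h4, ← h1, show b + 1 + (b + 1) = 2 * b + 2 by ring]
  ring

lemma weightMass_pos {b : ℝ} (hb : 0 < b) : 0 < weightMass b := by
  have := Real.Gamma_pos_of_pos (show 0 < b + 1 by positivity)
  have := Real.Gamma_pos_of_pos (show 0 < 2 * b + 2 by positivity)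
  rw [weightMass_eq hb]; positivity

/-- A polynomial of degree at most `k` is integrated against `P_k^{(α,α)}` through its
coefficient of degree `k`. -/
lemma integral_jacobiPoly_mul_poly {α : ℝ} (hα : 0 < α) (k : ℕ) (p : Polynomial ℝ)
    (hp : p.natDegree ≤ k) :
    ∫ z in (-1 : ℝ)..1, (1 - z ^ 2) ^ α * (jacobiPoly α k).eval z * p.eval z =
      p.coeff k * weightMass (α + k) / 2 ^ k := by
  have h := integral_jacobiPoly_eq hα k
    (fun j z => ((Polynomial.derivative^[j]) p).eval z) (fun j z => by
      rw [Function.iterate_succ_apply']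
      exact Polynomial.hasDerivAt _ _)
  simp only [Function.iterate_zero, id] at h
  have hd : (Polynomial.derivative^[k]) p = Polynomial.C (k.factorial * p.coeff k) := by
    have h0 : ((Polynomial.derivative^[k]) p).natDegree = 0 := by
      have := Polynomial.natDegree_iterate_derivative p k
      omega
    rw [Polynomial.eq_C_of_natDegree_eq_zero h0, Polynomial.coeff_iterate_derivative]
    simp [Nat.descFactorial_self]
  rw [h, hd]
  simp only [Polynomial.eval_C, intervalIntegral.integral_mul_const]
  rw [← weightMass]
  field_simp

lemma integral_jacobiPoly_mul_poly_eq_zero {α : ℝ} (hα : 0 < α) {k : ℕ} {p : Polynomial ℝ}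
    (hp : p.natDegree < k) :
    ∫ z in (-1 : ℝ)..1, (1 - z ^ 2) ^ α * (jacobiPoly α k).eval z * p.eval z = 0 := by
  rw [integral_jacobiPoly_mul_poly hα k p hp.le, Polynomial.coeff_eq_zero_of_natDegree_lt hp]
  simp

lemma integral_jacobiPoly_mul_of_ne {α : ℝ} (hα : 0 < α) {j k : ℕ} (h : j ≠ k) :
    ∫ z in (-1 : ℝ)..1, (1 - z ^ 2) ^ α * (jacobiPoly α j).eval z * (jacobiPoly α k).eval z =
      0 := by
  rcases lt_or_gt_of_ne h with h | h
  · rw [← integral_jacobiPoly_mul_poly_eq_zero hα ((natDegree_jacobiPoly_le α j).trans_lt h)]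
    refine intervalIntegral.integral_congr fun z _ => ?_
    ring
  · exact integral_jacobiPoly_mul_poly_eq_zero hα ((natDegree_jacobiPoly_le α k).trans_lt h)

/-- A polynomial all of whose Fourier-Jacobi coefficients up to its degree vanish is zero. -/
lemma poly_eq_zero_of_integral_jacobiPoly {α : ℝ} (hα : 0 < α) (p : Polynomial ℝ)
    (h : ∫ z in (-1 : ℝ)..1,
      (1 - z ^ 2) ^ α * (jacobiPoly α p.natDegree).eval z * p.eval z = 0) : p = 0 := by
  rw [integral_jacobiPoly_mul_poly hα _ p le_rfl] at h
  have := (weightMass_pos (show 0 < α + p.natDegree by positivity)).ne'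
  simpa [this] using h

lemma integral_jacobiPoly_sq {l : ℝ} (hl : 0 < l + 1) (k : ℕ) :
    ∫ z in (-1 : ℝ)..1, (1 - z ^ 2) ^ (l + 1) * (jacobiPoly (l + 1) k).eval z *
      (jacobiPoly (l + 1) k).eval z = jacobiNormSq l k := by
  have h3 : 0 < 2 * (k : ℝ) + 2 * l + 3 := by linarith [(by positivity : (0:ℝ) ≤ k)]
  have h7 : 0 < (k : ℝ) + 2 * l + 3 := by linarith [(by positivity : (0:ℝ) ≤ k)]
  have hG : Real.Gamma (2 * (l + 1 + k) + 2) =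
      (2 * (k : ℝ) + 2 * l + 3) * Real.Gamma (2 * (k : ℝ) + 2 * l + 3) := by
    rw [← Real.Gamma_add_one h3.ne']; congr 1; ring
  have hP : (2 : ℝ) ^ (2 * (l + 1 + k) + 1) = 2 ^ (2 * l + 3) * (2 ^ k * 2 ^ k) := by
    rw [show 2 * (l + 1 + k) + 1 = (2 * l + 3) + ((k + k : ℕ) : ℝ) by push_cast; ring,
      Real.rpow_add_natCast (by norm_num), pow_add]
  rw [integral_jacobiPoly_mul_poly hl k _ (natDegree_jacobiPoly_le _ _),
    coeff_jacobiPoly_self hl, weightMass_eq (by positivity), jacobiLead, jacobiNormSq, hG, hP,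
    show l + 1 + k + 1 = k + l + 2 by ring, show 2 * (l + 1) + k + 1 = k + 2 * l + 3 by ring,
    show 2 * (l + 1) + 2 * (k : ℝ) + 1 = 2 * (k : ℝ) + 2 * l + 3 by ring]
  have h4 := Real.Gamma_pos_of_pos h3
  have h5 := Real.Gamma_pos_of_pos h7
  generalize Real.Gamma (2 * (k : ℝ) + 2 * l + 3) = G at h4 ⊢
  field_simp

lemma jacobiNormSq_pos {l : ℝ} (hl : 0 < l + 1) (k : ℕ) : 0 < jacobiNormSq l k := by
  have hk : (0 : ℝ) ≤ k := by positivity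
  have h1 := Real.Gamma_pos_of_pos (show 0 < k + l + 2 by linarith)
  have h2 := Real.Gamma_pos_of_pos (show 0 < k + 2 * l + 3 by linarith)
  have h3 : 0 < 2 * (k : ℝ) + 2 * l + 3 := by linarith
  unfold jacobiNormSq
  positivity

lemma hasDerivAt_cpow_comp {f : ℝ → ℂ} {f' : ℂ} {x : ℝ} (hf : HasDerivAt f f' x)
    (h : f x ∈ Complex.slitPlane) (c : ℂ) :
    HasDerivAt (fun y => f y ^ c) (c * f x ^ (c - 1) * f') x := by
  have h1 : HasDerivAt (fun w : ℂ => w ^ c) (c * f x ^ (c - 1) * 1) (f x) :=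
    (hasDerivAt_id (f x)).cpow_const h
  have h2 := HasDerivAt.scomp x h1 hf
  refine h2.congr_deriv ?_
  simp only [smul_eq_mul]; ring

lemma ofReal_mul_cpow {x : ℝ} (hx : 0 < x) {w : ℂ} (hw : w ≠ 0) (c : ℂ) :
    ((x : ℂ) * w) ^ c = (x : ℂ) ^ c * w ^ c := by
  have hx' : (x : ℂ) ≠ 0 := by exact_mod_cast hx.ne'
  rw [Complex.cpow_def_of_ne_zero (mul_ne_zero hx' hw), Complex.cpow_def_of_ne_zero hx',
    Complex.cpow_def_of_ne_zero hw, Complex.log_ofReal_mul hx hw, ← Complex.exp_add,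
    Complex.ofReal_log hx.le, add_mul]

lemma cpow_add_one {w : ℂ} (hw : w ≠ 0) (c : ℂ) : w ^ (c + 1) = w ^ c * w := by
  rw [Complex.cpow_add _ _ hw, Complex.cpow_one]

lemma hasDerivAt_add_mul_ofReal (p q : ℂ) (x : ℝ) :
    HasDerivAt (fun y : ℝ => p + q * (y : ℂ)) q x := by
  simpa using ((hasDerivAt_id (x : ℂ)).const_mul q |>.const_add p).comp_ofReal

/-- Differentiation in `t` of `(1 - t ^ 2) ^ (b + 1) * (1 + i ε (t - z)) ^ (-(2 b + 2))`
integrates to zero. -/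
lemma integral_weight_mul_cpow_deriv {b : ℝ} (hb : 0 < b) (z ε : ℝ) :
    ∫ t in (-1 : ℝ)..1, (((1 - t ^ 2) ^ b : ℝ) : ℂ) *
      ((1 + Complex.I * ε * (t - z)) ^ (-(2 * b + 3) : ℂ) *
        (2 * ε * (1 - z * t) - 2 * Complex.I * t)) = 0 := by
  have hs : ∀ t : ℝ, (1 + Complex.I * ε * (t - z)) ∈ Complex.slitPlane := fun t => by
    left; simp
  have hc : ∀ c : ℂ, Continuous fun t : ℝ => (1 + Complex.I * ε * (t - z)) ^ c := fun c =>
    Continuous.cpow (by fun_prop) continuous_const hs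
  have h := intervalIntegral.integral_eq_sub_of_hasDerivAt_of_le (a := (-1 : ℝ)) (b := 1)
    (by norm_num) (f := fun t : ℝ => (((1 - t ^ 2) ^ (b + 1) : ℝ) : ℂ) *
      (1 + Complex.I * ε * (t - z)) ^ (-(2 * b + 2) : ℂ))
    (f' := fun t : ℝ => -Complex.I * (b + 1) * ((((1 - t ^ 2) ^ b : ℝ) : ℂ) *
      ((1 + Complex.I * ε * (t - z)) ^ (-(2 * b + 3) : ℂ) *
        (2 * ε * (1 - z * t) - 2 * Complex.I * t))))
    ((Complex.continuous_ofReal.comp (continuous_weight (by positivity))).mul (hc _)).continuousOn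
    (fun t ht => by
      have hpos : 0 < 1 - t ^ 2 := by nlinarith [ht.1, ht.2]
      have h1 : HasDerivAt (fun z : ℝ => 1 - z ^ 2) (-(2 * t)) t := by
        simpa using (hasDerivAt_pow 2 t).const_sub 1
      have h2 := (h1.rpow_const (p := b + 1) (Or.inl hpos.ne')).ofReal_comp
      have h3 : HasDerivAt (fun t : ℝ => 1 + Complex.I * ε * ((t : ℂ) - z)) (Complex.I * ε) t := by
        have := hasDerivAt_add_mul_ofReal (1 - Complex.I * ε * z) (Complex.I * ε) t
        refine this.congr_of_eventuallyEq (Eventually.of_forall fun y => ?_)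
        ring
      have h4 := h2.mul (hasDerivAt_cpow_comp h3 (hs t) (-(2 * b + 2)))
      refine h4.congr_deriv ?_
      have hne : (1 + Complex.I * ε * ((t : ℂ) - z)) ≠ 0 := Complex.slitPlane_ne_zero (hs t)
      have e1 : (1 + Complex.I * ε * ((t : ℂ) - z)) ^ (-(2 * b + 2) : ℂ) =
          (1 + Complex.I * ε * ((t : ℂ) - z)) ^ (-(2 * b + 3) : ℂ) *
            (1 + Complex.I * ε * ((t : ℂ) - z)) := by
        rw [← cpow_add_one hne]; congr 1; ring
      have e2 : (1 - t ^ 2) ^ (b + 1) = (1 - t ^ 2) ^ b * (1 - t ^ 2) :=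
        Real.rpow_add_one hpos.ne' _
      rw [e1, e2, show (-(2 * b + 2) - 1 : ℂ) = -(2 * b + 3) by ring]
      rw [add_sub_cancel_right]
      push_cast
      linear_combination (-2) * (b + 1) * t * (((1 - t ^ 2) ^ b : ℝ) : ℂ) *
        (1 + Complex.I * ε * ((t : ℂ) - z)) ^ (-(2 * b + 3) : ℂ) * Complex.I_sq)
    ((continuous_const.mul ((Complex.continuous_ofReal.comp (continuous_weight hb.le)).mul
      ((hc _).mul (by fun_prop)))).intervalIntegrable _ _)
  rw [intervalIntegral.integral_const_mul] at h
  have hne : (b + 1) ≠ 0 := by positivity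
  have hne' : (b : ℂ) + 1 ≠ 0 := by exact_mod_cast hne
  simpa [Real.zero_rpow hne, hne'] using h

lemma hasDerivAt_integral_weight_mul_cpow {b : ℝ} (hb : 0 < b) (z ε : ℝ) :
    HasDerivAt (fun ε : ℝ => ∫ t in (-1 : ℝ)..1, (((1 - t ^ 2) ^ b : ℝ) : ℂ) *
      (1 + Complex.I * ε * (t - z)) ^ (-(2 * b + 2) : ℂ))
      (∫ t in (-1 : ℝ)..1, (((1 - t ^ 2) ^ b : ℝ) : ℂ) * ((-(2 * b + 2)) *
        (1 + Complex.I * ε * (t - z)) ^ (-(2 * b + 3) : ℂ) * (Complex.I * (t - z)))) ε := by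
  have hs : ∀ ε t : ℝ, (1 + Complex.I * ε * (t - z)) ∈ Complex.slitPlane := fun ε t => by
    left; simp
  have hc : ∀ (ε : ℝ) (c : ℂ), Continuous fun t : ℝ => (1 + Complex.I * ε * (t - z)) ^ c :=
    fun ε c => Continuous.cpow (by fun_prop) continuous_const (hs ε)
  have hw : Continuous fun t : ℝ => (((1 - t ^ 2) ^ b : ℝ) : ℂ) :=
    Complex.continuous_ofReal.comp (continuous_weight hb.le)
  refine (intervalIntegral.hasDerivAt_integral_of_dominated_loc_of_deriv_le
    (F := fun (ε : ℝ) (t : ℝ) => (((1 - t ^ 2) ^ b : ℝ) : ℂ) *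
      (1 + Complex.I * ε * (t - z)) ^ (-(2 * b + 2) : ℂ))
    (F' := fun (ε : ℝ) (t : ℝ) => (((1 - t ^ 2) ^ b : ℝ) : ℂ) * ((-(2 * b + 2)) *
        (1 + Complex.I * ε * (t - z)) ^ (-(2 * b + 3) : ℂ) * (Complex.I * (t - z))))
    (bound := fun t => |(1 - t ^ 2) ^ b| * ((2 * b + 2) * |t - z|))
    (s := univ) univ_mem ?_ ?_ ?_ ?_ ?_ ?_).2
  · exact Eventually.of_forall fun ε => (hw.mul (hc ε _)).aestronglyMeasurable
  · exact (hw.mul (hc ε _)).intervalIntegrable _ _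
  · exact (hw.mul ((continuous_const.mul (hc ε _)).mul (by fun_prop))).aestronglyMeasurable
  · refine Eventually.of_forall fun t _ ε _ => ?_
    have h1 : ‖(1 + Complex.I * ε * (t - z)) ^ (-(2 * b + 3) : ℂ)‖ ≤ 1 := by
      rw [show (-(2 * b + 3) : ℂ) = ((-(2 * b + 3) : ℝ) : ℂ) by push_cast; ring,
        Complex.norm_cpow_real]
      refine Real.rpow_le_one_of_one_le_of_nonpos ?_ (by linarith)
      refine le_trans ?_ (Complex.abs_re_le_norm _)
      simp
    have h2 : ‖(-(2 * b + 2) : ℂ)‖ = 2 * b + 2 := by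
      rw [norm_neg, show (2 * b + 2 : ℂ) = ((2 * b + 2 : ℝ) : ℂ) by push_cast; ring,
        Complex.norm_real, Real.norm_of_nonneg (by positivity)]
    have h3 : ‖(t : ℂ) - z‖ = |t - z| := by
      rw [← Complex.ofReal_sub, Complex.norm_real, Real.norm_eq_abs]
    rw [norm_mul, norm_mul, norm_mul, norm_mul, h2, h3, Complex.norm_real, Complex.norm_I,
      one_mul, Real.norm_eq_abs]
    gcongr
    exact mul_le_of_le_one_right (by positivity) h1
  · exact ((continuous_weight hb.le).abs.mul (by fun_prop)).intervalIntegrable _ _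
  · refine Eventually.of_forall fun t _ ε _ => ?_
    have h3 : HasDerivAt (fun ε : ℝ => 1 + Complex.I * ε * ((t : ℂ) - z))
        (Complex.I * (t - z)) ε := by
      have := hasDerivAt_add_mul_ofReal 1 (Complex.I * (t - z)) ε
      refine this.congr_of_eventuallyEq (Eventually.of_forall fun y => ?_)
      ring
    have h4 := (hasDerivAt_cpow_comp h3 (hs ε t) (-(2 * b + 2))).const_mul
      ((((1 - t ^ 2) ^ b : ℝ) : ℂ))
    refine h4.congr_deriv ?_
    rw [show (-(2 * b + 2) - 1 : ℂ) = -(2 * b + 3) by ring]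

lemma integral_weight_mul_cpow_one_add {b : ℝ} (hb : 0 < b) {z : ℝ} (hz : z ∈ Ioo (-1 : ℝ) 1)
    (ε : ℝ) :
    (1 + ε ^ 2 * (1 - z ^ 2) - 2 * Complex.I * ε * z) ^ (b + 1 : ℂ) *
      ∫ t in (-1 : ℝ)..1, (((1 - t ^ 2) ^ b : ℝ) : ℂ) *
        (1 + Complex.I * ε * (t - z)) ^ (-(2 * b + 2) : ℂ) = weightMass b := by
  have hpos : 0 < 1 - z ^ 2 := by nlinarith [hz.1, hz.2]
  set q : ℝ → ℂ := fun ε => 1 + ε ^ 2 * (1 - z ^ 2) - 2 * Complex.I * ε * z with hq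
  set J : ℝ → ℂ := fun ε => ∫ t in (-1 : ℝ)..1, (((1 - t ^ 2) ^ b : ℝ) : ℂ) *
        (1 + Complex.I * ε * (t - z)) ^ (-(2 * b + 2) : ℂ) with hJ
  have hqs : ∀ ε, q ε ∈ Complex.slitPlane := fun ε => by
    left
    have : (q ε).re = 1 + ε ^ 2 * (1 - z ^ 2) := by
      have : q ε = ((1 + ε ^ 2 * (1 - z ^ 2) : ℝ) : ℂ) + ((-2 * ε * z : ℝ) : ℂ) * Complex.I := by
        simp only [hq]; push_cast; ring
      rw [this, Complex.add_re, Complex.re_ofReal_mul, Complex.I_re, mul_zero, add_zero,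
        Complex.ofReal_re]
    rw [this]; positivity
  have hder : ∀ ε, HasDerivAt (fun ε => q ε ^ (b + 1 : ℂ) * J ε) 0 ε := fun ε => by
    have h1 : HasDerivAt q (2 * ε * (1 - z ^ 2) - 2 * Complex.I * z) ε := by
      have : HasDerivAt (fun w : ℂ => 1 + w ^ 2 * (1 - z ^ 2) - 2 * Complex.I * w * z)
          (2 * ε * (1 - z ^ 2) - 2 * Complex.I * z) (ε : ℂ) := by
        have e1 := (((hasDerivAt_pow 2 (ε : ℂ)).mul_const (1 - (z : ℂ) ^ 2)).const_add 1).sub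
          (((hasDerivAt_id (ε : ℂ)).const_mul (2 * Complex.I)).mul_const (z : ℂ))
        refine e1.congr_deriv ?_
        push_cast; ring
      exact this.comp_ofReal
    have h2 := (hasDerivAt_cpow_comp h1 (hqs ε) (b + 1)).mul
      (hasDerivAt_integral_weight_mul_cpow hb z ε)
    refine h2.congr_deriv ?_
    have hne : q ε ≠ 0 := Complex.slitPlane_ne_zero (hqs ε)
    have h3 := integral_weight_mul_cpow_deriv hb z ε
    have hs : ∀ t : ℝ, (1 + Complex.I * ε * (t - z)) ∈ Complex.slitPlane := fun t => by
      left; simp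
    have hc : ∀ (c : ℂ), Continuous fun t : ℝ => (1 + Complex.I * ε * (t - z)) ^ c :=
      fun c => Continuous.cpow (by fun_prop) continuous_const hs
    have hw : Continuous fun t : ℝ => (((1 - t ^ 2) ^ b : ℝ) : ℂ) :=
      Complex.continuous_ofReal.comp (continuous_weight hb.le)
    have h4 : (2 * ε * (1 - z ^ 2) - 2 * Complex.I * z) * J ε + q ε *
        (∫ t in (-1 : ℝ)..1, (((1 - t ^ 2) ^ b : ℝ) : ℂ) *
        ((1 + Complex.I * ε * (t - z)) ^ (-(2 * b + 3) : ℂ) * (-2 * Complex.I * (t - z)))) = 0 := by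
      rw [← h3, hJ, ← intervalIntegral.integral_const_mul, ← intervalIntegral.integral_const_mul,
        ← intervalIntegral.integral_add]
      · refine intervalIntegral.integral_congr fun t _ => ?_
        have e1 : (1 + Complex.I * ε * ((t : ℂ) - z)) ^ (-(2 * b + 2) : ℂ) =
            (1 + Complex.I * ε * ((t : ℂ) - z)) ^ (-(2 * b + 3) : ℂ) *
              (1 + Complex.I * ε * ((t : ℂ) - z)) := by
          rw [← cpow_add_one (Complex.slitPlane_ne_zero (hs t))]; congr 1; ring
        simp only [e1, hq]
        ring_nf
        simp only [Complex.I_sq]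
        ring
      · exact (continuous_const.mul (hw.mul (hc _))).intervalIntegrable _ _
      · exact (continuous_const.mul (hw.mul ((hc _).mul (by fun_prop)))).intervalIntegrable _ _
    have h5 : (∫ t in (-1 : ℝ)..1, (((1 - t ^ 2) ^ b : ℝ) : ℂ) * ((-(2 * b + 2)) *
        (1 + Complex.I * ε * (t - z)) ^ (-(2 * b + 3) : ℂ) * (Complex.I * (t - z)))) = (b + 1) *
        (∫ t in (-1 : ℝ)..1, (((1 - t ^ 2) ^ b : ℝ) : ℂ) *
        ((1 + Complex.I * ε * (t - z)) ^ (-(2 * b + 3) : ℂ) * (-2 * Complex.I * (t - z)))) := by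
      rw [← intervalIntegral.integral_const_mul]
      refine intervalIntegral.integral_congr fun t _ => ?_
      ring
    rw [h5, add_sub_cancel_right, cpow_add_one hne]
    linear_combination (b + 1) * q ε ^ (b : ℂ) * h4
  have h6 := is_const_of_deriv_eq_zero (fun ε => (hder ε).differentiableAt)
    (fun ε => (hder ε).deriv) ε 0
  rw [h6]
  simp only [hq, hJ]
  simp [weightMass, intervalIntegral.integral_ofReal]

lemma integral_weight_mul_cpow {b : ℝ} (hb : 0 < b) {z η : ℝ} (hz : z ∈ Ioo (-1 : ℝ) 1)
    (hη : 0 < η) :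
    ∫ t in (-1 : ℝ)..1, (((1 - t ^ 2) ^ b : ℝ) : ℂ) *
        (η + Complex.I * (t - z)) ^ (-(2 * b + 2) : ℂ) =
      weightMass b * (1 - (z + Complex.I * η) ^ 2) ^ (-(b + 1) : ℂ) := by
  have hpos : 0 < 1 - z ^ 2 := by nlinarith [hz.1, hz.2]
  have h := integral_weight_mul_cpow_one_add hb hz η⁻¹
  have hη' : (η : ℂ) ≠ 0 := by exact_mod_cast hη.ne'
  have h1 : (1 - ((z : ℂ) + Complex.I * η) ^ 2) ≠ 0 := by
    intro h0
    have := congrArg Complex.re h0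
    have e : (1 - ((z : ℂ) + Complex.I * η) ^ 2) =
        ((1 - z ^ 2 + η ^ 2 : ℝ) : ℂ) + ((-2 * z * η : ℝ) : ℂ) * Complex.I := by
      push_cast; ring_nf; simp only [Complex.I_sq]; ring
    rw [e, Complex.add_re, Complex.re_ofReal_mul, Complex.I_re, mul_zero, add_zero,
      Complex.ofReal_re, Complex.zero_re] at this
    nlinarith [sq_nonneg η]
  have h2 : (1 + (η⁻¹ : ℝ) ^ 2 * (1 - z ^ 2) - 2 * Complex.I * (η⁻¹ : ℝ) * z : ℂ) =
      ((η ^ 2)⁻¹ : ℝ) * (1 - ((z : ℂ) + Complex.I * η) ^ 2) := by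
    push_cast; field_simp; ring_nf; simp only [Complex.I_sq]; ring
  rw [h2, ofReal_mul_cpow (by positivity) h1] at h
  have h3 : ∀ t : ℝ, ((1 : ℂ) + Complex.I * (η⁻¹ : ℝ) * (t - z)) ^ (-(2 * b + 2) : ℂ) =
      ((η⁻¹ : ℝ) : ℂ) ^ (-(2 * b + 2) : ℂ) *
        (η + Complex.I * (t - z)) ^ (-(2 * b + 2) : ℂ) := fun t => by
    rw [← ofReal_mul_cpow (by positivity)]
    · congr 1; push_cast; field_simp
    · intro h0
      have := congrArg Complex.re h0
      simp at this
      exact hη.ne' this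
  simp_rw [h3] at h
  have h4 : (((η ^ 2)⁻¹ : ℝ) : ℂ) ^ (b + 1 : ℂ) * ((η⁻¹ : ℝ) : ℂ) ^ (-(2 * b + 2) : ℂ) = 1 := by
    rw [show (b + 1 : ℂ) = ((b + 1 : ℝ) : ℂ) by push_cast; ring,
      show (-(2 * b + 2) : ℂ) = ((-(2 * b + 2) : ℝ) : ℂ) by push_cast; ring,
      ← Complex.ofReal_cpow (by positivity), ← Complex.ofReal_cpow (by positivity),
      ← Complex.ofReal_mul, ← inv_pow, ← Real.rpow_natCast, ← Real.rpow_mul (by positivity),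
      ← Real.rpow_add (by positivity)]
    push_cast
    rw [show 2 * (b + 1) + -(2 * b + 2) = 0 by ring, Real.rpow_zero, Complex.ofReal_one]
  have h5 : ∀ t : ℝ, (((1 - t ^ 2) ^ b : ℝ) : ℂ) * (((η⁻¹ : ℝ) : ℂ) ^ (-(2 * b + 2) : ℂ) *
        (η + Complex.I * (t - z)) ^ (-(2 * b + 2) : ℂ)) = ((η⁻¹ : ℝ) : ℂ) ^ (-(2 * b + 2) : ℂ) *
      ((((1 - t ^ 2) ^ b : ℝ) : ℂ) * (η + Complex.I * (t - z)) ^ (-(2 * b + 2) : ℂ)) :=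
    fun t => by ring
  simp_rw [h5, intervalIntegral.integral_const_mul] at h
  rw [← h, Complex.cpow_neg _ (b + 1 : ℂ)]
  have h6 : (1 - ((z : ℂ) + Complex.I * η) ^ 2) ^ (b + 1 : ℂ) ≠ 0 := by
    rw [Ne, Complex.cpow_eq_zero_iff]; tauto
  generalize (∫ t in (-1 : ℝ)..1, (((1 - t ^ 2) ^ b : ℝ) : ℂ) *
        (η + Complex.I * (t - z)) ^ (-(2 * b + 2) : ℂ)) = I
  have h7 := mul_inv_cancel₀ h6
  linear_combination (-I) * h4 - (((η ^ 2)⁻¹ : ℝ) : ℂ) ^ (b + 1 : ℂ) *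
    ((η⁻¹ : ℝ) : ℂ) ^ (-(2 * b + 2) : ℂ) * I * h7

lemma integrableOn_rpow_mul_exp {s δ : ℝ} (hs : -1 < s) (hδ : 0 < δ) :
    IntegrableOn (fun ξ : ℝ => ξ ^ s * Real.exp (-(δ * ξ))) (Ioi 0) := by
  refine (integrableOn_rpow_mul_exp_neg_mul_rpow hs one_pos hδ).congr_fun (fun ξ _ => ?_)
    measurableSet_Ioi
  simp

lemma measurable_rpow_mul_cexp (s : ℝ) (r : ℂ) :
    Measurable fun ξ : ℝ => ((ξ ^ s : ℝ) : ℂ) * Complex.exp (-(r * ξ)) :=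
  (Complex.measurable_ofReal.comp (measurable_id.pow_const s)).mul
    (by fun_prop : Continuous fun ξ : ℝ => Complex.exp (-(r * ξ))).measurable

lemma norm_rpow_mul_cexp (s : ℝ) {ξ : ℝ} (hξ : 0 < ξ) (r : ℂ) :
    ‖((ξ ^ s : ℝ) : ℂ) * Complex.exp (-(r * ξ))‖ = ξ ^ s * Real.exp (-(r.re * ξ)) := by
  rw [norm_mul, Complex.norm_real, Real.norm_of_nonneg (by positivity), Complex.norm_exp]
  simp

lemma integrableOn_rpow_mul_cexp {s : ℝ} (hs : -1 < s) {r : ℂ} (hr : 0 < r.re) :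
    IntegrableOn (fun ξ : ℝ => ((ξ ^ s : ℝ) : ℂ) * Complex.exp (-(r * ξ))) (Ioi 0) := by
  refine (integrableOn_rpow_mul_exp hs hr).mono'
    (measurable_rpow_mul_cexp s r).aestronglyMeasurable ?_
  filter_upwards [ae_restrict_mem measurableSet_Ioi] with ξ hξ
  rw [norm_rpow_mul_cexp s hξ]

lemma integral_rpow_mul_cexp_parts {s : ℝ} (hs : 0 < s) {r : ℂ} (hr : 0 < r.re) :
    r * ∫ ξ in Ioi (0 : ℝ), ((ξ ^ s : ℝ) : ℂ) * Complex.exp (-(r * ξ)) =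
      s * ∫ ξ in Ioi (0 : ℝ), ((ξ ^ (s - 1) : ℝ) : ℂ) * Complex.exp (-(r * ξ)) := by
  have i1 := integrableOn_rpow_mul_cexp (show -1 < s by linarith) hr
  have i2 := integrableOn_rpow_mul_cexp (show -1 < s - 1 by linarith) hr
  have h := integral_Ioi_of_hasDerivAt_of_tendsto (a := (0 : ℝ)) (m := 0)
    (f := fun ξ : ℝ => ((ξ ^ s : ℝ) : ℂ) * Complex.exp (-(r * ξ)))
    (f' := fun ξ : ℝ => s * (((ξ ^ (s - 1) : ℝ) : ℂ) * Complex.exp (-(r * ξ))) -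
      r * (((ξ ^ s : ℝ) : ℂ) * Complex.exp (-(r * ξ))))
    (by
      refine ContinuousAt.continuousWithinAt (ContinuousAt.mul ?_ (by fun_prop))
      exact Complex.continuous_ofReal.continuousAt.comp
        (Real.continuousAt_rpow_const 0 s (Or.inr hs.le)))
    (fun ξ hξ => by
      have hξ : 0 < ξ := hξ
      have h1 := (Real.hasDerivAt_rpow_const (x := ξ) (p := s) (Or.inl hξ.ne')).ofReal_comp
      have h2 : HasDerivAt (fun ξ : ℝ => Complex.exp (-(r * ξ)))
          (Complex.exp (-(r * ξ)) * (-(r * 1))) ξ :=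
        (((hasDerivAt_id (ξ : ℂ)).const_mul r).neg.cexp).comp_ofReal
      refine (h1.mul h2).congr_deriv ?_
      push_cast; ring)
    ((i2.const_mul _).sub (i1.const_mul _))
    (by
      rw [tendsto_zero_iff_norm_tendsto_zero]
      refine (tendsto_rpow_mul_exp_neg_mul_atTop_nhds_zero s r.re hr).congr' ?_
      filter_upwards [eventually_gt_atTop 0] with ξ hξ
      rw [norm_rpow_mul_cexp s hξ, neg_mul])
  rw [integral_sub (i2.const_mul _) (i1.const_mul _), integral_const_mul, integral_const_mul] at h
  simp only [Real.zero_rpow hs.ne', Complex.ofReal_zero, zero_mul, sub_zero] at h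
  linear_combination -h

lemma hasDerivAt_integral_rpow_mul_cexp {s η : ℝ} (hs : 0 < s) (hη : 0 < η) (τ : ℝ) :
    HasDerivAt (fun τ : ℝ => ∫ ξ in Ioi (0 : ℝ), ((ξ ^ (s - 1) : ℝ) : ℂ) *
        Complex.exp (-((η + Complex.I * τ) * ξ)))
      (-Complex.I * ∫ ξ in Ioi (0 : ℝ), ((ξ ^ s : ℝ) : ℂ) *
        Complex.exp (-((η + Complex.I * τ) * ξ))) τ := by
  rw [← integral_const_mul]
  have hre : ∀ τ : ℝ, 0 < ((η : ℂ) + Complex.I * τ).re := fun τ => by simpa using hη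
  have hre' : ∀ τ : ℝ, ((η : ℂ) + Complex.I * τ).re = η := fun τ => by simp
  refine (hasDerivAt_integral_of_dominated_loc_of_deriv_le (s := univ)
    (bound := fun ξ => ξ ^ s * Real.exp (-(η * ξ)))
    (F := fun (τ : ℝ) (ξ : ℝ) => ((ξ ^ (s - 1) : ℝ) : ℂ) *
        Complex.exp (-((η + Complex.I * τ) * ξ)))
    (F' := fun (τ : ℝ) (ξ : ℝ) => -Complex.I * (((ξ ^ s : ℝ) : ℂ) *
        Complex.exp (-((η + Complex.I * τ) * ξ)))) univ_mem
    (Eventually.of_forall fun τ => (measurable_rpow_mul_cexp _ _).aestronglyMeasurable)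
    (integrableOn_rpow_mul_cexp (by linarith) (hre τ))
    ((measurable_rpow_mul_cexp _ _).const_mul _).aestronglyMeasurable ?_
    (integrableOn_rpow_mul_exp (by linarith) hη) ?_).2
  · filter_upwards [ae_restrict_mem measurableSet_Ioi] with ξ hξ τ _
    rw [norm_mul, norm_rpow_mul_cexp s hξ, hre']
    simp
  · filter_upwards [ae_restrict_mem measurableSet_Ioi] with ξ hξ τ _
    have hξ : 0 < ξ := hξ
    have h1 : HasDerivAt (fun τ : ℝ => -(((η : ℂ) + Complex.I * τ) * ξ)) (-(Complex.I * ξ)) τ :=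
      ((hasDerivAt_add_mul_ofReal (η : ℂ) Complex.I τ).mul_const (ξ : ℂ)).neg
    refine (h1.cexp.const_mul (((ξ ^ (s - 1) : ℝ) : ℂ))).congr_deriv ?_
    have : ξ ^ s = ξ ^ (s - 1) * ξ := by rw [← Real.rpow_add_one hξ.ne']; ring_nf
    rw [this]; push_cast; ring

lemma integral_rpow_mul_cexp {s η : ℝ} (hs : 0 < s) (hη : 0 < η) (τ : ℝ) :
    ∫ ξ in Ioi (0 : ℝ), ((ξ ^ (s - 1) : ℝ) : ℂ) * Complex.exp (-((η + Complex.I * τ) * ξ)) =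
      Real.Gamma s * (η + Complex.I * τ) ^ (-s : ℂ) := by
  have hre : ∀ τ : ℝ, 0 < ((η : ℂ) + Complex.I * τ).re := fun τ => by simpa using hη
  have hsl : ∀ τ : ℝ, ((η : ℂ) + Complex.I * τ) ∈ Complex.slitPlane := fun τ => Or.inl (hre τ)
  have hne : ∀ τ : ℝ, ((η : ℂ) + Complex.I * τ) ≠ 0 := fun τ =>
    Complex.slitPlane_ne_zero (hsl τ)
  have hder : ∀ τ : ℝ, HasDerivAt (fun τ : ℝ => ((η : ℂ) + Complex.I * τ) ^ (s : ℂ) *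
      ∫ ξ in Ioi (0 : ℝ), ((ξ ^ (s - 1) : ℝ) : ℂ) * Complex.exp (-((η + Complex.I * τ) * ξ)))
      0 τ := fun τ => by
    refine ((hasDerivAt_cpow_comp (hasDerivAt_add_mul_ofReal (η : ℂ) Complex.I τ) (hsl τ)
      (s : ℂ)).mul (hasDerivAt_integral_rpow_mul_cexp hs hη τ)).congr_deriv ?_
    have h1 := integral_rpow_mul_cexp_parts hs (hre τ)
    have h2 := cpow_add_one (hne τ) (s - 1)
    rw [sub_add_cancel] at h2
    rw [h2]
    linear_combination (-Complex.I * ((η : ℂ) + Complex.I * τ) ^ (s - 1 : ℂ)) * h1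
  have h := is_const_of_deriv_eq_zero (fun τ => (hder τ).differentiableAt)
    (fun τ => (hder τ).deriv) τ 0
  have h0 : ∫ ξ in Ioi (0 : ℝ), ((ξ ^ (s - 1) : ℝ) : ℂ) *
      Complex.exp (-((η + Complex.I * (0 : ℝ)) * ξ)) = (((1 / η) ^ s * Real.Gamma s : ℝ) : ℂ) := by
    rw [← Real.integral_rpow_mul_exp_neg_mul_Ioi hs hη, ← integral_complex_ofReal]
    refine integral_congr_ae (Eventually.of_forall fun ξ => ?_)
    push_cast
    simp
  rw [h0, Complex.ofReal_zero, mul_zero, add_zero, ← Complex.ofReal_cpow hη.le,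
    ← Complex.ofReal_mul, ← mul_assoc, ← Real.mul_rpow hη.le (by positivity),
    mul_one_div_cancel hη.ne', Real.one_rpow, one_mul] at h
  rw [← h, Complex.cpow_neg]
  have h6 : ((η : ℂ) + Complex.I * τ) ^ (s : ℂ) ≠ 0 := by
    rw [Ne, Complex.cpow_eq_zero_iff]; exact fun h => hne τ h.1
  field_simp

/-- The cosine transform over `(-1, 1)`. -/
noncomputable def cosT (u : ℝ → ℝ) (ξ : ℝ) : ℝ := ∫ t in (-1 : ℝ)..1, u t * Real.cos (ξ * t)

lemma continuous_cosT {u : ℝ → ℝ} (hu : Continuous u) : Continuous (cosT u) :=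
  intervalIntegral.continuous_parametric_intervalIntegral_of_continuous'
    (f := fun ξ t => u t * Real.cos (ξ * t)) (by fun_prop) _ _

lemma abs_cosT_le {u : ℝ → ℝ} (hu : Continuous u) (ξ : ℝ) :
    |cosT u ξ| ≤ ∫ t in (-1 : ℝ)..1, |u t| := by
  rw [← Real.norm_eq_abs]
  refine intervalIntegral.norm_integral_le_of_norm_le (by norm_num)
    (Eventually.of_forall fun t _ => ?_) (hu.abs.intervalIntegrable _ _)
  rw [norm_mul, Real.norm_eq_abs, Real.norm_eq_abs]
  exact mul_le_of_le_one_right (abs_nonneg _) (Real.abs_cos_le_one _)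

lemma integral_odd_eq_zero {u : ℝ → ℝ} (hu : ∀ t, u (-t) = -u t) :
    ∫ t in (-1 : ℝ)..1, u t = 0 := by
  have h := intervalIntegral.integral_comp_neg (a := (-1 : ℝ)) (b := 1) u
  simp_rw [hu, neg_neg] at h
  rw [intervalIntegral.integral_neg] at h
  linarith

lemma cosT_eq_cexp {u : ℝ → ℝ} (hu : Continuous u) (he : ∀ t, u (-t) = u t) (ξ : ℝ) :
    (cosT u ξ : ℂ) = ∫ t in (-1 : ℝ)..1, (u t : ℂ) * Complex.exp (-(Complex.I * t * ξ)) := by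
  have h1 : ∀ t : ℝ, (u t : ℂ) * Complex.exp (-(Complex.I * t * ξ)) =
      ((u t * Real.cos (ξ * t) : ℝ) : ℂ) - Complex.I * ((u t * Real.sin (ξ * t) : ℝ) : ℂ) := by
    intro t
    rw [show -(Complex.I * t * ξ) = ((-(ξ * t) : ℝ) : ℂ) * Complex.I by push_cast; ring,
      Complex.exp_mul_I, ← Complex.ofReal_cos, ← Complex.ofReal_sin, Real.cos_neg, Real.sin_neg]
    push_cast; ring
  simp_rw [h1]
  rw [intervalIntegral.integral_sub, intervalIntegral.integral_const_mul,
    intervalIntegral.integral_ofReal, intervalIntegral.integral_ofReal,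
    integral_odd_eq_zero (u := fun t => u t * Real.sin (ξ * t))]
  · simp [cosT]
  · intro t; simp [he]
  · exact Continuous.intervalIntegrable (by fun_prop) _ _
  · exact (by fun_prop : Continuous fun t : ℝ =>
      Complex.I * ((u t * Real.sin (ξ * t) : ℝ) : ℂ)).intervalIntegrable _ _

lemma cosT_weight_mul_jacobiPoly {a : ℝ} (ha : 0 < a) (m : ℕ) (ξ : ℝ) :
    cosT (fun t => (1 - t ^ 2) ^ a * (jacobiPoly a (2 * m)).eval t) ξ =
      (-1) ^ m * ξ ^ (2 * m) / (2 ^ (2 * m) * (2 * m).factorial) *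
        cosT (fun t => (1 - t ^ 2) ^ (a + (2 * m : ℕ))) ξ := by
  have h := integral_jacobiPoly_eq ha (2 * m)
    (fun j t => ξ ^ j * Real.cos (ξ * t + j * (Real.pi / 2))) (fun j t => by
      have h1 : HasDerivAt (fun t : ℝ => ξ * t + j * (Real.pi / 2)) ξ t := by
        simpa using ((hasDerivAt_id t).const_mul ξ).add_const (j * (Real.pi / 2))
      refine (h1.cos.const_mul (ξ ^ j)).congr_deriv ?_
      push_cast
      rw [show ξ * t + ((j : ℝ) + 1) * (Real.pi / 2) = ξ * t + j * (Real.pi / 2) + Real.pi / 2 by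
        ring, Real.cos_add_pi_div_two]
      ring)
  have h2 : ∀ t : ℝ, Real.cos (ξ * t + (2 * m : ℕ) * (Real.pi / 2)) =
      (-1) ^ m * Real.cos (ξ * t) := fun t => by
    rw [show ξ * t + (2 * m : ℕ) * (Real.pi / 2) = ξ * t + m * Real.pi by push_cast; ring,
      Real.cos_add_nat_mul_pi]
  simp_rw [h2] at h
  simp only [pow_zero, CharP.cast_eq_zero, zero_mul, add_zero, one_mul] at h
  rw [cosT, h, cosT, ← intervalIntegral.integral_const_mul, ← intervalIntegral.integral_const_mul]
  refine intervalIntegral.integral_congr fun t _ => ?_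
  ring

lemma integral_mul_cosT_weight {b : ℝ} (hb : 0 < b) {z η : ℝ} (hz : z ∈ Ioo (-1 : ℝ) 1)
    (hη : 0 < η) :
    ∫ ξ in Ioi (0 : ℝ), ((ξ ^ (2 * b + 1) : ℝ) : ℂ) * Complex.exp (-((η - Complex.I * z) * ξ)) *
      (cosT (fun t => (1 - t ^ 2) ^ b) ξ : ℂ) =
    Real.Gamma (2 * b + 2) * weightMass b *
      (1 - (z + Complex.I * η) ^ 2) ^ (-(b + 1) : ℂ) := by
  have hw := continuous_weight hb.le
  have hwc : Continuous fun t : ℝ => (((1 - t ^ 2) ^ b : ℝ) : ℂ) :=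
    Complex.continuous_ofReal.comp hw
  rw [mul_assoc, ← integral_weight_mul_cpow hb hz hη, ← intervalIntegral.integral_const_mul,
    intervalIntegral.integral_of_le (by norm_num)]
  have hG : IntegrableOn (fun ξ : ℝ => ((ξ ^ (2 * b + 1) : ℝ) : ℂ) *
      Complex.exp (-((η - Complex.I * z) * ξ))) (Ioi 0) :=
    integrableOn_rpow_mul_cexp (by linarith) (by simpa using hη)
  have hW : IntegrableOn (fun t : ℝ => (((1 - t ^ 2) ^ b : ℝ) : ℂ)) (Ioc (-1) 1) :=
    (hwc.intervalIntegrable (-1) 1).1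
  have hF : Integrable (Function.uncurry fun ξ t : ℝ => ((ξ ^ (2 * b + 1) : ℝ) : ℂ) *
      Complex.exp (-((η - Complex.I * z) * ξ)) * ((((1 - t ^ 2) ^ b : ℝ) : ℂ)) *
      Complex.exp (-(Complex.I * t * ξ)))
      ((volume.restrict (Ioi 0)).prod (volume.restrict (Ioc (-1) 1))) := by
    refine (Integrable.mul_prod hG hW).mul_bdd (c := 1)
      (by fun_prop : Continuous fun p : ℝ × ℝ =>
        Complex.exp (-(Complex.I * p.2 * p.1))).aestronglyMeasurable
      (Eventually.of_forall fun p => ?_)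
    rw [Complex.norm_exp]
    simp
  calc _ = ∫ ξ in Ioi (0 : ℝ), ∫ t in Ioc (-1 : ℝ) 1, ((ξ ^ (2 * b + 1) : ℝ) : ℂ) *
      Complex.exp (-((η - Complex.I * z) * ξ)) * ((((1 - t ^ 2) ^ b : ℝ) : ℂ)) *
      Complex.exp (-(Complex.I * t * ξ)) := by
        refine integral_congr_ae (Eventually.of_forall fun ξ => ?_)
        simp only
        rw [cosT_eq_cexp hw (by simp), intervalIntegral.integral_of_le (by norm_num),
          ← integral_const_mul]
        refine integral_congr_ae (Eventually.of_forall fun t => ?_)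
        simp only
        ring
    _ = _ := by
      rw [integral_integral_swap hF]
      refine integral_congr_ae (Eventually.of_forall fun t => ?_)
      have h := integral_rpow_mul_cexp (s := 2 * b + 2) (by linarith) hη (t - z)
      push_cast at h
      simp only
      rw [mul_left_comm, ← h, ← integral_const_mul]
      refine integral_congr_ae (Eventually.of_forall fun ξ => ?_)
      simp only
      rw [mul_right_comm, mul_assoc _ (Complex.exp _) (Complex.exp _), ← Complex.exp_add,
        show 2 * b + 2 - 1 = 2 * b + 1 by ring]
      rw [mul_comm]
      congr 3
      ring

lemma integral_pow_mul_exp (k : ℕ) {ξ : ℝ} (hξ : 0 < ξ) :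
    ∫ y in Ioi (0 : ℝ), y ^ k * Real.exp (-(ξ * y)) = k.factorial / ξ ^ (k + 1) := by
  have h := Real.integral_rpow_mul_exp_neg_mul_Ioi (a := k + 1) (by positivity) hξ
  simp only [add_sub_cancel_right, Real.rpow_natCast, Real.Gamma_nat_eq_factorial] at h
  rw [h, ← Nat.cast_add_one, Real.rpow_natCast]
  rw [one_div, inv_pow]; field_simp

/-- The Laplace-type integral of `y ^ k (1 - (z + i (δ + y)) ^ 2) ^ (-(b + 1))`. -/
noncomputable def rayInt (b : ℝ) (k : ℕ) (δ z : ℝ) : ℂ :=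
  ∫ y in Ioi (0 : ℝ), (y : ℂ) ^ k * (1 - (z + Complex.I * (δ + y)) ^ 2) ^ (-(b + 1) : ℂ)

lemma integral_mul_cosT_weight_eq_rayInt {b : ℝ} (hb : 0 < b) {k : ℕ} (hk : k ≤ b) {z δ : ℝ}
    (hz : z ∈ Ioo (-1 : ℝ) 1) (hδ : 0 < δ) :
    ∫ ξ in Ioi (0 : ℝ), ((ξ ^ (2 * b - k) : ℝ) : ℂ) * Complex.exp (-((δ - Complex.I * z) * ξ)) *
      (cosT (fun t => (1 - t ^ 2) ^ b) ξ : ℂ) =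
    Real.Gamma (2 * b + 2) * weightMass b / k.factorial * rayInt b k δ z := by
  have hw := continuous_weight hb.le
  have hkf : (k.factorial : ℂ) ≠ 0 := by exact_mod_cast k.factorial_ne_zero
  set Φ : ℝ → ℝ → ℂ := fun ξ y => ((ξ ^ (2 * b + 1) : ℝ) : ℂ) *
    Complex.exp (-((δ - Complex.I * z) * ξ)) * (cosT (fun t => (1 - t ^ 2) ^ b) ξ : ℂ) *
    ((y ^ k * Real.exp (-(ξ * y)) : ℝ) : ℂ) with hΦ
  have hm1 : Measurable fun ξ : ℝ => ((ξ ^ (2 * b + 1) : ℝ) : ℂ) *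
    Complex.exp (-((δ - Complex.I * z) * ξ)) * (cosT (fun t => (1 - t ^ 2) ^ b) ξ : ℂ) :=
    (measurable_rpow_mul_cexp _ _).mul
      (Complex.continuous_ofReal.comp (continuous_cosT hw)).measurable
  have hm2 : Measurable (Function.uncurry Φ) :=
    (hm1.comp measurable_fst).mul (by fun_prop : Continuous fun p : ℝ × ℝ =>
      ((p.2 ^ k * Real.exp (-(p.1 * p.2)) : ℝ) : ℂ)).measurable
  have hinner : ∀ ξ : ℝ, 0 < ξ → ∫ y in Ioi (0 : ℝ), Φ ξ y = k.factorial *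
      (((ξ ^ (2 * b - k) : ℝ) : ℂ) * Complex.exp (-((δ - Complex.I * z) * ξ)) *
      (cosT (fun t => (1 - t ^ 2) ^ b) ξ : ℂ)) := fun ξ hξ => by
    have e : ξ ^ (2 * b + 1) = ξ ^ (2 * b - k) * ξ ^ (k + 1) := by
      rw [← Real.rpow_natCast ξ (k + 1), ← Real.rpow_add hξ]; push_cast; ring_nf
    have hξ' : (ξ : ℂ) ≠ 0 := by exact_mod_cast hξ.ne'
    simp only [hΦ]
    rw [integral_const_mul, integral_complex_ofReal, integral_pow_mul_exp k hξ, e]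
    push_cast
    field_simp
  have hcast : ∀ y : ℝ, 0 < y → ∀ ξ : ℝ, Φ ξ y = (y : ℂ) ^ k * (((ξ ^ (2 * b + 1) : ℝ) : ℂ) *
      Complex.exp (-(((δ + y : ℝ) - Complex.I * z) * ξ)) *
        (cosT (fun t => (1 - t ^ 2) ^ b) ξ : ℂ)) := fun y hy ξ => by
    have : Complex.exp (-(((δ + y : ℝ) - Complex.I * z) * ξ)) =
        Complex.exp (-((δ - Complex.I * z) * ξ)) * ((Real.exp (-(ξ * y)) : ℝ) : ℂ) := by
      rw [Complex.ofReal_exp, ← Complex.exp_add]; congr 1; push_cast; ring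
    simp only [hΦ]
    rw [this]; push_cast; ring
  have hint : Integrable (Function.uncurry Φ)
      ((volume.restrict (Ioi 0)).prod (volume.restrict (Ioi 0))) := by
    rw [integrable_prod_iff hm2.aestronglyMeasurable]
    have hpi : ∀ ξ : ℝ, 0 < ξ →
        IntegrableOn (fun y : ℝ => y ^ k * Real.exp (-(ξ * y))) (Ioi 0) := fun ξ hξ => by
      simpa using integrableOn_rpow_mul_exp (s := k)
        (by linarith [(by positivity : (0 : ℝ) ≤ k)]) hξ
    constructor
    · filter_upwards [ae_restrict_mem measurableSet_Ioi] with ξ hξ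
      simp only [Function.uncurry, hΦ]
      exact ((hpi ξ hξ).ofReal (𝕜 := ℂ)).const_mul _
    · have hdom := ((integrableOn_rpow_mul_exp (s := 2 * b - k) (by
        linarith [(by positivity : (0 : ℝ) ≤ k)]) hδ).const_mul
        (k.factorial : ℝ)).mul_const (∫ t in (-1 : ℝ)..1, |(1 - t ^ 2) ^ b|)
      refine hdom.mono' hm2.norm.aestronglyMeasurable.integral_prod_right' ?_
      filter_upwards [ae_restrict_mem measurableSet_Ioi] with ξ hξ
      have hξ : 0 < ξ := hξ
      have e : ξ ^ (2 * b + 1) = ξ ^ (2 * b - k) * ξ ^ (k + 1) := by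
        rw [← Real.rpow_natCast ξ (k + 1), ← Real.rpow_add hξ]; push_cast; ring_nf
      rw [Real.norm_of_nonneg (integral_nonneg fun _ => norm_nonneg _)]
      have h1 : ∫ y in Ioi (0 : ℝ), ‖Function.uncurry Φ (ξ, y)‖ =
          ξ ^ (2 * b + 1) * Real.exp (-(δ * ξ)) * |cosT (fun t => (1 - t ^ 2) ^ b) ξ| *
            ∫ y in Ioi (0 : ℝ), y ^ k * Real.exp (-(ξ * y)) := by
        rw [← integral_const_mul]
        refine setIntegral_congr_fun measurableSet_Ioi fun y hy => ?_
        have hy : 0 < y := hy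
        simp only [Function.uncurry, hΦ]
        rw [norm_mul, norm_mul, norm_rpow_mul_cexp _ hξ, Complex.norm_real, Complex.norm_real,
          Real.norm_eq_abs, Real.norm_of_nonneg (by positivity)]
        simp
      rw [h1, integral_pow_mul_exp k hξ, e]
      have h2 := abs_cosT_le hw ξ
      have h3 : ξ ^ (2 * b - ↑k) * ξ ^ (k + 1) * Real.exp (-(δ * ξ)) *
          |cosT (fun t => (1 - t ^ 2) ^ b) ξ| * (k.factorial / ξ ^ (k + 1)) =
          (k.factorial * (ξ ^ (2 * b - ↑k) * Real.exp (-(δ * ξ)))) *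
            |cosT (fun t => (1 - t ^ 2) ^ b) ξ| := by
        field_simp
      rw [h3]
      exact mul_le_mul_of_nonneg_left h2 (by positivity)
  have h1 := integral_integral_swap hint
  rw [setIntegral_congr_fun measurableSet_Ioi (fun ξ hξ => hinner ξ hξ),
    integral_const_mul] at h1
  have h2 : ∫ y in Ioi (0 : ℝ), ∫ ξ in Ioi (0 : ℝ), Φ ξ y =
      Real.Gamma (2 * b + 2) * weightMass b * rayInt b k δ z := by
    rw [rayInt, ← integral_const_mul]
    refine setIntegral_congr_fun measurableSet_Ioi fun y hy => ?_
    have hy : 0 < y := hy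
    simp only [hcast y hy]
    rw [integral_const_mul, integral_mul_cosT_weight hb hz (by positivity)]
    push_cast
    ring
  rw [h2] at h1
  rw [div_mul_eq_mul_div, eq_div_iff hkf, mul_comm]
  exact h1

lemma one_sub_sq_eq (z y : ℝ) : (1 - ((z : ℂ) + Complex.I * y) ^ 2) =
    ((1 - z ^ 2 + y ^ 2 : ℝ) : ℂ) + ((-2 * z * y : ℝ) : ℂ) * Complex.I := by
  push_cast; ring_nf; simp only [Complex.I_sq]; ring

lemma one_sub_sq_re (z y : ℝ) : (1 - ((z : ℂ) + Complex.I * y) ^ 2).re = 1 - z ^ 2 + y ^ 2 := by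
  rw [one_sub_sq_eq, Complex.add_re, Complex.re_ofReal_mul, Complex.I_re, mul_zero, add_zero,
    Complex.ofReal_re]

lemma one_sub_sq_pos {z : ℝ} (hz : z ∈ Ioo (-1 : ℝ) 1) : 0 < 1 - z ^ 2 := by
  nlinarith [hz.1, hz.2]

lemma one_sub_sq_mem_slitPlane {z : ℝ} (hz : z ∈ Ioo (-1 : ℝ) 1) (y : ℝ) :
    (1 - ((z : ℂ) + Complex.I * y) ^ 2) ∈ Complex.slitPlane := by
  left
  rw [one_sub_sq_re]
  have := one_sub_sq_pos hz
  positivity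

lemma le_norm_one_sub_sq (z y : ℝ) :
    1 - z ^ 2 + y ^ 2 ≤ ‖1 - ((z : ℂ) + Complex.I * y) ^ 2‖ := by
  rw [← one_sub_sq_re]
  exact (le_abs_self _).trans (Complex.abs_re_le_norm _)

lemma abs_le_norm_one_sub_sq (z y : ℝ) : |y| ≤ ‖1 - ((z : ℂ) + Complex.I * y) ^ 2‖ := by
  refine abs_le_of_sq_le_sq' ?_ (norm_nonneg _) |> fun h => abs_le.2 h
  rw [one_sub_sq_eq, ← Complex.normSq_eq_norm_sq, Complex.normSq_add_mul_I]
  nlinarith [sq_nonneg (1 - z ^ 2), sq_nonneg (y ^ 2), sq_nonneg (z * y), sq_nonneg y]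

lemma norm_one_sub_sq_cpow (z y c : ℝ) : ‖(1 - ((z : ℂ) + Complex.I * y) ^ 2) ^ (-(c + 1) : ℂ)‖ =
    ‖1 - ((z : ℂ) + Complex.I * y) ^ 2‖ ^ (-(c + 1)) := by
  rw [← Complex.norm_cpow_real]; push_cast; rfl

/-- An integrable majorant on `(0, ∞)`. -/
noncomputable def rayBound (y : ℝ) : ℝ := min (y ^ (-(3 / 4) : ℝ)) (y ^ (-(3 / 2) : ℝ))

lemma integrableOn_rayBound : IntegrableOn rayBound (Ioi 0) := by
  have hm : Measurable rayBound :=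
    (measurable_id.pow_const _).min (measurable_id.pow_const _)
  rw [← Ioc_union_Ioi_eq_Ioi zero_le_one]
  refine IntegrableOn.union ?_ ?_
  · have h : IntegrableOn (fun y : ℝ => y ^ (-(3 / 4) : ℝ)) (Ioc 0 1) :=
      (intervalIntegrable_iff_integrableOn_Ioc_of_le zero_le_one).1
        (intervalIntegral.intervalIntegrable_rpow' (by norm_num))
    refine h.mono' hm.aestronglyMeasurable ?_
    filter_upwards [ae_restrict_mem measurableSet_Ioc] with y hy
    have := hy.1
    rw [Real.norm_of_nonneg (by unfold rayBound; positivity)]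
    exact min_le_left _ _
  · have h : IntegrableOn (fun y : ℝ => y ^ (-(3 / 2) : ℝ)) (Ioi 1) :=
      integrableOn_Ioi_rpow_of_lt (by norm_num) one_pos
    refine h.mono' hm.aestronglyMeasurable ?_
    filter_upwards [ae_restrict_mem measurableSet_Ioi] with y hy
    have : (0 : ℝ) < y := one_pos.trans hy
    rw [Real.norm_of_nonneg (by unfold rayBound; positivity)]
    exact min_le_right _ _

lemma norm_ray_integrand_le {a : ℝ} (ha : 0 < a) (k : ℕ) {z : ℝ}
    (hz : z ∈ Ioo (-1 : ℝ) 1) {δ y : ℝ} (hδ : 0 ≤ δ) (hy : 0 < y) :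
    ‖(y : ℂ) ^ k * (1 - ((z : ℂ) + Complex.I * (δ + y)) ^ 2) ^ (-((a + k : ℝ) + 1) : ℂ)‖ ≤
      (1 - z ^ 2) ^ (-(a + 1 / 4)) * rayBound y := by
  have hD := one_sub_sq_pos hz
  have hyy : 0 < δ + y := by positivity
  rw [← Complex.ofReal_add, norm_mul, norm_one_sub_sq_cpow, norm_pow, Complex.norm_real,
    Real.norm_of_nonneg hy.le]
  set R := ‖1 - ((z : ℂ) + Complex.I * (δ + y : ℝ)) ^ 2‖ with hR
  have h1 : 1 - z ^ 2 + (δ + y) ^ 2 ≤ R := le_norm_one_sub_sq z (δ + y)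
  have h2 : δ + y ≤ R := (le_abs_self _).trans (abs_le_norm_one_sub_sq z (δ + y))
  have hR0 : 0 < R := hyy.trans_le h2
  have hRy : y ≤ R := by linarith
  have hRy2 : y ^ 2 ≤ R := by nlinarith
  have hRD : 1 - z ^ 2 ≤ R := by nlinarith
  have e : R ^ (-(a + k + 1)) = (R ^ k)⁻¹ * (R ^ (-(a + 1 / 4)) * R ^ (-(3 / 4) : ℝ)) := by
    rw [← Real.rpow_natCast, ← Real.rpow_neg hR0.le, ← Real.rpow_add hR0, ← Real.rpow_add hR0]
    congr 1; ring
  rw [e, ← mul_assoc]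
  have h3 : y ^ k * (R ^ k)⁻¹ ≤ 1 := by
    rw [← div_eq_mul_inv]
    exact div_le_one_of_le₀ (pow_le_pow_left₀ hy.le hRy k) (by positivity)
  refine (mul_le_of_le_one_left (by positivity) h3).trans ?_
  refine mul_le_mul (Real.rpow_le_rpow_of_nonpos hD hRD (by linarith)) (le_min ?_ ?_)
    (by positivity) (by positivity)
  · exact Real.rpow_le_rpow_of_nonpos hy hRy (by norm_num)
  · refine (Real.rpow_le_rpow_of_nonpos (by positivity) hRy2 (by norm_num)).trans_eq ?_
    rw [← Real.rpow_natCast, ← Real.rpow_mul hy.le]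
    norm_num

lemma measurable_ray_integrand (b : ℝ) (k : ℕ) {z : ℝ} (hz : z ∈ Ioo (-1 : ℝ) 1) (δ : ℝ) :
    Continuous fun y : ℝ =>
      (y : ℂ) ^ k * (1 - ((z : ℂ) + Complex.I * (δ + y)) ^ 2) ^ (-(b + 1) : ℂ) := by
  refine Continuous.mul (by fun_prop) (Continuous.cpow (by fun_prop) continuous_const fun y => ?_)
  simpa using one_sub_sq_mem_slitPlane hz (δ + y)

lemma norm_rayInt_le {a : ℝ} (ha : 0 < a) (k : ℕ) {z : ℝ} (hz : z ∈ Ioo (-1 : ℝ) 1) {δ : ℝ}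
    (hδ : 0 ≤ δ) :
    ‖rayInt (a + k) k δ z‖ ≤ (1 - z ^ 2) ^ (-(a + 1 / 4)) * ∫ y in Ioi (0 : ℝ), rayBound y := by
  rw [rayInt, ← integral_const_mul]
  refine norm_integral_le_of_norm_le (integrableOn_rayBound.const_mul _) ?_
  filter_upwards [ae_restrict_mem measurableSet_Ioi] with y hy
  exact norm_ray_integrand_le ha k hz hδ hy

lemma tendsto_rayInt {a : ℝ} (ha : 0 < a) (k : ℕ) {z : ℝ} (hz : z ∈ Ioo (-1 : ℝ) 1) :
    Tendsto (fun δ => rayInt (a + k) k δ z) (𝓝[>] 0) (𝓝 (rayInt (a + k) k 0 z)) := by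
  refine tendsto_integral_filter_of_dominated_convergence
    (fun y => (1 - z ^ 2) ^ (-(a + 1 / 4)) * rayBound y)
    (Eventually.of_forall fun δ => (measurable_ray_integrand _ _ hz δ).aestronglyMeasurable) ?_
    (integrableOn_rayBound.const_mul _) (Eventually.of_forall fun y => ?_)
  · filter_upwards [self_mem_nhdsWithin] with δ hδ
    filter_upwards [ae_restrict_mem measurableSet_Ioi] with y hy
    exact norm_ray_integrand_le ha k hz (le_of_lt hδ) hy
  · have hc : Continuous fun δ : ℝ =>
        (y : ℂ) ^ k * (1 - ((z : ℂ) + Complex.I * (δ + y)) ^ 2) ^ (-((a + k : ℝ) + 1) : ℂ) := by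
      refine Continuous.mul (by fun_prop)
        (Continuous.cpow (by fun_prop) continuous_const fun δ => ?_)
      simpa using one_sub_sq_mem_slitPlane hz (δ + y)
    exact (hc.tendsto 0).mono_left nhdsWithin_le_nhds

lemma norm_pow_mul_cpow_le {b : ℝ} (hb : 0 < b) {j : ℕ} (hj : j ≤ b) {ρ : ℝ}
    (hρ : 0 < ρ) {z : ℝ} (hz : ρ ≤ 1 - z ^ 2) (y : ℝ) :
    ‖(y : ℂ) ^ j * (1 - ((z : ℂ) + Complex.I * y) ^ 2) ^ (-(b + 1) : ℂ)‖ ≤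
      ρ ^ (-(b + 1)) * (1 + y ^ 2)⁻¹ := by
  have h1 : ρ * (1 + y ^ 2) ≤ ‖1 - ((z : ℂ) + Complex.I * y) ^ 2‖ :=
    le_trans (by nlinarith [sq_nonneg y, sq_nonneg z]) (le_norm_one_sub_sq z y)
  rw [norm_mul, norm_one_sub_sq_cpow, norm_pow, Complex.norm_real, Real.norm_eq_abs]
  have h2 : |y| ^ j ≤ (1 + y ^ 2) ^ b := by
    have : |y| ≤ 1 + y ^ 2 := by rw [← sq_abs]; nlinarith [sq_nonneg (|y| - 1)]
    refine (pow_le_pow_left₀ (abs_nonneg _) this j).trans ?_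
    rw [← Real.rpow_natCast]
    exact Real.rpow_le_rpow_of_exponent_le (by nlinarith [sq_nonneg y]) hj
  have h3 := Real.rpow_le_rpow_of_nonpos (by positivity) h1 (show -(b + 1) ≤ 0 by linarith)
  refine (mul_le_mul h2 h3 (by positivity) (by positivity)).trans_eq ?_
  rw [Real.mul_rpow hρ.le (by positivity), mul_left_comm, ← Real.rpow_add (by positivity)]
  rw [show b + -(b + 1) = -1 by ring, Real.rpow_neg_one]

lemma integrable_ray_integrand {b : ℝ} (hb : 0 < b) {j : ℕ} (hj : j ≤ b) {z : ℝ}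
    (hz : z ∈ Ioo (-1 : ℝ) 1) : Integrable fun y : ℝ =>
      (y : ℂ) ^ j * (1 - ((z : ℂ) + Complex.I * y) ^ 2) ^ (-(b + 1) : ℂ) := by
  have hc : Continuous fun y : ℝ =>
      (y : ℂ) ^ j * (1 - ((z : ℂ) + Complex.I * y) ^ 2) ^ (-(b + 1) : ℂ) := by
    refine Continuous.mul (by fun_prop) (Continuous.cpow (by fun_prop) continuous_const fun y => ?_)
    exact one_sub_sq_mem_slitPlane hz y
  refine (integrable_inv_one_add_sq.const_mul ((1 - z ^ 2) ^ (-(b + 1)))).mono'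
    hc.aestronglyMeasurable (Eventually.of_forall fun y => ?_)
  exact norm_pow_mul_cpow_le hb hj (one_sub_sq_pos hz) le_rfl y

lemma hasDerivAt_rayInt_aux {b : ℝ} (hb : 0 < b) {j : ℕ} (hj : j ≤ b) {z : ℝ}
    (hz : z ∈ Ioo (-1 : ℝ) 1) :
    IntegrableOn (fun y : ℝ => (y : ℂ) ^ j * (2 * (b + 1) * (z + Complex.I * y) *
        (1 - ((z : ℂ) + Complex.I * y) ^ 2) ^ (-(b + 1 + 1) : ℂ))) (Ioi 0) ∧
    HasDerivAt (fun z : ℝ => ∫ y in Ioi (0 : ℝ),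
        (y : ℂ) ^ j * (1 - ((z : ℂ) + Complex.I * y) ^ 2) ^ (-(b + 1) : ℂ))
      (∫ y in Ioi (0 : ℝ), (y : ℂ) ^ j * (2 * (b + 1) * (z + Complex.I * y) *
        (1 - ((z : ℂ) + Complex.I * y) ^ 2) ^ (-(b + 1 + 1) : ℂ))) z := by
  have hD := one_sub_sq_pos hz
  set ρ : ℝ := (1 - z ^ 2) / 2 with hρ
  have hρ0 : 0 < ρ := by positivity
  have hs : {w : ℝ | ρ < 1 - w ^ 2} ∈ 𝓝 z :=
    (isOpen_lt continuous_const (by fun_prop)).mem_nhds (by simp only [mem_ofPred_eq]; linarith)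
  have hmem : ∀ w : ℝ, ρ < 1 - w ^ 2 → w ∈ Ioo (-1 : ℝ) 1 := fun w hw =>
    ⟨by nlinarith, by nlinarith⟩
  have hsl : ∀ w : ℝ, ρ < 1 - w ^ 2 → ∀ y : ℝ,
    (1 - ((w : ℂ) + Complex.I * y) ^ 2) ∈ Complex.slitPlane := fun w hw y =>
      one_sub_sq_mem_slitPlane (hmem w hw) y
  have hzρ : ρ < 1 - z ^ 2 := by linarith
  have hc : ∀ w : ℝ, ρ < 1 - w ^ 2 → ∀ c : ℂ, Continuous fun y : ℝ =>
      (1 - ((w : ℂ) + Complex.I * y) ^ 2) ^ c := fun w hw c =>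
    Continuous.cpow (by fun_prop) continuous_const fun y => hsl w hw y
  refine hasDerivAt_integral_of_dominated_loc_of_deriv_le (s := {w : ℝ | ρ < 1 - w ^ 2})
    (F := fun (z y : ℝ) => (y : ℂ) ^ j * (1 - ((z : ℂ) + Complex.I * y) ^ 2) ^ (-(b + 1) : ℂ))
    (F' := fun (z y : ℝ) => (y : ℂ) ^ j * (2 * (b + 1) * (z + Complex.I * y) *
        (1 - ((z : ℂ) + Complex.I * y) ^ 2) ^ (-(b + 1 + 1) : ℂ)))
    (bound := fun y => 4 * (b + 1) * ρ ^ (-(b + 1 + 1)) * (1 + y ^ 2)⁻¹) hs ?_ ?_ ?_ ?_ ?_ ?_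
  · filter_upwards [hs] with w hw
    exact (Continuous.mul (by fun_prop) (hc w hw _)).aestronglyMeasurable
  · exact (integrable_ray_integrand hb hj hz).integrableOn
  · exact (Continuous.mul (by fun_prop) ((by fun_prop :
      Continuous fun y : ℝ => 2 * ((b : ℂ) + 1) * (z + Complex.I * y)).mul
        (hc z hzρ _))).aestronglyMeasurable
  · refine Eventually.of_forall fun y w hw => ?_
    have hw : ρ < 1 - w ^ 2 := hw
    have h1 : ρ * (1 + y ^ 2) ≤ ‖1 - ((w : ℂ) + Complex.I * y) ^ 2‖ :=
      le_trans (by nlinarith [sq_nonneg y]) (le_norm_one_sub_sq w y)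
    have h2 : |y| ^ j ≤ (1 + y ^ 2) ^ b := by
      have : |y| ≤ 1 + y ^ 2 := by rw [← sq_abs]; nlinarith [sq_nonneg (|y| - 1)]
      refine (pow_le_pow_left₀ (abs_nonneg _) this j).trans ?_
      rw [← Real.rpow_natCast]
      exact Real.rpow_le_rpow_of_exponent_le (by nlinarith [sq_nonneg y]) hj
    have h3 := Real.rpow_le_rpow_of_nonpos (by positivity) h1
      (show -(b + 1 + 1) ≤ 0 by linarith)
    have h4 : ‖(w : ℂ) + Complex.I * y‖ ≤ 2 * (1 + y ^ 2) := by
      refine (norm_add_le _ _).trans ?_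
      rw [norm_mul, Complex.norm_I, one_mul, Complex.norm_real, Complex.norm_real,
        Real.norm_eq_abs, Real.norm_eq_abs]
      have h5 : |w| ≤ 1 := (abs_le.2 ⟨(hmem w hw).1.le, (hmem w hw).2.le⟩)
      nlinarith [sq_nonneg (|y| - 1), sq_abs y]
    have h5 : ‖(1 - ((w : ℂ) + Complex.I * y) ^ 2) ^ (-(b + 1 + 1) : ℂ)‖ =
        ‖1 - ((w : ℂ) + Complex.I * y) ^ 2‖ ^ (-(b + 1 + 1)) := by
      have := norm_one_sub_sq_cpow w y (b + 1)
      push_cast at this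
      exact this
    have h6 : ‖(2 * (b + 1) : ℂ)‖ = 2 * (b + 1) := by
      rw [show (2 * (b + 1) : ℂ) = ((2 * (b + 1) : ℝ) : ℂ) by push_cast; ring,
        Complex.norm_real, Real.norm_of_nonneg (by positivity)]
    rw [norm_mul, norm_mul, norm_mul, h5, h6, norm_pow, Complex.norm_real, Real.norm_eq_abs]
    calc |y| ^ j * (2 * (b + 1) * ‖(w : ℂ) + Complex.I * y‖ *
          ‖1 - ((w : ℂ) + Complex.I * y) ^ 2‖ ^ (-(b + 1 + 1)))
        ≤ (1 + y ^ 2) ^ b * (2 * (b + 1) * (2 * (1 + y ^ 2)) *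
          (ρ * (1 + y ^ 2)) ^ (-(b + 1 + 1))) := by gcongr
      _ = 4 * (b + 1) * ρ ^ (-(b + 1 + 1)) * ((1 + y ^ 2) ^ b * (1 + y ^ 2) ^ (1 : ℝ) *
          (1 + y ^ 2) ^ (-(b + 1 + 1))) := by
        rw [Real.mul_rpow hρ0.le (by positivity), Real.rpow_one]; ring
      _ = _ := by
        rw [← Real.rpow_add (by positivity), ← Real.rpow_add (by positivity),
          show b + 1 + -(b + 1 + 1) = -1 by ring, Real.rpow_neg_one]
  · exact (integrable_inv_one_add_sq.const_mul _).integrableOn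
  · refine Eventually.of_forall fun y w hw => ?_
    have h1 : HasDerivAt (fun w : ℝ => 1 - ((w : ℂ) + Complex.I * y) ^ 2)
        (-(2 * (w + Complex.I * y))) w := by
      have := ((((hasDerivAt_id (w : ℂ)).add_const (Complex.I * y)).pow 2).const_sub 1).comp_ofReal
      refine this.congr_deriv ?_
      simp
    refine ((hasDerivAt_cpow_comp h1 (hsl w hw y) (-(b + 1))).const_mul _).congr_deriv ?_
    rw [show (-(b + 1) - 1 : ℂ) = -(b + 1 + 1) by ring]
    ring

lemma hasDerivAt_cpow_ray {b : ℝ} {z : ℝ} (hz : z ∈ Ioo (-1 : ℝ) 1) (y : ℝ) :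
    HasDerivAt (fun y : ℝ => (1 - ((z : ℂ) + Complex.I * y) ^ 2) ^ (-(b + 1) : ℂ))
      (Complex.I * (2 * (b + 1) * (z + Complex.I * y) *
        (1 - ((z : ℂ) + Complex.I * y) ^ 2) ^ (-(b + 1 + 1) : ℂ))) y := by
  have h1 : HasDerivAt (fun y : ℝ => 1 - ((z : ℂ) + Complex.I * y) ^ 2)
      (-(2 * (z + Complex.I * y) * Complex.I)) y := by
    have := (((((hasDerivAt_id (y : ℂ)).const_mul Complex.I).const_add (z : ℂ)).pow 2).const_sub
      1).comp_ofReal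
    refine this.congr_deriv ?_
    simp
  refine (hasDerivAt_cpow_comp h1 (one_sub_sq_mem_slitPlane hz y) (-(b + 1))).congr_deriv ?_
  rw [show (-(b + 1) - 1 : ℂ) = -(b + 1 + 1) by ring]
  ring

lemma tendsto_ray_integrand {b : ℝ} (hb : 0 < b) {j : ℕ} (hj : j ≤ b) {z : ℝ}
    (hz : z ∈ Ioo (-1 : ℝ) 1) : Tendsto (fun y : ℝ =>
      (y : ℂ) ^ j * (1 - ((z : ℂ) + Complex.I * y) ^ 2) ^ (-(b + 1) : ℂ)) atTop (𝓝 0) := by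
  have h : Tendsto (fun y : ℝ => (1 - z ^ 2) ^ (-(b + 1)) * (1 + y ^ 2)⁻¹) atTop (𝓝 0) := by
    rw [← mul_zero ((1 - z ^ 2) ^ (-(b + 1)))]
    refine Tendsto.const_mul _ (tendsto_inv_atTop_zero.comp ?_)
    exact tendsto_atTop_add_const_left _ _ (tendsto_pow_atTop two_ne_zero)
  exact squeeze_zero_norm (norm_pow_mul_cpow_le hb hj (one_sub_sq_pos hz) le_rfl) h

lemma rayInt_zero (b : ℝ) (j : ℕ) (z : ℝ) : rayInt b j 0 z = ∫ y in Ioi (0 : ℝ),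
    (y : ℂ) ^ j * (1 - ((z : ℂ) + Complex.I * y) ^ 2) ^ (-(b + 1) : ℂ) := by
  simp [rayInt]

lemma hasDerivAt_rayInt_zero {b : ℝ} (hb : 0 < b) {z : ℝ} (hz : z ∈ Ioo (-1 : ℝ) 1) :
    HasDerivAt (rayInt b 0 0) (Complex.I * ((1 - z ^ 2 : ℝ) ^ (-(b + 1)) : ℝ)) z := by
  obtain ⟨hi, hd⟩ := hasDerivAt_rayInt_aux hb (j := 0) (by simpa using hb.le) hz
  rw [show rayInt b 0 0 = _ from funext (rayInt_zero b 0)]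
  refine hd.congr_deriv ?_
  have := integral_Ioi_of_hasDerivAt_of_tendsto' (a := 0)
    (fun y _ => ((hasDerivAt_cpow_ray (b := b) hz y).const_mul (-Complex.I)).congr_deriv ?_) hi
    ((tendsto_ray_integrand hb (j := 0) (by simpa using hb.le) hz).const_mul (-Complex.I)
      |>.congr fun y => ?_)
  · rw [this, Complex.ofReal_cpow (one_sub_sq_pos hz).le]
    simp
  · linear_combination (-(2 * (b + 1) * (z + Complex.I * y) *
        (1 - ((z : ℂ) + Complex.I * y) ^ 2) ^ (-(b + 1 + 1) : ℂ))) * Complex.I_sq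
  · simp

lemma hasDerivAt_rayInt_succ {b : ℝ} (hb : 0 < b) {j : ℕ} (hj : ((j + 1 : ℕ) : ℝ) ≤ b) {z : ℝ}
    (hz : z ∈ Ioo (-1 : ℝ) 1) :
    HasDerivAt (rayInt b (j + 1) 0) (Complex.I * (j + 1) * rayInt b j 0 z) z := by
  obtain ⟨hi, hd⟩ := hasDerivAt_rayInt_aux hb hj hz
  rw [show rayInt b (j + 1) 0 = _ from funext (rayInt_zero b (j + 1))]
  refine hd.congr_deriv ?_
  have hj' : (j : ℝ) ≤ b := by push_cast at hj; linarith
  have h1 := (integrable_ray_integrand hb hj' hz).integrableOn (s := Ioi (0 : ℝ))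
  have := integral_Ioi_of_hasDerivAt_of_tendsto' (a := 0)
    (fun y _ => ((((hasDerivAt_id (y : ℂ)).pow (j + 1)).comp_ofReal.mul
      (hasDerivAt_cpow_ray (b := b) hz y)).const_mul (-Complex.I)).congr_deriv ?_)
    (hi.sub (h1.const_mul (Complex.I * (j + 1))))
    ((tendsto_ray_integrand hb hj hz).const_mul (-Complex.I))
  · simp only [Pi.sub_apply] at this
    rw [integral_sub hi (h1.const_mul _), integral_const_mul] at this
    rw [rayInt_zero, ← sub_eq_zero, this]
    simp
  · simp only [id_eq, Pi.sub_apply, Nat.add_sub_cancel, Nat.cast_add, Nat.cast_one, mul_one,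
      Pi.pow_apply]
    linear_combination (-(y : ℂ) ^ (j + 1) * (2 * (b + 1) * (z + Complex.I * y) *
        (1 - ((z : ℂ) + Complex.I * y) ^ 2) ^ (-(b + 1 + 1) : ℂ))) * Complex.I_sq

/-- The value at the origin of the undifferentiated ray integral. -/
noncomputable def rayMass (b : ℝ) : ℝ := ∫ y in Ioi (0 : ℝ), (1 + y ^ 2) ^ (-(b + 1))

lemma rayInt_zero_zero (b : ℝ) : rayInt b 0 0 0 = rayMass b := by
  rw [rayInt_zero, rayMass, ← integral_complex_ofReal]
  refine setIntegral_congr_fun measurableSet_Ioi fun y _ => ?_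
  have : (1 - (((0 : ℝ) : ℂ) + Complex.I * y) ^ 2) = ((1 + y ^ 2 : ℝ) : ℂ) := by
    push_cast; linear_combination (-(y : ℂ) ^ 2) * Complex.I_sq
  simp only [this, pow_zero, one_mul]
  rw [Complex.ofReal_cpow (by positivity)]
  push_cast; rfl

lemma eqOn_of_hasDerivAt_eq {F G F' : ℝ → ℝ} (hF : ∀ z ∈ Ioo (-1 : ℝ) 1, HasDerivAt F (F' z) z)
    (hG : ∀ z ∈ Ioo (-1 : ℝ) 1, HasDerivAt G (F' z) z) :
    ∃ c, ∀ z ∈ Ioo (-1 : ℝ) 1, F z = G z + c := by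
  have hd : ∀ z ∈ Ioo (-1 : ℝ) 1, HasDerivAt (fun z => F z - G z) 0 z := fun z hz =>
    ((hF z hz).sub (hG z hz)).congr_deriv (sub_self _)
  refine ⟨F 0 - G 0, fun z hz => ?_⟩
  have := isOpen_Ioo.is_const_of_deriv_eq_zero isPreconnected_Ioo
    (fun w hw => (hd w hw).differentiableAt.differentiableWithinAt)
    (fun w hw => (hd w hw).deriv) hz (show (0 : ℝ) ∈ Ioo (-1 : ℝ) 1 by norm_num)
  linarith

lemma exists_poly_rayInt {b : ℝ} (hb : 0 < b) (j : ℕ) (hj : j ≤ b) :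
    ∃ p : Polynomial ℝ, p.natDegree ≤ j ∧ p.coeff j = rayMass b ∧
      ∀ z ∈ Ioo (-1 : ℝ) 1, ((-Complex.I) ^ j * rayInt b j 0 z).re = p.eval z := by
  induction j with
  | zero =>
    have hd : ∀ z ∈ Ioo (-1 : ℝ) 1, HasDerivAt (fun z => (rayInt b 0 0 z).re) 0 z := by
      intro z hz
      refine (Complex.reCLM.hasFDerivAt.comp_hasDerivAt z
        (hasDerivAt_rayInt_zero hb hz)).congr_deriv ?_
      simp
    obtain ⟨c, hc⟩ := eqOn_of_hasDerivAt_eq hd (fun z _ => hasDerivAt_const z (0 : ℝ))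
    have h0 := hc 0 (by norm_num)
    simp only [rayInt_zero_zero, Complex.ofReal_re, zero_add] at h0
    exact ⟨Polynomial.C c, by simp, by simp [h0], fun z hz => by simp [hc z hz]⟩
  | succ j ih =>
    obtain ⟨p, hp, hpj, hpe⟩ := ih (by push_cast at hj; linarith)
    set q : Polynomial ℝ := ∑ i ∈ Finset.range (j + 1),
      Polynomial.monomial (i + 1) ((j + 1) * p.coeff i / (i + 1)) with hq
    have hqd : ∀ z, HasDerivAt (fun z => q.eval z) ((j + 1) * p.eval z) z := by
      intro z
      refine (q.hasDerivAt z).congr_deriv ?_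
      rw [hq, Polynomial.derivative_sum, Polynomial.eval_finsetSum,
        Polynomial.eval_eq_sum_range' (Nat.lt_succ_of_le hp), Finset.mul_sum]
      refine Finset.sum_congr rfl fun i _ => ?_
      rw [Polynomial.derivative_monomial, Polynomial.eval_monomial]
      push_cast
      field_simp
    have hd : ∀ z ∈ Ioo (-1 : ℝ) 1,
        HasDerivAt (fun z => ((-Complex.I) ^ (j + 1) * rayInt b (j + 1) 0 z).re)
          ((j + 1) * p.eval z) z := by
      intro z hz
      refine (Complex.reCLM.hasFDerivAt.comp_hasDerivAt z
        ((hasDerivAt_rayInt_succ hb hj hz).const_mul ((-Complex.I) ^ (j + 1)))).congr_deriv ?_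
      rw [Complex.reCLM_apply, ← hpe z hz, ← Nat.cast_succ, ← Complex.re_ofReal_mul]
      congr 1
      push_cast
      linear_combination (-(j + 1) * (-Complex.I) ^ j * rayInt b j 0 z) * Complex.I_sq
    obtain ⟨c, hc⟩ := eqOn_of_hasDerivAt_eq hd (fun z _ => hqd z)
    refine ⟨q + Polynomial.C c, ?_, ?_, fun z hz => by simp [hc z hz]⟩
    · refine Polynomial.natDegree_add_le_of_degree_le ?_ (by simp)
      refine Polynomial.natDegree_sum_le_of_forall_le _ _ fun i hi => ?_
      have := Finset.mem_range.1 hi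
      exact (Polynomial.natDegree_monomial_le _).trans (by omega)
    · rw [Polynomial.coeff_add, Polynomial.coeff_C_succ, add_zero, hq,
        Polynomial.finsetSum_coeff, Finset.sum_eq_single_of_mem j (by simp)]
      · rw [Polynomial.coeff_monomial, if_pos rfl, hpj]
        field_simp
      · intro i _ hij
        rw [Polynomial.coeff_monomial, if_neg (by omega)]

lemma exists_poly_re_rayInt {b : ℝ} (hb : 0 < b) (m : ℕ) (hm : ((2 * m : ℕ) : ℝ) ≤ b) :
    ∃ p : Polynomial ℝ, p.natDegree ≤ 2 * m ∧ p.coeff (2 * m) = rayMass b ∧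
      ∀ z ∈ Ioo (-1 : ℝ) 1, (-1) ^ m * (rayInt b (2 * m) 0 z).re = p.eval z := by
  obtain ⟨p, h1, h2, h3⟩ := exists_poly_rayInt hb (2 * m) hm
  refine ⟨p, h1, h2, fun z hz => ?_⟩
  rw [← h3 z hz, pow_mul, neg_sq, Complex.I_sq, ← Complex.re_ofReal_mul]
  norm_num

/-- The weighted Jacobi polynomial `(1 - t ^ 2) ^ a * P_k^{(a,a)}(t)`. -/
noncomputable def wJac (a : ℝ) (k : ℕ) (t : ℝ) : ℝ := (1 - t ^ 2) ^ a * (jacobiPoly a k).eval t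

lemma continuous_wJac {a : ℝ} (ha : 0 ≤ a) (k : ℕ) : Continuous (wJac a k) :=
  (continuous_weight ha).mul (jacobiPoly a k).continuous

/-- The cosine transform of the damped spectral density `ξ ^ (2 * a) * e^{-δ ξ} * û(ξ)`. -/
noncomputable def dampF (a δ : ℝ) (u : ℝ → ℝ) (z : ℝ) : ℝ :=
  ∫ ξ in Ioi (0 : ℝ), ξ ^ (2 * a) * Real.exp (-(δ * ξ)) * cosT u ξ * Real.cos (ξ * z)

/-- The damped bilinear form with spectral density `ξ ^ (2 * a) * e^{-δ ξ}`. -/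
noncomputable def dampB (a δ : ℝ) (g u : ℝ → ℝ) : ℝ :=
  ∫ ξ in Ioi (0 : ℝ), ξ ^ (2 * a) * Real.exp (-(δ * ξ)) * cosT g ξ * cosT u ξ

lemma integrableOn_damp {a δ : ℝ} (ha : 0 ≤ a) (hδ : 0 < δ) {F : ℝ → ℝ} (hF : Continuous F)
    {C : ℝ} (hC : ∀ ξ, |F ξ| ≤ C) :
    IntegrableOn (fun ξ => ξ ^ (2 * a) * Real.exp (-(δ * ξ)) * F ξ) (Ioi 0) :=
  Integrable.mul_bdd (c := C) (integrableOn_rpow_mul_exp (by linarith) hδ)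
    hF.aestronglyMeasurable (Eventually.of_forall hC)

lemma dampB_comm (a δ : ℝ) (g u : ℝ → ℝ) : dampB a δ g u = dampB a δ u g := by
  unfold dampB
  congr 1; ext ξ; ring

lemma integrable_mul_dampF_and_dampB_eq {a δ : ℝ} (ha : 0 ≤ a) (hδ : 0 < δ) {g u : ℝ → ℝ}
    (hg : Continuous g) (hu : Continuous u) :
    Integrable (fun z => g z * dampF a δ u z) (volume.restrict (Ioc (-1) 1)) ∧
      dampB a δ g u = ∫ z in (-1 : ℝ)..1, g z * dampF a δ u z := by
  have h1 := integrableOn_damp ha hδ (continuous_cosT hu) (abs_cosT_le hu)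
  have h2 : Integrable g (volume.restrict (Ioc (-1) 1)) :=
    hg.integrableOn_Ioc
  have h3 : Integrable (fun q : ℝ × ℝ => g q.1 *
      (q.2 ^ (2 * a) * Real.exp (-(δ * q.2)) * cosT u q.2) * Real.cos (q.2 * q.1))
      ((volume.restrict (Ioc (-1) 1)).prod (volume.restrict (Ioi 0))) :=
    (h2.mul_prod h1).mul_bdd (c := 1)
      (by fun_prop : Continuous fun q : ℝ × ℝ => Real.cos (q.2 * q.1)).aestronglyMeasurable
      (Eventually.of_forall fun q => Real.abs_cos_le_one _)
  have h4 : ∀ z, g z * dampF a δ u z = ∫ ξ in Ioi (0 : ℝ), g z *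
      (ξ ^ (2 * a) * Real.exp (-(δ * ξ)) * cosT u ξ) * Real.cos (ξ * z) := fun z => by
    rw [dampF, ← integral_const_mul]
    congr 1; ext ξ; ring
  simp only [h4]
  refine ⟨h3.integral_prod_left, ?_⟩
  rw [intervalIntegral.integral_of_le (by norm_num), integral_integral_swap h3, dampB]
  congr 1; ext ξ
  rw [cosT, intervalIntegral.integral_of_le (by norm_num), mul_assoc, mul_comm (∫ _ in _, _),
    ← mul_assoc, ← integral_const_mul]
  congr 1; ext z; ring

/-- The proportionality factor between `dampF` of a weighted Jacobi polynomial and a ray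
integral. -/
noncomputable def rayCoeff (a : ℝ) (k : ℕ) : ℝ :=
  Real.Gamma (2 * (a + k) + 2) * weightMass (a + k) / (2 ^ k * k.factorial ^ 2)

lemma rayCoeff_pos {a : ℝ} (ha : 0 < a) (k : ℕ) : 0 < rayCoeff a k := by
  have hb : 0 < a + k := by positivity
  have := weightMass_pos hb
  have := Real.Gamma_pos_of_pos (show 0 < 2 * (a + k) + 2 by positivity)
  unfold rayCoeff
  positivity

lemma dampF_wJac {a : ℝ} (ha : 0 < a) (m : ℕ) {δ z : ℝ} (hδ : 0 < δ) (hz : z ∈ Ioo (-1 : ℝ) 1) :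
    dampF a δ (wJac a (2 * m)) z =
      rayCoeff a (2 * m) * ((-1) ^ m * (rayInt (a + (2 * m : ℕ)) (2 * m) δ z).re) := by
  set k := 2 * m with hk
  have hb : 0 < a + k := by positivity
  have h := congrArg Complex.re (integral_mul_cosT_weight_eq_rayInt hb
    (show (k : ℝ) ≤ a + k by linarith) hz hδ)
  have hw := continuous_weight hb.le
  have hint : IntegrableOn (fun ξ : ℝ => ((ξ ^ (2 * (a + k) - k) : ℝ) : ℂ) *
      Complex.exp (-((δ - Complex.I * z) * ξ)) *
      (cosT (fun t => (1 - t ^ 2) ^ (a + k)) ξ : ℂ)) (Ioi 0) := by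
    refine Integrable.mul_bdd (c := ∫ t in (-1 : ℝ)..1, |(1 - t ^ 2) ^ (a + k)|)
      (integrableOn_rpow_mul_cexp (by linarith) (by simpa using hδ))
      (Complex.continuous_ofReal.comp (continuous_cosT hw)).aestronglyMeasurable
      (Eventually.of_forall fun ξ => ?_)
    rw [Complex.norm_real]
    exact abs_cosT_le hw ξ
  rw [← RCLike.re_eq_complex_re, ← integral_re hint, RCLike.re_eq_complex_re,
    show (Real.Gamma (2 * (a + k : ℝ) + 2) * weightMass (a + k) / k.factorial : ℂ) =
      ((Real.Gamma (2 * (a + k) + 2) * weightMass (a + k) / k.factorial : ℝ) : ℂ) by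
        push_cast; rfl, Complex.re_ofReal_mul] at h
  have e : rayCoeff a k * ((-1) ^ m * (rayInt (a + k) k δ z).re) =
      (-1) ^ m / (2 ^ k * k.factorial) * (Real.Gamma (2 * (a + k) + 2) * weightMass (a + k) /
        k.factorial * (rayInt (a + k) k δ z).re) := by
    unfold rayCoeff; field_simp
  rw [e, ← h, dampF, ← integral_const_mul]
  refine setIntegral_congr_fun measurableSet_Ioi fun ξ hξ => ?_
  have hξ : 0 < ξ := hξ
  have h1 : cosT (wJac a k) ξ = _ := cosT_weight_mul_jacobiPoly ha m ξ
  have h2 : ξ ^ (2 * (a + k) - k) = ξ ^ (2 * a) * ξ ^ k := by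
    rw [← Real.rpow_natCast, ← Real.rpow_add hξ]; congr 1; ring
  have h3 : (Complex.exp (-((δ - Complex.I * z) * ξ))).re =
      Real.exp (-(δ * ξ)) * Real.cos (ξ * z) := by
    rw [Complex.exp_re]
    simp [mul_comm]
  rw [Complex.re_mul_ofReal, Complex.re_ofReal_mul, h1, h2, h3]
  ring

lemma exists_abs_dampF_wJac_le {a : ℝ} (ha : 0 < a) (m : ℕ) :
    ∃ C, ∀ δ > 0, ∀ z ∈ Ioo (-1 : ℝ) 1,
      |dampF a δ (wJac a (2 * m)) z| ≤ C * (1 - z ^ 2) ^ (-(a + 1 / 4)) := by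
  refine ⟨rayCoeff a (2 * m) * ∫ y in Ioi (0 : ℝ), rayBound y, fun δ hδ z hz => ?_⟩
  have h := rayCoeff_pos ha (2 * m)
  have h1 := (Complex.abs_re_le_norm _).trans (norm_rayInt_le ha (2 * m) hz (le_of_lt hδ))
  rw [dampF_wJac ha m hδ hz, abs_mul, abs_mul, abs_neg_one_pow, one_mul, abs_of_pos h, mul_assoc,
    mul_comm (∫ _ in _, _)]
  exact mul_le_mul_of_nonneg_left h1 h.le

lemma exists_poly_tendsto_dampF {a : ℝ} (ha : 0 < a) (m : ℕ) :
    ∃ p : Polynomial ℝ, p.natDegree ≤ 2 * m ∧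
      p.coeff (2 * m) = rayCoeff a (2 * m) * rayMass (a + (2 * m : ℕ)) ∧
      ∀ z ∈ Ioo (-1 : ℝ) 1,
        Tendsto (fun δ => dampF a δ (wJac a (2 * m)) z) (𝓝[>] 0) (𝓝 (p.eval z)) := by
  obtain ⟨p, h1, h2, h3⟩ := exists_poly_re_rayInt (b := a + (2 * m : ℕ)) (by positivity) m
    (by linarith)
  refine ⟨Polynomial.C (rayCoeff a (2 * m)) * p, (Polynomial.natDegree_C_mul_le _ _).trans h1,
    by rw [Polynomial.coeff_C_mul, h2], fun z hz => ?_⟩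
  rw [Polynomial.eval_mul, Polynomial.eval_C, ← h3 z hz]
  refine (((Complex.continuous_re.tendsto _).comp (tendsto_rayInt ha (2 * m) hz)).const_mul
    ((-1) ^ m) |>.const_mul (rayCoeff a (2 * m))).congr' ?_
  filter_upwards [self_mem_nhdsWithin] with δ hδ
  rw [dampF_wJac ha m hδ hz]
  rfl

lemma integrableOn_one_sub_sq_rpow :
    IntegrableOn (fun z : ℝ => (1 - z ^ 2) ^ (-(1 / 4) : ℝ)) (Ioo (-1) 1) := by
  have h0 : IntegrableOn (fun z : ℝ => z ^ (-(1 / 4) : ℝ)) (Ioc 0 2) :=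
    (intervalIntegrable_iff_integrableOn_Ioc_of_le zero_le_two).1
      (intervalIntegral.intervalIntegrable_rpow' (by norm_num))
  have h0' := (intervalIntegrable_iff_integrableOn_Ioc_of_le zero_le_two).2 h0
  have h1 : IntegrableOn (fun z : ℝ => (1 + z) ^ (-(1 / 4) : ℝ)) (Ioo (-1) 1) := by
    have := (h0'.comp_add_left 1)
    norm_num at this
    exact ((intervalIntegrable_iff_integrableOn_Ioc_of_le (by norm_num)).1 this).mono_set
      Ioo_subset_Ioc_self
  have h2 : IntegrableOn (fun z : ℝ => (1 - z) ^ (-(1 / 4) : ℝ)) (Ioo (-1) 1) := by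
    have := (h0'.comp_sub_left 1).symm
    norm_num at this
    exact ((intervalIntegrable_iff_integrableOn_Ioc_of_le (by norm_num)).1 this).mono_set
      Ioo_subset_Ioc_self
  refine (h1.add h2).mono' (by fun_prop : Measurable fun z : ℝ =>
    (1 - z ^ 2) ^ (-(1 / 4) : ℝ)).aestronglyMeasurable ?_
  filter_upwards [ae_restrict_mem measurableSet_Ioo] with z hz
  have hz0 := one_sub_sq_pos hz
  have p1 : 0 < 1 + z := by linarith [hz.1]
  have p2 : 0 < 1 - z := by linarith [hz.2]
  rw [Real.norm_of_nonneg (by positivity), Pi.add_apply]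
  rcases le_total 0 z with h | h
  · have := Real.rpow_le_rpow_of_nonpos p2 (show 1 - z ≤ 1 - z ^ 2 by nlinarith)
      (show (-(1 / 4) : ℝ) ≤ 0 by norm_num)
    have : 0 ≤ (1 + z) ^ (-(1 / 4) : ℝ) := by positivity
    linarith
  · have := Real.rpow_le_rpow_of_nonpos p1 (show 1 + z ≤ 1 - z ^ 2 by nlinarith)
      (show (-(1 / 4) : ℝ) ≤ 0 by norm_num)
    have : 0 ≤ (1 - z) ^ (-(1 / 4) : ℝ) := by positivity
    linarith

lemma tendsto_dampB_of_tendsto_dampF {a : ℝ} (ha : 0 < a) (m : ℕ) {p : Polynomial ℝ}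
    (hp : ∀ z ∈ Ioo (-1 : ℝ) 1,
      Tendsto (fun δ => dampF a δ (wJac a (2 * m)) z) (𝓝[>] 0) (𝓝 (p.eval z)))
    {g : ℝ → ℝ} (hg : Continuous g) {C : ℝ}
    (hC : ∀ z ∈ Ioo (-1 : ℝ) 1, |g z| ≤ C * (1 - z ^ 2) ^ a) :
    Tendsto (fun δ => dampB a δ g (wJac a (2 * m))) (𝓝[>] 0)
      (𝓝 (∫ z in (-1 : ℝ)..1, g z * p.eval z)) := by
  obtain ⟨K, hK⟩ := exists_abs_dampF_wJac_le ha m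
  have hu := continuous_wJac ha.le (2 * m)
  have h : Tendsto (fun δ => ∫ z in Ioo (-1 : ℝ) 1, g z * dampF a δ (wJac a (2 * m)) z) (𝓝[>] 0)
      (𝓝 (∫ z in Ioo (-1 : ℝ) 1, g z * p.eval z)) := by
    refine tendsto_integral_filter_of_dominated_convergence
      (fun z => C * K * (1 - z ^ 2) ^ (-(1 / 4) : ℝ)) ?_ ?_
      (integrableOn_one_sub_sq_rpow.const_mul _) ?_
    · filter_upwards [self_mem_nhdsWithin] with δ hδ
      have := (integrable_mul_dampF_and_dampB_eq ha.le hδ hg hu).1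
      exact this.aestronglyMeasurable.mono_measure
        (Measure.restrict_mono Ioo_subset_Ioc_self le_rfl)
    · filter_upwards [self_mem_nhdsWithin] with δ hδ
      filter_upwards [ae_restrict_mem measurableSet_Ioo] with z hz
      have hz0 := one_sub_sq_pos hz
      rw [norm_mul, Real.norm_eq_abs, Real.norm_eq_abs]
      refine (mul_le_mul (hC z hz) (hK δ hδ z hz) (abs_nonneg _)
        ((abs_nonneg _).trans (hC z hz))).trans_eq ?_
      rw [mul_mul_mul_comm, ← Real.rpow_add hz0]
      congr 2; ring
    · filter_upwards [ae_restrict_mem measurableSet_Ioo] with z hz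
      exact (hp z hz).const_mul _
  rw [intervalIntegral.integral_of_le (by norm_num), integral_Ioc_eq_integral_Ioo]
  refine h.congr' ?_
  filter_upwards [self_mem_nhdsWithin] with δ hδ
  rw [(integrable_mul_dampF_and_dampB_eq ha.le hδ hg hu).2,
    intervalIntegral.integral_of_le (by norm_num), integral_Ioc_eq_integral_Ioo]

lemma exists_abs_weight_mul_le {φ : ℝ → ℝ} (hφ : Continuous φ) (a : ℝ) :
    ∃ C, ∀ z ∈ Ioo (-1 : ℝ) 1, |(1 - z ^ 2) ^ a * φ z| ≤ C * (1 - z ^ 2) ^ a := by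
  obtain ⟨C, hC⟩ := isCompact_Icc.exists_bound_of_continuousOn (hφ.continuousOn (s := Icc (-1) 1))
  refine ⟨C, fun z hz => ?_⟩
  have := one_sub_sq_pos hz
  rw [abs_mul, abs_of_pos (by positivity), mul_comm]
  exact mul_le_mul_of_nonneg_right (hC z (Ioo_subset_Icc_self hz)) (by positivity)

lemma cosT_wJac_odd {a : ℝ} (ha : 0 < a) {k : ℕ} (hk : Odd k) (ξ : ℝ) : cosT (wJac a k) ξ = 0 := by
  refine integral_odd_eq_zero fun t => ?_
  rw [wJac, wJac, jacobiPoly_comp_neg ha, hk.neg_one_pow, mul_neg, Real.cos_neg]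
  ring_nf

/-- The eigenvalue of the spectral form on the weighted Jacobi polynomial of degree `2 * m`. -/
noncomputable def specNu (a : ℝ) (m : ℕ) : ℝ :=
  rayCoeff a (2 * m) * rayMass (a + (2 * m : ℕ)) / jacobiLead a (2 * m)

lemma tendsto_dampF_wJac {a : ℝ} (ha : 0 < a) (m : ℕ) {z : ℝ} (hz : z ∈ Ioo (-1 : ℝ) 1) :
    Tendsto (fun δ => dampF a δ (wJac a (2 * m)) z) (𝓝[>] 0)
      (𝓝 ((Polynomial.C (specNu a m) * jacobiPoly a (2 * m)).eval z)) := by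
  obtain ⟨p, hpd, hpc, hp⟩ := exists_poly_tendsto_dampF ha m
  suffices h : p - Polynomial.C (specNu a m) * jacobiPoly a (2 * m) = 0 by
    rw [← sub_eq_zero.1 h]; exact hp z hz
  set q := p - Polynomial.C (specNu a m) * jacobiPoly a (2 * m) with hq
  have hqd : q.natDegree ≤ 2 * m := (Polynomial.natDegree_sub_le _ _).trans
    (max_le hpd ((Polynomial.natDegree_C_mul_le _ _).trans (natDegree_jacobiPoly_le a _)))
  have hqc : q.coeff (2 * m) = 0 := by
    rw [hq, Polynomial.coeff_sub, hpc, Polynomial.coeff_C_mul, coeff_jacobiPoly_self ha, specNu,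
      div_mul_cancel₀ _ (jacobiLead_pos ha _).ne', sub_self]
  rcases hqd.eq_or_lt with hj | hj
  · rw [← hj] at hqc
    exact Polynomial.leadingCoeff_eq_zero.1 hqc
  refine poly_eq_zero_of_integral_jacobiPoly ha q ?_
  set j := q.natDegree
  have hw := continuous_weight ha.le
  have hu := continuous_wJac ha.le j
  obtain ⟨C, hC⟩ := exists_abs_weight_mul_le (jacobiPoly a j).continuous a
  have h1 := tendsto_dampB_of_tendsto_dampF ha m hp hu hC
  have h2 : ∫ z in (-1 : ℝ)..1, wJac a j z * p.eval z = 0 := by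
    refine tendsto_nhds_unique h1 ?_
    rcases Nat.even_or_odd' j with ⟨i, hi | hi⟩
    · obtain ⟨r, hrd, -, hr⟩ := exists_poly_tendsto_dampF ha i
      obtain ⟨C', hC'⟩ := exists_abs_weight_mul_le (jacobiPoly a (2 * m)).continuous a
      have h3 := tendsto_dampB_of_tendsto_dampF ha i hr (continuous_wJac ha.le (2 * m)) hC'
      have h4 := integral_jacobiPoly_mul_poly_eq_zero ha (k := 2 * m) (p := r)
        (hrd.trans_lt (hi ▸ hj))
      have h5 : ∫ z in (-1 : ℝ)..1, wJac a (2 * m) z * r.eval z = 0 := h4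
      rw [h5] at h3
      simpa only [dampB_comm a _ _ (wJac a (2 * m)), hi] using h3
    · have : ∀ δ, dampB a δ (wJac a j) (wJac a (2 * m)) = 0 := fun δ => by
        simp [dampB, cosT_wJac_odd ha (show Odd j from ⟨i, hi⟩)]
      simp only [this]
      exact tendsto_const_nhds
  have h3 := integral_jacobiPoly_mul_of_ne ha hj.ne
  have e : ∀ z, (1 - z ^ 2) ^ a * (jacobiPoly a j).eval z * q.eval z =
      wJac a j z * p.eval z - specNu a m * ((1 - z ^ 2) ^ a * (jacobiPoly a j).eval z *
        (jacobiPoly a (2 * m)).eval z) := fun z => by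
    rw [hq, Polynomial.eval_sub, Polynomial.eval_mul, Polynomial.eval_C, wJac]; ring
  simp only [e]
  rw [intervalIntegral.integral_sub, intervalIntegral.integral_const_mul, h2, h3, mul_zero,
    sub_zero]
  · exact (hu.mul p.continuous).intervalIntegrable _ _
  · exact (continuous_const.mul ((hw.mul (jacobiPoly a j).continuous).mul
      (jacobiPoly a (2 * m)).continuous)).intervalIntegrable _ _

lemma tendsto_dampB_wJac {a : ℝ} (ha : 0 < a) (m : ℕ) {g : ℝ → ℝ} (hg : Continuous g) {C : ℝ}
    (hC : ∀ z ∈ Ioo (-1 : ℝ) 1, |g z| ≤ C * (1 - z ^ 2) ^ a) :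
    Tendsto (fun δ => dampB a δ g (wJac a (2 * m))) (𝓝[>] 0)
      (𝓝 (specNu a m * ∫ z in (-1 : ℝ)..1, g z * (jacobiPoly a (2 * m)).eval z)) := by
  have := tendsto_dampB_of_tendsto_dampF ha m (fun z hz => tendsto_dampF_wJac ha m hz) hg hC
  refine this.trans_eq ?_
  rw [← intervalIntegral.integral_const_mul]
  congr 2; ext z
  rw [Polynomial.eval_mul, Polynomial.eval_C]; ring

lemma le_rayMass {b : ℝ} (hb : 0 < b) : √(Real.pi / (b + 1)) / 2 ≤ rayMass b := by
  rw [← integral_gaussian_Ioi, rayMass]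
  have h1 : 0 < b + 1 := by positivity
  refine integral_mono_ae (integrable_exp_neg_mul_sq h1).integrableOn ?_
    (Eventually.of_forall fun y => ?_)
  · refine (integrable_inv_one_add_sq.integrableOn (s := Ioi (0 : ℝ))).mono'
      (by fun_prop : Measurable fun y : ℝ => (1 + y ^ 2) ^ (-(b + 1))).aestronglyMeasurable
      (Eventually.of_forall fun y => ?_)
    rw [Real.norm_of_nonneg (by positivity), ← Real.rpow_neg_one]
    exact Real.rpow_le_rpow_of_exponent_le (by nlinarith [sq_nonneg y]) (by linarith)
  · have := Real.rpow_le_rpow_of_nonpos (show 0 < 1 + y ^ 2 by positivity)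
      (show 1 + y ^ 2 ≤ Real.exp (y ^ 2) by linarith [Real.add_one_le_exp (y ^ 2)])
      (show -(b + 1) ≤ 0 by linarith)
    rw [← Real.exp_mul] at this
    refine (Eq.le ?_).trans this
    ring_nf

lemma sqrt_mul_Gamma_le {b : ℝ} (hb : 0 < b) :
    √b * Real.Gamma (b + 1 / 2) ≤ Real.Gamma (b + 1) := by
  have h := Real.Gamma_mul_add_mul_le_rpow_Gamma_mul_rpow_Gamma hb (show 0 < b + 1 by positivity)
    one_half_pos one_half_pos (by norm_num)
  have hG := Real.Gamma_pos_of_pos hb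
  rw [Real.Gamma_add_one hb.ne', Real.mul_rpow hb.le hG.le, mul_left_comm, ← Real.rpow_add hG,
    show 1 / 2 * b + 1 / 2 * (b + 1) = b + 1 / 2 by ring, add_halves, Real.rpow_one,
    ← Real.sqrt_eq_rpow] at h
  rw [Real.Gamma_add_one hb.ne']
  refine (mul_le_mul_of_nonneg_left h (Real.sqrt_nonneg b)).trans_eq ?_
  rw [← mul_assoc, Real.mul_self_sqrt hb.le]

lemma rpow_mul_Gamma_le {k s : ℝ} (hk : 0 < k) (hs : 0 < s) :
    k ^ s * Real.Gamma (k + 1) ≤ Real.Gamma (k + 1 + s) := by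
  have h := Real.convexOn_log_Gamma.slope_mono_adjacent (x := k) (y := k + 1) (z := k + 1 + s)
    hk (by simp only [mem_Ioi]; positivity) (by linarith) (by linarith)
  have hG := Real.Gamma_pos_of_pos hk
  have hG1 := Real.Gamma_pos_of_pos (show 0 < k + 1 by positivity)
  have hG2 := Real.Gamma_pos_of_pos (show 0 < k + 1 + s by positivity)
  simp only [Function.comp_apply, add_sub_cancel_left, div_one] at h
  rw [le_div_iff₀ hs, Real.Gamma_add_one hk.ne', Real.log_mul hk.ne' hG.ne',
    ← Real.log_mul hk.ne' hG.ne', ← Real.Gamma_add_one hk.ne',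
    ← Real.log_div hG1.ne' hG.ne', Real.Gamma_add_one hk.ne', mul_div_cancel_right₀ _ hG.ne',
    ← Real.Gamma_add_one hk.ne', le_sub_iff_add_le, mul_comm, ← Real.log_rpow hk,
    ← Real.log_mul (by positivity) hG1.ne'] at h
  exact (Real.log_le_log_iff (by positivity) hG2).1 h

lemma specNu_eq {a : ℝ} (ha : 0 < a) (m : ℕ) : specNu a m =
    2 * √Real.pi * rayMass (a + (2 * m : ℕ)) * (Real.Gamma (a + (2 * m : ℕ) + 1) /
      Real.Gamma (a + (2 * m : ℕ) + 1 / 2)) *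
      (Real.Gamma (2 * a + (2 * m : ℕ) + 1) / Real.Gamma ((2 * m : ℕ) + 1)) := by
  rw [specNu, rayCoeff, jacobiLead]
  generalize 2 * m = k
  have hb : 0 < a + k := by positivity
  have hd := Real.Gamma_mul_Gamma_add_half (a + k + 1 / 2)
  rw [show a + k + 1 / 2 + 1 / 2 = a + k + 1 by ring,
    show 2 * (a + k + 1 / 2) = 2 * a + 2 * k + 1 by ring,
    show 1 - (2 * a + 2 * k + 1) = -(2 * (a + k)) by ring, Real.rpow_neg zero_le_two] at hd
  rw [weightMass_eq hb, Real.Gamma_nat_eq_factorial, Real.rpow_add_one two_ne_zero]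
  have g1 := Real.Gamma_pos_of_pos (show 0 < 2 * (a + k) + 2 by positivity)
  have g2 := Real.Gamma_pos_of_pos (show 0 < a + k + 1 / 2 by positivity)
  have g4 := Real.Gamma_pos_of_pos (show 0 < 2 * a + 2 * k + 1 by positivity)
  generalize Real.Gamma (2 * (a + k) + 2) = G1 at *
  generalize Real.Gamma (a + k + 1 / 2) = G2 at *
  generalize Real.Gamma (2 * a + 2 * k + 1) = G4 at *
  generalize Real.Gamma (a + k + 1) = G3 at *
  generalize Real.Gamma (2 * a + k + 1) = G5 at *
  generalize rayMass (a + k) = M at *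
  have h2 : (0 : ℝ) < 2 ^ (2 * (a + k)) := by positivity
  generalize (2 : ℝ) ^ (2 * (a + k)) = W at *
  field_simp
  field_simp at hd
  linear_combination (G3 * M * G5) * hd

lemma specNu_pos {a : ℝ} (ha : 0 < a) (m : ℕ) : 0 < specNu a m := by
  have h1 := rayCoeff_pos ha (2 * m)
  have h2 := jacobiLead_pos ha (2 * m)
  have hb : 0 < a + (2 * m : ℕ) := by positivity
  have h3 := le_rayMass hb
  have h4 : 0 < √(Real.pi / (a + (2 * m : ℕ) + 1)) := by have := Real.pi_pos; positivity
  have : 0 < rayMass (a + (2 * m : ℕ)) := by linarith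
  unfold specNu
  positivity

lemma rpow_le_specNu {a : ℝ} (ha : 0 < a) {m : ℕ} (hm : 0 < m) :
    (2 * m : ℝ) ^ (2 * a) ≤ specNu a m := by
  have hk : (1 : ℝ) ≤ (2 * m : ℕ) := by exact_mod_cast (by omega : 1 ≤ 2 * m)
  rw [specNu_eq ha, show (2 * m : ℝ) = (2 * m : ℕ) by push_cast; rfl]
  set k : ℝ := ((2 * m : ℕ) : ℝ)
  have hk0 : 0 < k := by linarith
  have hb : 0 < a + k := by positivity
  have g2 := Real.Gamma_pos_of_pos (show 0 < a + k + 1 / 2 by positivity)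
  have g3 := Real.Gamma_pos_of_pos (show 0 < k + 1 by positivity)
  have h1 := le_rayMass hb
  have h2 := (le_div_iff₀ g2).2 (sqrt_mul_Gamma_le hb)
  have h3 := (le_div_iff₀ g3).2 (rpow_mul_Gamma_le hk0 (show 0 < 2 * a by positivity))
  rw [show k + 1 + 2 * a = 2 * a + k + 1 by ring] at h3
  have hpi := Real.pi_gt_three
  have h4 : 1 ≤ √Real.pi := Real.one_le_sqrt.2 (by linarith)
  have h5 : 1 ≤ √(Real.pi / (a + k + 1)) * √(a + k) := by
    rw [← Real.sqrt_mul (by positivity), Real.one_le_sqrt, div_mul_eq_mul_div,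
      one_le_div (by positivity)]
    nlinarith
  have hM : 0 ≤ rayMass (a + k) := le_trans (by positivity) h1
  have g1 := Real.Gamma_pos_of_pos (show 0 < a + k + 1 by positivity)
  calc k ^ (2 * a) = 1 * 1 * k ^ (2 * a) := by ring
    _ ≤ √Real.pi * (√(Real.pi / (a + k + 1)) * √(a + k)) * k ^ (2 * a) := by gcongr
    _ = 2 * √Real.pi * (√(Real.pi / (a + k + 1)) / 2) * √(a + k) * k ^ (2 * a) := by ring
    _ ≤ _ := by gcongr

/-- The bilinear form `∫ (1 - z ^ 2) ^ a f g` over `(-1, 1)`. -/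
noncomputable def wForm {a : ℝ} (ha : 0 ≤ a) : LinearMap.BilinForm ℝ C(ℝ, ℝ) :=
  have hi : ∀ f g : C(ℝ, ℝ),
      IntervalIntegrable (fun z => (1 - z ^ 2) ^ a * f z * g z) volume (-1) 1 := fun f g =>
    (((continuous_weight ha).mul f.continuous).mul g.continuous).intervalIntegrable _ _
  LinearMap.mk₂ ℝ (fun f g => ∫ z in (-1 : ℝ)..1, (1 - z ^ 2) ^ a * f z * g z)
    (fun f f' g => by
      rw [← intervalIntegral.integral_add (hi f g) (hi f' g)]
      congr 1; ext z; simp only [ContinuousMap.add_apply]; ring)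
    (fun c f g => by
      rw [smul_eq_mul, ← intervalIntegral.integral_const_mul]
      congr 1; ext z; simp only [ContinuousMap.smul_apply, smul_eq_mul]; ring)
    (fun f g g' => by
      rw [← intervalIntegral.integral_add (hi f g) (hi f g')]
      congr 1; ext z; simp only [ContinuousMap.add_apply]; ring)
    (fun c f g => by
      rw [smul_eq_mul, ← intervalIntegral.integral_const_mul]
      congr 1; ext z; simp only [ContinuousMap.smul_apply, smul_eq_mul]; ring)

lemma wForm_apply {a : ℝ} (ha : 0 ≤ a) (f g : C(ℝ, ℝ)) :
    wForm ha f g = ∫ z in (-1 : ℝ)..1, (1 - z ^ 2) ^ a * f z * g z := rfl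

lemma wForm_comm {a : ℝ} (ha : 0 ≤ a) (f g : C(ℝ, ℝ)) : wForm ha f g = wForm ha g f := by
  rw [wForm_apply, wForm_apply]
  congr 1; ext z; ring

lemma wForm_self_nonneg {a : ℝ} (ha : 0 ≤ a) (f : C(ℝ, ℝ)) : 0 ≤ wForm ha f f := by
  rw [wForm_apply]
  refine intervalIntegral.integral_nonneg (by norm_num) fun z hz => ?_
  have : 0 ≤ 1 - z ^ 2 := by nlinarith [hz.1, hz.2]
  rw [mul_assoc]
  exact mul_nonneg (by positivity) (mul_self_nonneg _)

lemma wForm_self_le {a : ℝ} (ha : 0 ≤ a) {f : C(ℝ, ℝ)} {ε : ℝ}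
    (h : ∀ z ∈ Icc (-1 : ℝ) 1, |f z| ≤ ε) : wForm ha f f ≤ 2 * ε ^ 2 := by
  have := intervalIntegral.norm_integral_le_of_norm_le_const (a := (-1 : ℝ)) (b := 1)
    (f := fun z => (1 - z ^ 2) ^ a * f z * f z) (C := ε ^ 2) fun z hz => ?_
  · rw [wForm_apply]
    refine (le_abs_self _).trans (this.trans_eq ?_)
    norm_num; ring
  · rw [uIoc_of_le (by norm_num)] at hz
    have hz' := h z (Ioc_subset_Icc_self hz)
    have h0 : 0 ≤ 1 - z ^ 2 := by nlinarith [hz.1, hz.2]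
    have h1 := Real.rpow_le_one h0 (by nlinarith [sq_nonneg z]) ha
    rw [mul_assoc, norm_mul, norm_mul, Real.norm_of_nonneg (by positivity), Real.norm_eq_abs]
    nlinarith [mul_le_mul hz' hz' (abs_nonneg _) ((abs_nonneg _).trans hz'),
      mul_nonneg (abs_nonneg (f z)) (abs_nonneg (f z))]

/-- A polynomial as a continuous function. -/
noncomputable def polyC : Polynomial ℝ →ₗ[ℝ] C(ℝ, ℝ) := Polynomial.toContinuousMapAlgHom.toLinearMap

lemma polyC_apply (p : Polynomial ℝ) (z : ℝ) : polyC p z = p.eval z := rfl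

/-- The normalized Jacobi polynomial as a continuous function. -/
noncomputable def jacC (l : ℝ) (k : ℕ) : C(ℝ, ℝ) :=
  (√(jacobiNormSq l k))⁻¹ • polyC (jacobiPoly (l + 1) k)

lemma jacC_apply (l : ℝ) (k : ℕ) (z : ℝ) : jacC l k z = jacobiPNorm l k z := by
  rw [jacC, ContinuousMap.smul_apply, polyC_apply, eval_jacobiPoly, jacobiPNorm, smul_eq_mul,
    div_eq_inv_mul]

lemma wForm_jacC_self {l : ℝ} (hl : 0 < l + 1) (k : ℕ) : wForm hl.le (jacC l k) (jacC l k) = 1 := by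
  have h := jacobiNormSq_pos hl k
  rw [jacC, map_smul, map_smul, LinearMap.smul_apply, wForm_apply]
  simp only [polyC_apply]
  rw [integral_jacobiPoly_sq hl, smul_eq_mul, smul_eq_mul, ← mul_assoc, ← mul_inv,
    Real.mul_self_sqrt h.le, inv_mul_cancel₀ h.ne']

lemma wForm_jacC_of_ne {l : ℝ} (hl : 0 < l + 1) {j k : ℕ} (h : j ≠ k) :
    wForm hl.le (jacC l j) (jacC l k) = 0 := by
  rw [jacC, jacC, map_smul, map_smul, LinearMap.smul_apply, wForm_apply]
  simp only [polyC_apply]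
  rw [integral_jacobiPoly_mul_of_ne hl h, smul_zero, smul_zero]

lemma wForm_polyC_eq_zero {a : ℝ} (ha : 0 < a) {e : C(ℝ, ℝ)} (n : ℕ)
    (h : ∀ j < n, wForm ha.le e (polyC (jacobiPoly a j)) = 0) (p : Polynomial ℝ)
    (hp : p.degree < n) : wForm ha.le e (polyC p) = 0 := by
  induction n generalizing p with
  | zero =>
    have : p = 0 := by simpa using hp
    simp [this]
  | succ n ih =>
    set c := p.coeff n / jacobiLead a n
    have h1 : wForm ha.le e (polyC (p - c • jacobiPoly a n)) = 0 := by
      refine ih (fun j hj => h j (by omega)) _ ?_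
      rw [Polynomial.degree_lt_iff_coeff_zero] at hp ⊢
      intro m hm
      rw [Polynomial.coeff_sub, Polynomial.coeff_smul, smul_eq_mul]
      rcases hm.eq_or_lt with rfl | hm
      · rw [coeff_jacobiPoly_self ha, div_mul_cancel₀ _ (jacobiLead_pos ha _).ne', sub_self]
      · rw [hp m hm, Polynomial.coeff_eq_zero_of_natDegree_lt
          ((natDegree_jacobiPoly_le a n).trans_lt hm), mul_zero, sub_zero]
    rw [map_sub, map_sub, map_smul, map_smul, h n (by omega), smul_zero, sub_zero] at h1
    exact h1

lemma wForm_odd_eq_zero {a : ℝ} (ha : 0 < a) {e : C(ℝ, ℝ)} (he : ∀ z, e (-z) = e z) {j : ℕ}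
    (hj : Odd j) : wForm ha.le e (polyC (jacobiPoly a j)) = 0 := by
  rw [wForm_apply]
  refine integral_odd_eq_zero fun z => ?_
  rw [polyC_apply, polyC_apply, jacobiPoly_comp_neg ha, hj.neg_one_pow, he]
  ring_nf

/-- The partial sum of the even Fourier–Jacobi expansion. -/
noncomputable def jacSum {l : ℝ} (hl : 0 < l + 1) (h : C(ℝ, ℝ)) (N : ℕ) : C(ℝ, ℝ) :=
  ∑ k ∈ Finset.range (N + 1), wForm hl.le h (jacC l (2 * k)) • jacC l (2 * k)

lemma wForm_sub_jacSum_jacC {l : ℝ} (hl : 0 < l + 1) (h : C(ℝ, ℝ)) {N i : ℕ} (hi : i ≤ N) :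
    wForm hl.le (h - jacSum hl h N) (jacC l (2 * i)) = 0 := by
  rw [jacSum, map_sub, LinearMap.sub_apply, map_sum, LinearMap.sum_apply,
    Finset.sum_eq_single_of_mem i (Finset.mem_range.2 (by omega))]
  · rw [map_smul, LinearMap.smul_apply, wForm_jacC_self hl, smul_eq_mul, mul_one, sub_self]
  · intro k _ hk
    rw [map_smul, LinearMap.smul_apply, wForm_jacC_of_ne hl (by omega), smul_zero]

lemma wForm_jacSum {l : ℝ} (hl : 0 < l + 1) (e h : C(ℝ, ℝ)) (N : ℕ) :
    wForm hl.le e (jacSum hl h N) = ∑ k ∈ Finset.range (N + 1),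
      wForm hl.le h (jacC l (2 * k)) * wForm hl.le e (jacC l (2 * k)) := by
  simp [jacSum, map_sum]

lemma wForm_sub_jacSum_self {l : ℝ} (hl : 0 < l + 1) (h : C(ℝ, ℝ)) (N : ℕ) :
    wForm hl.le (h - jacSum hl h N) (h - jacSum hl h N) = wForm hl.le h h -
      ∑ k ∈ Finset.range (N + 1), wForm hl.le h (jacC l (2 * k)) ^ 2 := by
  have h1 : wForm hl.le (h - jacSum hl h N) (jacSum hl h N) = 0 := by
    rw [wForm_jacSum]
    refine Finset.sum_eq_zero fun k hk => ?_
    rw [wForm_sub_jacSum_jacC hl h (Nat.lt_succ_iff.1 (Finset.mem_range.1 hk)), mul_zero]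
  rw [map_sub (wForm hl.le (h - jacSum hl h N)), h1, sub_zero, wForm_comm, map_sub, wForm_jacSum]
  simp only [sq]

lemma jacC_neg {l : ℝ} (hl : 0 < l + 1) (k : ℕ) (z : ℝ) :
    jacC l (2 * k) (-z) = jacC l (2 * k) z := by
  rw [jacC, ContinuousMap.smul_apply, ContinuousMap.smul_apply, polyC_apply, polyC_apply,
    jacobiPoly_comp_neg hl, (even_two_mul k).neg_one_pow, one_mul]

lemma jacSum_apply {l : ℝ} (hl : 0 < l + 1) (h : C(ℝ, ℝ)) (N : ℕ) (z : ℝ) :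
    jacSum hl h N z = ∑ k ∈ Finset.range (N + 1), wForm hl.le h (jacC l (2 * k)) *
      jacC l (2 * k) z := by
  simp [jacSum, ContinuousMap.sum_apply]

lemma wForm_sub_jacSum_le {l : ℝ} (hl : 0 < l + 1) {h : C(ℝ, ℝ)} (he : ∀ z, h (-z) = h z) {N : ℕ}
    {p : Polynomial ℝ} (hp : p.natDegree ≤ 2 * N) :
    wForm hl.le (h - jacSum hl h N) (h - jacSum hl h N) ≤
      wForm hl.le (h - polyC p) (h - polyC p) := by
  set e := h - jacSum hl h N with hedef
  have hev : ∀ z, e (-z) = e z := fun z => by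
    simp only [hedef, ContinuousMap.sub_apply, he, jacSum_apply, jacC_neg hl]
  have h1 : wForm hl.le e (polyC p) = 0 := by
    refine wForm_polyC_eq_zero hl (2 * N + 1) (fun j hj => ?_) p ?_
    · rcases Nat.even_or_odd' j with ⟨i, rfl | rfl⟩
      · have := wForm_sub_jacSum_jacC hl h (N := N) (i := i) (by omega)
        rw [jacC, map_smul, smul_eq_mul, mul_eq_zero, inv_eq_zero] at this
        exact this.resolve_left (Real.sqrt_pos.2 (jacobiNormSq_pos hl _)).ne'
      · exact wForm_odd_eq_zero hl hev ⟨i, rfl⟩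
    · exact Polynomial.degree_le_natDegree.trans_lt (by exact_mod_cast (by omega))
  have h2 : wForm hl.le e (jacSum hl h N) = 0 := by
    rw [wForm_jacSum]
    refine Finset.sum_eq_zero fun k hk => ?_
    rw [wForm_sub_jacSum_jacC hl h (Nat.lt_succ_iff.1 (Finset.mem_range.1 hk)), mul_zero]
  have h3 : h - polyC p = e + (jacSum hl h N - polyC p) := by rw [hedef]; abel
  have h4 : wForm hl.le e (jacSum hl h N - polyC p) = 0 := by rw [map_sub, h1, h2, sub_zero]
  rw [h3, map_add (wForm hl.le), LinearMap.add_apply, map_add (wForm hl.le e), h4,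
    map_add (wForm hl.le (jacSum hl h N - polyC p)),
    wForm_comm hl.le (jacSum hl h N - polyC p) e, h4]
  linarith [wForm_self_nonneg hl.le (jacSum hl h N - polyC p)]

lemma exists_wForm_sub_jacSum_le {l : ℝ} (hl : 0 < l + 1) {h : C(ℝ, ℝ)} (he : ∀ z, h (-z) = h z)
    {ε : ℝ} (hε : 0 < ε) (N : ℕ) :
    ∃ M, N ≤ M ∧ wForm hl.le (h - jacSum hl h M) (h - jacSum hl h M) ≤ ε := by
  obtain ⟨p, hp⟩ := exists_polynomial_near_of_continuousOn (-1) 1 h h.continuous.continuousOn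
    (√(ε / 2)) (by positivity)
  refine ⟨max N p.natDegree, le_max_left _ _, ?_⟩
  refine (wForm_sub_jacSum_le hl he (p := p) ?_).trans
    ((wForm_self_le hl.le (ε := √(ε / 2)) fun z hz => ?_).trans_eq ?_)
  · have := le_max_right N p.natDegree
    omega
  · rw [ContinuousMap.sub_apply, abs_sub_comm]
    exact (hp z hz).le
  · rw [Real.sq_sqrt (by positivity)]; ring

lemma cosT_add {u v : ℝ → ℝ} (hu : Continuous u) (hv : Continuous v) (ξ : ℝ) :
    cosT (fun t => u t + v t) ξ = cosT u ξ + cosT v ξ := by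
  simp only [cosT]
  rw [← intervalIntegral.integral_add]
  · congr 1; ext t; ring
  · exact (by fun_prop : Continuous fun t => u t * Real.cos (ξ * t)).intervalIntegrable _ _
  · exact (by fun_prop : Continuous fun t => v t * Real.cos (ξ * t)).intervalIntegrable _ _

lemma cosT_const_mul (c : ℝ) (u : ℝ → ℝ) (ξ : ℝ) : cosT (fun t => c * u t) ξ = c * cosT u ξ := by
  simp only [cosT]
  rw [← intervalIntegral.integral_const_mul]
  congr 1; ext t; ring

lemma integrableOn_dampB {a δ : ℝ} (ha : 0 ≤ a) (hδ : 0 < δ) {g u : ℝ → ℝ} (hg : Continuous g)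
    (hu : Continuous u) : IntegrableOn
      (fun ξ => ξ ^ (2 * a) * Real.exp (-(δ * ξ)) * cosT g ξ * cosT u ξ) (Ioi 0) :=
  Integrable.mul_bdd (c := ∫ t in (-1 : ℝ)..1, |u t|)
    (integrableOn_damp ha hδ (continuous_cosT hg) (abs_cosT_le hg))
    (continuous_cosT hu).aestronglyMeasurable (Eventually.of_forall (abs_cosT_le hu))

/-- `dampB` as a bilinear form. -/
noncomputable def dampForm {a δ : ℝ} (ha : 0 ≤ a) (hδ : 0 < δ) : LinearMap.BilinForm ℝ C(ℝ, ℝ) :=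
  have hi := fun f g : C(ℝ, ℝ) => integrableOn_dampB ha hδ f.continuous g.continuous
  LinearMap.mk₂ ℝ (fun f g => dampB a δ f g)
    (fun f f' g => by
      simp only [dampB]
      rw [← integral_add (hi f g) (hi f' g)]
      congr 1; ext ξ
      have : cosT (⇑(f + f')) ξ = _ := cosT_add f.continuous f'.continuous ξ
      rw [this]; ring)
    (fun c f g => by
      simp only [dampB]
      rw [smul_eq_mul, ← integral_const_mul]
      congr 1; ext ξ
      have : cosT (⇑(c • f)) ξ = _ := cosT_const_mul c f ξ
      rw [this]; ring)
    (fun f g g' => by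
      simp only [dampB]
      rw [← integral_add (hi f g) (hi f g')]
      congr 1; ext ξ
      have : cosT (⇑(g + g')) ξ = _ := cosT_add g.continuous g'.continuous ξ
      rw [this]; ring)
    (fun c f g => by
      simp only [dampB]
      rw [smul_eq_mul, ← integral_const_mul]
      congr 1; ext ξ
      have : cosT (⇑(c • g)) ξ = _ := cosT_const_mul c g ξ
      rw [this]; ring)

lemma dampForm_apply {a δ : ℝ} (ha : 0 ≤ a) (hδ : 0 < δ) (f g : C(ℝ, ℝ)) :
    dampForm ha hδ f g = dampB a δ f g := rfl

lemma dampB_self_nonneg (a δ : ℝ) (f : ℝ → ℝ) : 0 ≤ dampB a δ f f := by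
  refine setIntegral_nonneg measurableSet_Ioi fun ξ hξ => ?_
  have hξ : 0 < ξ := hξ
  rw [mul_assoc]
  exact mul_nonneg (by positivity) (mul_self_nonneg _)

/-- The weight `(1 - z ^ 2) ^ a` as a continuous function. -/
noncomputable def weightC {a : ℝ} (ha : 0 ≤ a) : C(ℝ, ℝ) := ⟨_, continuous_weight ha⟩

lemma tendsto_dampB_jacC {l : ℝ} (hl : 0 < l + 1) (h : C(ℝ, ℝ)) (m : ℕ) :
    Tendsto (fun δ => dampB (l + 1) δ ⇑(weightC hl.le * h) ⇑(weightC hl.le * jacC l (2 * m)))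
      (𝓝[>] 0) (𝓝 (specNu (l + 1) m * wForm hl.le h (jacC l (2 * m)))) := by
  obtain ⟨C, hC⟩ := exists_abs_weight_mul_le h.continuous (l + 1)
  have h1 := (tendsto_dampB_wJac hl m (weightC hl.le * h).continuous hC).const_mul
    (√(jacobiNormSq l (2 * m)))⁻¹
  rw [mul_left_comm, ← smul_eq_mul (√_)⁻¹] at h1
  rw [jacC, map_smul]
  refine h1.congr' ?_
  filter_upwards [self_mem_nhdsWithin] with δ (hδ : 0 < δ)
  have h2 := map_smul (dampForm hl.le hδ (weightC hl.le * h)) (√(jacobiNormSq l (2 * m)))⁻¹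
    (weightC hl.le * polyC (jacobiPoly (l + 1) (2 * m)))
  rw [mul_smul_comm, ← dampForm_apply hl.le hδ, h2]
  rfl

lemma mul_sum_sq_le {l : ℝ} (hl : 0 < l + 1) {h : C(ℝ, ℝ)} {K : ℝ}
    (hK : ∀ δ > 0, dampB (l + 1) δ ⇑(weightC hl.le * h) ⇑(weightC hl.le * h) ≤ K) {ν : ℝ}
    {s : Finset ℕ} (hν : 0 < ν) (hs : ∀ k ∈ s, ν ≤ specNu (l + 1) k) :
    ν * ∑ k ∈ s, wForm hl.le h (jacC l (2 * k)) ^ 2 ≤ K := by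
  set c : ℕ → ℝ := fun k => wForm hl.le h (jacC l (2 * k)) with hc
  set n : ℕ → ℝ := fun k => specNu (l + 1) k with hn
  have hn0 : ∀ k, 0 < n k := specNu_pos hl
  set U : C(ℝ, ℝ) := ∑ k ∈ s, (c k / n k) • jacC l (2 * k) with hU
  have key : ∀ f : C(ℝ, ℝ), Tendsto (fun δ => dampB (l + 1) δ ⇑(weightC hl.le * f)
      ⇑(weightC hl.le * U)) (𝓝[>] 0) (𝓝 (∑ k ∈ s, c k * wForm hl.le f (jacC l (2 * k)))) := by
    intro f
    have h1 := tendsto_finsetSum s fun k _ => (tendsto_dampB_jacC hl f k).const_mul (c k / n k)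
    refine (h1.congr' ?_).trans_eq ?_
    · filter_upwards [self_mem_nhdsWithin] with δ (hδ : 0 < δ)
      simp only [← dampForm_apply hl.le hδ, hU, Finset.mul_sum, mul_smul_comm, map_sum, map_smul,
        smul_eq_mul]
    · congr 1
      refine Finset.sum_congr rfl fun k _ => ?_
      rw [← mul_assoc, div_mul_cancel₀ _ (hn0 k).ne']
  have hUc : ∀ k ∈ s, wForm hl.le U (jacC l (2 * k)) = c k / n k := by
    intro k hk
    rw [hU, map_sum, LinearMap.sum_apply, Finset.sum_eq_single_of_mem k hk]
    · rw [map_smul, LinearMap.smul_apply, wForm_jacC_self hl, smul_eq_mul, mul_one]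
    · intro j _ hj
      rw [map_smul, LinearMap.smul_apply, wForm_jacC_of_ne hl (by omega), smul_zero]
  have hUU := key U
  rw [Finset.sum_congr rfl fun k hk => by rw [hUc k hk]] at hUU
  have hlim := (((key h).const_mul (2 * ν)).sub (hUU.const_mul (ν ^ 2)))
  have hle : 2 * ν * ∑ k ∈ s, c k * c k - ν ^ 2 * ∑ k ∈ s, c k * (c k / n k) ≤ K := by
    refine le_of_tendsto hlim ?_
    filter_upwards [self_mem_nhdsWithin] with δ (hδ : 0 < δ)
    have h0 := dampB_self_nonneg (l + 1) δ (weightC hl.le * h - ν • (weightC hl.le * U) : C(ℝ, ℝ))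
    have h1 := hK δ hδ
    have h2 := dampB_comm (l + 1) δ ⇑(weightC hl.le * U) ⇑(weightC hl.le * h)
    simp only [← dampForm_apply hl.le hδ, map_sub, map_smul, LinearMap.sub_apply,
      LinearMap.smul_apply, smul_eq_mul] at h0 h1 h2 ⊢
    rw [h2] at h0
    linarith
  have hY : ν * ∑ k ∈ s, c k * (c k / n k) ≤ ∑ k ∈ s, c k * c k := by
    rw [Finset.mul_sum]
    refine Finset.sum_le_sum fun k hk => ?_
    have h1 : ν / n k ≤ 1 := (div_le_one (hn0 k)).2 (hs k hk)
    calc ν * (c k * (c k / n k)) = ν / n k * (c k * c k) := by ring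
      _ ≤ _ := mul_le_of_le_one_left (mul_self_nonneg _) h1
  simp only [sq] at hle ⊢
  have := mul_le_mul_of_nonneg_left hY hν.le
  linarith

lemma wForm_remainder_le {l : ℝ} (hl : 0 < l + 1) {h : C(ℝ, ℝ)} (he : ∀ z, h (-z) = h z) {K : ℝ}
    (hK : ∀ δ > 0, dampB (l + 1) δ ⇑(weightC hl.le * h) ⇑(weightC hl.le * h) ≤ K) {N : ℕ}
    (hN : 1 ≤ N) : wForm hl.le (h - jacSum hl h N) (h - jacSum hl h N) ≤
      K / (2 * N : ℝ) ^ (2 * (l + 1)) := by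
  refine le_of_forall_pos_le_add fun ε hε => ?_
  obtain ⟨M, hNM, hM⟩ := exists_wForm_sub_jacSum_le hl he hε N
  have hN' : (0 : ℝ) < N := by exact_mod_cast hN
  have hν : (0 : ℝ) < (2 * N : ℝ) ^ (2 * (l + 1)) := by positivity
  have h1 := mul_sum_sq_le hl hK (s := Finset.range (M + 1) \ Finset.range (N + 1)) hν
    fun k hk => by
      rw [Finset.mem_sdiff, Finset.mem_range, Finset.mem_range] at hk
      refine le_trans ?_ (rpow_le_specNu hl (show 0 < k by omega))
      have : (N : ℝ) ≤ k := by exact_mod_cast (by omega : N ≤ k)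
      gcongr
  rw [mul_comm, ← le_div_iff₀ hν] at h1
  have h2 := Finset.sum_sdiff (f := fun k => wForm hl.le h (jacC l (2 * k)) ^ 2)
    (Finset.range_mono (show N + 1 ≤ M + 1 by omega))
  rw [wForm_sub_jacSum_self] at hM ⊢
  linarith

lemma cosT_eq_integral {u : ℝ → ℝ} (h0 : ∀ z, 1 < |z| → u z = 0) (ξ : ℝ) :
    cosT u ξ = ∫ t : ℝ, u t * Real.cos (ξ * t) := by
  rw [cosT, intervalIntegral.integral_of_le (by norm_num), ← integral_Icc_eq_integral_Ioc]
  refine setIntegral_eq_integral_of_forall_compl_eq_zero fun t ht => ?_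
  rw [h0 t (not_le.1 fun h => ht (abs_le.1 h)), zero_mul]

lemma cosT_comp_mul {u : ℝ → ℝ} (h0 : ∀ z, 1 < |z| → u z = 0) {ρ : ℝ} (hρ : 1 ≤ ρ) (ξ : ℝ) :
    cosT (fun z => u (ρ * z)) ξ = ρ⁻¹ * cosT u (ξ / ρ) := by
  have hρ0 : 0 < ρ := by linarith
  rw [cosT_eq_integral h0, cosT_eq_integral fun z hz => h0 _ (by
    rw [abs_mul, abs_of_pos hρ0]; nlinarith)]
  have := Measure.integral_comp_mul_left (fun t => u t * Real.cos (ξ / ρ * t)) ρ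
  rw [abs_of_pos (inv_pos.2 hρ0), smul_eq_mul] at this
  rw [← this]
  congr 1; ext t
  rw [← mul_assoc, div_mul_cancel₀ _ hρ0.ne']

lemma dampB_self_le {a δ s B D : ℝ} (ha : 0 ≤ a) (hδ : 0 < δ) (hs : 2 * a - 2 * s < -1)
    {v : ℝ → ℝ} (hv : Continuous v) (hB : ∀ ξ, |cosT v ξ| ≤ B)
    (hD : ∀ ξ, 0 < ξ → |cosT v ξ| ≤ D * ξ ^ (-s)) :
    dampB a δ v v ≤ B ^ 2 + D ^ 2 * ∫ ξ in Ioi (1 : ℝ), ξ ^ (2 * a - 2 * s) := by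
  have hi := integrableOn_dampB ha hδ hv hv
  rw [dampB, ← Ioc_union_Ioi_eq_Ioi (zero_le_one (α := ℝ)),
    setIntegral_union (Ioc_disjoint_Ioi le_rfl) measurableSet_Ioi
      (hi.mono_set Ioc_subset_Ioi_self) (hi.mono_set (Ioi_subset_Ioi zero_le_one))]
  have hexp : ∀ ξ : ℝ, 0 < ξ → Real.exp (-(δ * ξ)) ≤ 1 := fun ξ hξ =>
    Real.exp_le_one_iff.2 (by have := mul_pos hδ hξ; linarith)
  refine add_le_add ?_ ?_
  · calc _ ≤ ∫ ξ in Ioc (0 : ℝ) 1, B ^ 2 := by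
          refine setIntegral_mono_on (hi.mono_set Ioc_subset_Ioi_self) (by simp) measurableSet_Ioc
            fun ξ hξ => ?_
          have h1 : ξ ^ (2 * a) ≤ 1 := Real.rpow_le_one hξ.1.le hξ.2 (by linarith)
          have h2 : ξ ^ (2 * a) * Real.exp (-(δ * ξ)) ≤ 1 :=
            mul_le_one₀ h1 (Real.exp_pos _).le (hexp ξ hξ.1)
          rw [mul_assoc, ← sq]
          exact (mul_le_of_le_one_left (sq_nonneg _) h2).trans (sq_le_sq' (abs_le.1 (hB ξ)).1
            (abs_le.1 (hB ξ)).2)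
      _ = B ^ 2 := by simp
  · rw [← integral_const_mul]
    refine setIntegral_mono_on (hi.mono_set (Ioi_subset_Ioi zero_le_one))
      ((integrableOn_Ioi_rpow_of_lt hs one_pos).const_mul _) measurableSet_Ioi fun ξ hξ => ?_
    have hξ : 0 < ξ := one_pos.trans hξ
    have h1 : cosT v ξ ^ 2 ≤ (D * ξ ^ (-s)) ^ 2 :=
      sq_le_sq' (abs_le.1 (hD ξ hξ)).1 (abs_le.1 (hD ξ hξ)).2
    calc _ = Real.exp (-(δ * ξ)) * (ξ ^ (2 * a) * cosT v ξ ^ 2) := by ring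
      _ ≤ ξ ^ (2 * a) * cosT v ξ ^ 2 :=
        mul_le_of_le_one_left (by positivity) (hexp ξ hξ)
      _ ≤ ξ ^ (2 * a) * (D * ξ ^ (-s)) ^ 2 := by gcongr
      _ = D ^ 2 * (ξ ^ (2 * a) * (ξ ^ (-s)) ^ 2) := by ring
      _ = _ := by
        rw [← Real.rpow_natCast (ξ ^ (-s)), ← Real.rpow_mul hξ.le, ← Real.rpow_add hξ]
        congr 2; push_cast; ring

lemma exists_dampB_comp_mul_le {a s D : ℝ} (ha : 0 ≤ a) (hs : 2 * a - 2 * s < -1)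
    {u : ℝ → ℝ} (hu : Continuous u) (h0 : ∀ z, 1 < |z| → u z = 0) (hD0 : 0 ≤ D)
    (hD : ∀ ξ, 0 < ξ → |cosT u ξ| ≤ D * ξ ^ (-s)) :
    ∃ K, 0 ≤ K ∧ ∀ ρ ∈ Ioc (1 : ℝ) 2, ∀ δ > 0,
      dampB a δ (fun z => u (ρ * z)) (fun z => u (ρ * z)) ≤ K := by
  set B := ∫ t in (-1 : ℝ)..1, |u t|
  refine ⟨B ^ 2 + (D * 2 ^ s) ^ 2 * ∫ ξ in Ioi (1 : ℝ), ξ ^ (2 * a - 2 * s), ?_, ?_⟩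
  · refine add_nonneg (sq_nonneg _) (mul_nonneg (sq_nonneg _) ?_)
    refine setIntegral_nonneg measurableSet_Ioi fun ξ hξ => ?_
    have hξ : 0 < ξ := one_pos.trans hξ
    positivity
  · intro ρ hρ δ hδ
    have hρ0 : 0 < ρ := one_pos.trans hρ.1
    have hle : ∀ ξ, |cosT (fun z => u (ρ * z)) ξ| ≤ |cosT u (ξ / ρ)| := fun ξ => by
      rw [cosT_comp_mul h0 hρ.1.le, abs_mul, abs_of_pos (inv_pos.2 hρ0)]
      exact mul_le_of_le_one_left (abs_nonneg _) (inv_le_one_of_one_le₀ hρ.1.le)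
    refine dampB_self_le ha hδ hs (by fun_prop) (fun ξ => (hle ξ).trans (abs_cosT_le hu _))
      fun ξ hξ => (hle ξ).trans ((hD _ (by positivity)).trans ?_)
    rw [mul_assoc, Real.div_rpow hξ.le hρ0.le, Real.rpow_neg hρ0.le, div_inv_eq_mul,
      mul_comm (_ ^ _)]
    have : ρ ^ s ≤ 2 ^ s := Real.rpow_le_rpow hρ0.le hρ.2 (by linarith)
    gcongr

/-- For `1 < ρ` and `u` supported in `[-1, 1]`, the function `u (ρ z) / (1 - z ^ 2) ^ a` extended
by zero. -/
noncomputable def dilC {a : ℝ} (ha : 0 ≤ a) {u : ℝ → ℝ} (hu : Continuous u) {ρ : ℝ} (hρ : 1 < ρ) :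
    C(ℝ, ℝ) where
  toFun z := u (ρ * z) / max ((1 - z ^ 2) ^ a) ((1 - (ρ⁻¹) ^ 2) ^ a)
  continuous_toFun := by
    refine Continuous.div (by fun_prop) ((continuous_weight ha).max continuous_const) fun z => ?_
    have : (ρ⁻¹) ^ 2 < 1 := pow_lt_one₀ (by positivity) (inv_lt_one_of_one_lt₀ hρ) two_ne_zero
    have : 0 < (1 - (ρ⁻¹) ^ 2) ^ a := Real.rpow_pos_of_pos (by linarith) _
    exact (lt_max_of_lt_right this).ne'

lemma weightC_mul_dilC {a : ℝ} (ha : 0 ≤ a) {u : ℝ → ℝ} (hu : Continuous u)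
    (h0 : ∀ z, 1 < |z| → u z = 0) {ρ : ℝ} (hρ : 1 < ρ) :
    ⇑(weightC ha * dilC ha hu hρ) = fun z => u (ρ * z) := by
  ext z
  have hρ0 : 0 < ρ := one_pos.trans hρ
  change (1 - z ^ 2) ^ a * (u (ρ * z) / max ((1 - z ^ 2) ^ a) ((1 - (ρ⁻¹) ^ 2) ^ a)) = _
  rcases lt_or_ge 1 |ρ * z| with h | h
  · rw [h0 _ h]; simp
  · have h1 : (ρ⁻¹) ^ 2 < 1 := pow_lt_one₀ (by positivity) (inv_lt_one_of_one_lt₀ hρ) two_ne_zero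
    have h2 : z ^ 2 ≤ (ρ⁻¹) ^ 2 := by
      rw [abs_mul, abs_of_pos hρ0] at h
      refine sq_le_sq.2 ?_
      rw [abs_of_pos (inv_pos.2 hρ0), inv_eq_one_div, le_div_iff₀ hρ0, mul_comm]
      exact h
    rw [max_eq_left (Real.rpow_le_rpow (by linarith) (by linarith) ha)]
    exact mul_div_cancel₀ _ (Real.rpow_pos_of_pos (by linarith) _).ne'

/-- The remainder after `N` of the even Fourier–Jacobi expansion of `u / (1 - z ^ 2) ^ (l + 1)`. -/
noncomputable def jacRem (l : ℝ) (u : ℝ → ℝ) (N : ℕ) (z : ℝ) : ℝ :=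
  u z / (1 - z ^ 2) ^ (l + 1) - ∑ k ∈ Finset.range (N + 1),
    (∫ s in (-1 : ℝ)..1, u s * jacobiPNorm l (2 * k) s) * jacobiPNorm l (2 * k) z

lemma lintegral_jacRem_comp_mul_le {l K : ℝ} (hl : 0 < l + 1) {u : ℝ → ℝ} (hu : Continuous u)
    (h0 : ∀ z, 1 < |z| → u z = 0) (he : ∀ z, u (-z) = u z) {ρ : ℝ} (hρ : 1 < ρ)
    (hK : ∀ δ > 0, dampB (l + 1) δ (fun z => u (ρ * z)) (fun z => u (ρ * z)) ≤ K) {N : ℕ}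
    (hN : 1 ≤ N) :
    ∫⁻ z in Ioo (-1 : ℝ) 1, ENNReal.ofReal
      ((1 - z ^ 2) ^ (l + 1) * jacRem l (fun z => u (ρ * z)) N z ^ 2) ≤
      ENNReal.ofReal (K / (2 * N : ℝ) ^ (2 * (l + 1))) := by
  set h := dilC hl.le hu hρ
  have hw := weightC_mul_dilC hl.le hu h0 hρ
  have hwz : ∀ z, (1 - z ^ 2) ^ (l + 1) * h z = u (ρ * z) := fun z => congrFun hw z
  have hR := wForm_remainder_le hl (h := h) (fun z => by
    change u (ρ * -z) / _ = u (ρ * z) / _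
    rw [mul_neg, he, neg_sq]) (fun δ hδ => by rw [hw]; exact hK δ hδ) hN
  refine le_trans (le_of_eq ?_) (ENNReal.ofReal_le_ofReal hR)
  have hS : ∀ z ∈ Ioo (-1 : ℝ) 1, (h - jacSum hl h N) z = jacRem l (fun z => u (ρ * z)) N z := by
    intro z hz
    have hz0 := Real.rpow_pos_of_pos (one_sub_sq_pos hz) (l + 1)
    rw [ContinuousMap.sub_apply, jacSum_apply, jacRem, ← hwz, mul_div_cancel_left₀ _ hz0.ne']
    congr 1
    refine Finset.sum_congr rfl fun k _ => ?_
    rw [wForm_apply, jacC_apply]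
    simp only [hwz, jacC_apply]
  set d := h - jacSum hl h N with hd
  have hc : Continuous fun z => (1 - z ^ 2) ^ (l + 1) * d z * d z :=
    ((continuous_weight hl.le).mul d.continuous).mul d.continuous
  rw [wForm_apply, intervalIntegral.integral_of_le (by norm_num), integral_Ioc_eq_integral_Ioo,
    ofReal_integral_eq_lintegral_ofReal]
  · refine setLIntegral_congr_fun measurableSet_Ioo fun z hz => ?_
    rw [← hS z hz, sq (d z), mul_assoc]
  · exact (hc.integrableOn_Icc (a := -1) (b := 1)).mono_set Ioo_subset_Icc_self
  · refine (ae_restrict_iff' measurableSet_Ioo).2 (Eventually.of_forall fun z hz => ?_)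
    have hz0 := Real.rpow_pos_of_pos (one_sub_sq_pos hz) (l + 1)
    change 0 ≤ (1 - z ^ 2) ^ (l + 1) * d z * d z
    rw [mul_assoc]
    exact mul_nonneg hz0.le (mul_self_nonneg _)

lemma continuous_jacobiPNorm (l : ℝ) (k : ℕ) : Continuous (jacobiPNorm l k) := by
  rw [← funext (jacC_apply l k)]
  exact (jacC l k).continuous

lemma tendsto_jacRem_comp_mul {u : ℝ → ℝ} (hu : Continuous u) (l : ℝ) (N : ℕ) (z : ℝ) :
    Tendsto (fun ρ => jacRem l (fun z => u (ρ * z)) N z) (𝓝 1) (𝓝 (jacRem l u N z)) := by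
  have hc : Continuous fun ρ => jacRem l (fun z => u (ρ * z)) N z := by
    unfold jacRem
    refine Continuous.sub (by fun_prop) (continuous_finsetSum _ fun k _ => ?_)
    refine Continuous.mul ?_ continuous_const
    refine intervalIntegral.continuous_parametric_intervalIntegral_of_continuous' ?_ _ _
    have := continuous_jacobiPNorm l (2 * k)
    simp only [Function.uncurry_def]
    fun_prop
  simpa using hc.tendsto 1

lemma measurable_jacRem {l : ℝ} (hl : 0 < l + 1) {u : ℝ → ℝ} (hu : Continuous u) (N : ℕ) :
    Measurable fun z => ENNReal.ofReal ((1 - z ^ 2) ^ (l + 1) * jacRem l u N z ^ 2) := by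
  have hw := (continuous_weight hl.le).measurable
  have hP := fun k => continuous_jacobiPNorm l k
  refine ENNReal.measurable_ofReal.comp (hw.mul (Measurable.pow_const
    ((hu.measurable.div hw).sub ?_) 2))
  exact (by fun_prop : Continuous fun z => ∑ k ∈ Finset.range (N + 1),
    (∫ s in (-1 : ℝ)..1, u s * jacobiPNorm l (2 * k) s) * jacobiPNorm l (2 * k) z).measurable

lemma exists_lintegral_jacRem_le {l s D : ℝ} (hl : 0 < l + 1) (hs : 2 * (l + 1) - 2 * s < -1)
    {u : ℝ → ℝ} (hu : Continuous u) (h0 : ∀ z, 1 < |z| → u z = 0) (he : ∀ z, u (-z) = u z)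
    (hD0 : 0 ≤ D) (hD : ∀ ξ, 0 < ξ → |cosT u ξ| ≤ D * ξ ^ (-s)) :
    ∃ K, 0 ≤ K ∧ ∀ N : ℕ, 1 ≤ N → ∫⁻ z in Ioo (-1 : ℝ) 1, ENNReal.ofReal
      ((1 - z ^ 2) ^ (l + 1) * jacRem l u N z ^ 2) ≤
        ENNReal.ofReal (K / (2 * N : ℝ) ^ (2 * (l + 1))) := by
  obtain ⟨K, hK0, hK⟩ := exists_dampB_comp_mul_le hl.le hs hu h0 hD0 hD
  refine ⟨K, hK0, fun N hN => ?_⟩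
  obtain ⟨ρ, -, hρ, hρ1⟩ := exists_seq_strictAnti_tendsto' (show (1 : ℝ) < 2 by norm_num)
  have hlim : ∀ z, Tendsto (fun n => ENNReal.ofReal
      ((1 - z ^ 2) ^ (l + 1) * jacRem l (fun z => u (ρ n * z)) N z ^ 2)) atTop
      (𝓝 (ENNReal.ofReal ((1 - z ^ 2) ^ (l + 1) * jacRem l u N z ^ 2))) := fun z =>
    ENNReal.tendsto_ofReal
      ((((tendsto_jacRem_comp_mul hu l N z).comp hρ1).pow 2).const_mul _)
  have hm : ∀ n, Measurable fun z => ENNReal.ofReal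
      ((1 - z ^ 2) ^ (l + 1) * jacRem l (fun z => u (ρ n * z)) N z ^ 2) := fun n =>
    measurable_jacRem hl (by fun_prop) N
  calc _ = ∫⁻ z in Ioo (-1 : ℝ) 1, liminf (fun n => ENNReal.ofReal
      ((1 - z ^ 2) ^ (l + 1) * jacRem l (fun z => u (ρ n * z)) N z ^ 2)) atTop :=
        lintegral_congr fun z => (hlim z).liminf_eq.symm
    _ ≤ _ := lintegral_liminf_le hm
    _ ≤ _ := by
      refine liminf_le_of_le (by isBoundedDefault) fun b hb => ?_
      obtain ⟨n, hn⟩ := hb.exists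
      exact hn.trans (lintegral_jacRem_comp_mul_le hl hu h0 he (hρ n).1
        (hK _ ⟨(hρ n).1, (hρ n).2.le⟩) hN)

lemma cosT_add_cosT_mul_I_eq {x : ℝ} (hx : 0 < x) {f : ℝ → ℂ} (hfc : Continuous f)
    (heven : ∀ t, f (-t) = f t) (h0 : ∀ z, 1 < |z| → f (x * z) = 0) (ξ : ℝ) :
    (cosT (fun z => (f (x * z)).re) ξ : ℂ) + cosT (fun z => (f (x * z)).im) ξ * Complex.I =
      (x⁻¹ : ℝ) • fourierT f (ξ / x) := by
  have hx' : (x : ℂ) ≠ 0 := by exact_mod_cast hx.ne'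
  have h1 := Measure.integral_comp_mul_left
    (fun t => f t * Complex.exp (-Complex.I * (ξ / x : ℝ) * t)) x
  rw [abs_of_pos (inv_pos.2 hx)] at h1
  have h2 : ∀ t : ℝ, -Complex.I * (ξ / x : ℝ) * (x * t : ℝ) = -(Complex.I * t * ξ) := fun t => by
    push_cast; field_simp
  simp only [h2] at h1
  rw [fourierT, ← h1, cosT_eq_cexp (by fun_prop) (by simp [heven]),
    cosT_eq_cexp (by fun_prop) (by simp [heven]), ← intervalIntegral.integral_mul_const,
    ← intervalIntegral.integral_add (Continuous.intervalIntegrable (by fun_prop) _ _)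
      (Continuous.intervalIntegrable (by fun_prop) _ _),
    intervalIntegral.integral_of_le (by norm_num), ← integral_Icc_eq_integral_Ioc]
  refine Eq.trans (setIntegral_congr_fun measurableSet_Icc fun t _ => ?_)
    (setIntegral_eq_integral_of_forall_compl_eq_zero fun t ht => ?_)
  · conv_rhs => rw [← Complex.re_add_im (f (x * t))]
    ring
  · rw [h0 t (not_le.1 fun h => ht (abs_le.1 h)), zero_mul]

lemma cJ_eq {x : ℝ} {f : ℝ → ℂ} (hfc : Continuous f) (l : ℝ) (k : ℕ) :
    cJ l x f k = ((∫ z in (-1 : ℝ)..1, (f (x * z)).re * jacobiPNorm l k z : ℝ) : ℂ) +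
      (∫ z in (-1 : ℝ)..1, (f (x * z)).im * jacobiPNorm l k z : ℝ) * Complex.I := by
  have hP := continuous_jacobiPNorm l k
  rw [← intervalIntegral.integral_ofReal, ← intervalIntegral.integral_ofReal,
    ← intervalIntegral.integral_mul_const,
    ← intervalIntegral.integral_add (Continuous.intervalIntegrable (by fun_prop) _ _)
      (Continuous.intervalIntegrable (by fun_prop) _ _),
    intervalIntegral.integral_of_le (by norm_num), integral_Ioc_eq_integral_Ioo, cJ]
  refine setIntegral_congr_fun measurableSet_Ioo fun z hz => ?_
  have hw : (((1 - z ^ 2) ^ (l + 1) : ℝ) : ℂ) ≠ 0 := by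
    exact_mod_cast (Real.rpow_pos_of_pos (one_sub_sq_pos hz) (l + 1)).ne'
  conv_lhs => rw [← Complex.re_add_im (f (x * z))]
  simp only [Complex.ofReal_mul]
  field_simp

lemma enorm_remainder_sq {x l : ℝ} (hx : 0 < x) {f : ℝ → ℂ} (hfc : Continuous f) (N : ℕ) {z : ℝ}
    (hz : z ∈ Ioo (-1 : ℝ) 1) :
    (‖f (x * z) * (((1 - (x * z) ^ 2 / x ^ 2) ^ (-(l + 1) / 2) : ℝ) : ℂ) -
      (((1 - (x * z) ^ 2 / x ^ 2) ^ ((l + 1) / 2) : ℝ) : ℂ) *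
        ∑ k ∈ Finset.range (N + 1),
          cJ l x f (2 * k) * ((jacobiPNorm l (2 * k) (x * z / x) : ℝ) : ℂ)‖₊ : ENNReal) ^ 2 =
    ENNReal.ofReal ((1 - z ^ 2) ^ (l + 1) * jacRem l (fun z => (f (x * z)).re) N z ^ 2) +
      ENNReal.ofReal ((1 - z ^ 2) ^ (l + 1) * jacRem l (fun z => (f (x * z)).im) N z ^ 2) := by
  have hw := one_sub_sq_pos hz
  have hwp := Real.rpow_pos_of_pos hw (l + 1)
  have h1 : (x * z) ^ 2 / x ^ 2 = z ^ 2 := by field_simp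
  have h2 : x * z / x = z := by field_simp
  set q := (1 - z ^ 2) ^ ((l + 1) / 2) with hq
  have hq0 : 0 < q := Real.rpow_pos_of_pos hw _
  have hqq : (1 - z ^ 2) ^ (l + 1) = q * q := by
    rw [hq, ← Real.rpow_add hw, add_halves]
  have hqi : (1 - z ^ 2) ^ (-(l + 1) / 2) = q⁻¹ := by rw [neg_div, Real.rpow_neg hw.le]
  have hq' : (q : ℂ) ≠ 0 := by exact_mod_cast hq0.ne'
  rw [h1, h2, ← ENNReal.ofReal_add (by positivity) (by positivity), hqi]
  set A := jacRem l (fun z => (f (x * z)).re) N z with hA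
  set B := jacRem l (fun z => (f (x * z)).im) N z with hB
  have key : f (x * z) * ((q⁻¹ : ℝ) : ℂ) - (q : ℂ) * ∑ k ∈ Finset.range (N + 1),
      cJ l x f (2 * k) * ((jacobiPNorm l (2 * k) z : ℝ) : ℂ) =
      ((q * A : ℝ) : ℂ) + ((q * B : ℝ) : ℂ) * Complex.I := by
    simp only [hA, hB, jacRem, cJ_eq hfc, hqq]
    conv_lhs => rw [← Complex.re_add_im (f (x * z))]
    push_cast
    simp only [add_mul, Finset.sum_add_distrib, mul_right_comm _ Complex.I, ← Finset.sum_mul]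
    field_simp
    ring
  rw [key, ← enorm_eq_nnnorm, ← ofReal_norm, ← ENNReal.ofReal_pow (norm_nonneg _),
    Complex.sq_norm, Complex.normSq_add_mul_I, hqq]
  congr 1; ring

/-- convergence rate in `L²(-x,x)` of the weighted Fourier–Jacobi expansion
of a compactly supported even function whose Fourier transform decays like
`C₀/|ξ|^{ℓ-μ+2}`: for all `N` with `2N > ℓ+1`, the weighted remainder is bounded by
`C/(2N-ℓ-1)^{ℓ-μ+1}`. -/
theorem fourierJacobi_L2_convergence_rate
    (l μ x : ℝ) (hl : -(1/2 : ℝ) ≤ l) (hμ0 : 0 ≤ μ) (hμ : μ < 1/2) (hx : 0 < x)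
    (f : ℝ → ℂ) (hfc : Continuous f) (hfi : Integrable f)
    (heven : ∀ t : ℝ, f (-t) = f t)
    (hsupp : ∀ t : ℝ, t ∉ Set.Icc (-x) x → f t = 0)
    (C₀ : ℝ) (hC₀ : 0 < C₀)
    (hFT : ∀ ξ : ℝ, ξ ≠ 0 → ‖fourierT f ξ‖ ≤ C₀ / |ξ| ^ (l - μ + 2)) :
    ∃ C : ℝ, 0 < C ∧ ∀ N : ℕ, l + 1 < 2 * (N : ℝ) →
      (∫⁻ t in Set.Ioo (-x) x,
          (‖f t * (((1 - t ^ 2 / x ^ 2) ^ (-(l + 1) / 2) : ℝ) : ℂ) -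
            (((1 - t ^ 2 / x ^ 2) ^ ((l + 1) / 2) : ℝ) : ℂ) *
              ∑ k ∈ Finset.range (N + 1),
                cJ l x f (2 * k) * ((jacobiPNorm l (2 * k) (t / x) : ℝ) : ℂ)‖₊ : ENNReal) ^ 2)
        ^ (1 / 2 : ℝ) ≤
      ENNReal.ofReal (C / (2 * (N : ℝ) - l - 1) ^ (l - μ + 1)) := by
  have hl1 : 0 < l + 1 := by linarith
  have h0 : ∀ z, 1 < |z| → f (x * z) = 0 := fun z hz => hsupp _ fun h => by
    have := abs_le.2 h
    rw [abs_mul, abs_of_pos hx] at this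
    nlinarith
  have hD : ∀ ξ, 0 < ξ → ‖(cosT (fun z => (f (x * z)).re) ξ : ℂ) +
      cosT (fun z => (f (x * z)).im) ξ * Complex.I‖ ≤
        x⁻¹ * C₀ * x ^ (l - μ + 2) * ξ ^ (-(l - μ + 2)) := by
    intro ξ hξ
    rw [cosT_add_cosT_mul_I_eq hx hfc heven h0, norm_smul, Real.norm_of_nonneg (by positivity)]
    refine (mul_le_mul_of_nonneg_left (hFT (ξ / x) (by positivity)) (by positivity)).trans_eq ?_
    rw [abs_of_pos (by positivity), Real.div_rpow hξ.le hx.le, Real.rpow_neg hξ.le,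
      div_div_eq_mul_div]
    ring
  have hs : 2 * (l + 1) - 2 * (l - μ + 2) < -1 := by linarith
  have hD0 : 0 ≤ x⁻¹ * C₀ * x ^ (l - μ + 2) := by positivity
  obtain ⟨K₁, hK₁, h₁⟩ := exists_lintegral_jacRem_le hl1 hs
    (u := fun z => (f (x * z)).re) (by fun_prop) (fun z hz => by rw [h0 z hz, Complex.zero_re])
    (fun z => by rw [mul_neg, heven]) hD0 fun ξ hξ => by
      simpa using (Complex.abs_re_le_norm _).trans (hD ξ hξ)
  obtain ⟨K₂, hK₂, h₂⟩ := exists_lintegral_jacRem_le hl1 hs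
    (u := fun z => (f (x * z)).im) (by fun_prop) (fun z hz => by rw [h0 z hz, Complex.zero_im])
    (fun z => by rw [mul_neg, heven]) hD0 fun ξ hξ => by
      simpa using (Complex.abs_im_le_norm _).trans (hD ξ hξ)
  refine ⟨√(x * (K₁ + K₂)) + 1, by positivity, fun N hN => ?_⟩
  have hN1 : 1 ≤ N := Nat.one_le_iff_ne_zero.2 fun h => by
    rw [h, Nat.cast_zero] at hN; linarith
  have hN' : (1 : ℝ) ≤ N := by exact_mod_cast hN1
  have himg : Ioo (-x) x = (fun z => x * z) '' Ioo (-1) 1 := by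
    rw [image_mul_left_Ioo hx, mul_neg, mul_one]
  have hle : (2 * N - l - 1) ^ (l - μ + 1) ≤ (2 * N : ℝ) ^ (l + 1) :=
    (Real.rpow_le_rpow (by linarith) (by linarith) (by linarith)).trans
      (Real.rpow_le_rpow_of_exponent_le (by linarith) (by linarith))
  have hpos : 0 < (2 * N - l - 1) ^ (l - μ + 1) := Real.rpow_pos_of_pos (by linarith) _
  rw [himg, lintegral_image_eq_lintegral_abs_deriv_mul measurableSet_Ioo
    (fun z _ => (hasDerivAt_const_mul x).hasDerivWithinAt)
    ((mul_right_injective₀ hx.ne').injOn)]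
  rw [abs_of_pos hx, lintegral_const_mul' _ _ ENNReal.ofReal_ne_top,
    setLIntegral_congr_fun measurableSet_Ioo fun z hz => enorm_remainder_sq hx hfc N hz,
    lintegral_add_left (measurable_jacRem hl1 (by fun_prop) N)]
  have hsum := add_le_add (h₁ N hN1) (h₂ N hN1)
  rw [← ENNReal.ofReal_add (by positivity) (by positivity), ← add_div] at hsum
  calc _ ≤ (ENNReal.ofReal x * ENNReal.ofReal ((K₁ + K₂) / (2 * N : ℝ) ^ (2 * (l + 1)))) ^
        (1 / 2 : ℝ) := by gcongr
    _ = ENNReal.ofReal (√(x * (K₁ + K₂)) / (2 * N : ℝ) ^ (l + 1)) := by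
      rw [← ENNReal.ofReal_mul hx.le, ENNReal.ofReal_rpow_of_nonneg (by positivity) (by positivity),
        ← Real.sqrt_eq_rpow, ← mul_div_assoc, Real.sqrt_div (by positivity), mul_comm 2 (l + 1),
        Real.rpow_mul (by positivity), Real.rpow_two, Real.sqrt_sq (by positivity)]
    _ ≤ _ := by
      refine ENNReal.ofReal_le_ofReal ?_
      gcongr
      linarith
end
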